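/- Let X ⊂ ℙ^{n+c} be a nondegenerate smooth complex projective quadratic variety of dimension n and codimension c which is not a complete intersection, with n = 2c−1, c ≥ 3 and c even. Then c ≠ 4. -/

import Mathlib

/-!
Common framework for formalizing "Quadratic Varieties of Small Codimension"
(K. Watanabe), following Ionescu–Russo.

We model a projective variety as a subset of the complex projective space
`PS m := ℙ ℂ (Fin m → ℂ)` (which is `ℙ^{m-1}`, with `m` homogeneous coordinates).
-/

noncomputable section

open scoped BigOperators

/-- Complex projective space `ℙ^{m-1}`, described by `m` homogeneous coordinates. -/
abbrev PS (m : ℕ) : Type := Projectivization ℂ (Fin m → ℂ)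

namespace PaperQV

/-- A polynomial vanishes at a point of projective space, i.e. on the whole
corresponding line in affine space. -/
def PVanish {m : ℕ} (p : MvPolynomial (Fin m) ℂ) (x : PS m) : Prop :=
  ∀ v ∈ x.submodule, MvPolynomial.eval v p = 0

/-- The common zero locus, in projective space, of a set of polynomials. -/
def ZeroLocus {m : ℕ} (P : Set (MvPolynomial (Fin m) ℂ)) : Set (PS m) :=
  {x | ∀ p ∈ P, PVanish p x}

/-- Zariski-closed subsets of projective space. -/
def ZClosed {m : ℕ} (S : Set (PS m)) : Prop :=
  ∃ P : Set (MvPolynomial (Fin m) ℂ), S = ZeroLocus P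

/-- Zariski closure. -/
def ZClosure {m : ℕ} (S : Set (PS m)) : Set (PS m) :=
  ⋂₀ {C | ZClosed C ∧ S ⊆ C}

/-- Irreducibility with respect to the Zariski topology. -/
def ZIrreducible {m : ℕ} (S : Set (PS m)) : Prop :=
  S.Nonempty ∧ ∀ C₁ C₂ : Set (PS m), ZClosed C₁ → ZClosed C₂ → S ⊆ C₁ ∪ C₂ →
    S ⊆ C₁ ∨ S ⊆ C₂

/-- `X` contains a strictly increasing chain of `n + 1` irreducible Zariski-closed
subsets, i.e. `dim X ≥ n`. -/
def DimGE {m : ℕ} (X : Set (PS m)) (n : ℕ) : Prop :=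
  ∃ c : Fin (n + 1) → Set (PS m),
    StrictMono c ∧ ∀ i, ZClosed (c i) ∧ ZIrreducible (c i) ∧ c i ⊆ X

/-- `X` has dimension exactly `n`. -/
def HasDim {m : ℕ} (X : Set (PS m)) (n : ℕ) : Prop :=
  DimGE X n ∧ ¬ DimGE X (n + 1)

/-- The differential of a polynomial `p` at the vector `v`, as a linear functional. -/
def polyDiff {m : ℕ} (p : MvPolynomial (Fin m) ℂ) (v : Fin m → ℂ) :
    (Fin m → ℂ) →ₗ[ℂ] ℂ :=
  ∑ j, MvPolynomial.eval v (MvPolynomial.pderiv j p) • LinearMap.proj j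

/-- The Zariski tangent space at `x ∈ X` of the affine cone over `X`:
the intersection of the kernels of the differentials at `x.rep` of all
polynomials vanishing on `X`. -/
def tangentSubmodule {m : ℕ} (X : Set (PS m)) (x : PS m) :
    Submodule ℂ (Fin m → ℂ) :=
  ⨅ (p : MvPolynomial (Fin m) ℂ) (_ : ∀ y ∈ X, PVanish p y),
    LinearMap.ker (polyDiff p x.rep)

/-- `X ⊆ ℙ^{m-1}` is a smooth projective variety of dimension `n`:
it is Zariski closed, irreducible, of dimension `n`, and at every point the
Zariski tangent space of its affine cone has dimension `n + 1`. -/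
def SmoothVariety {m : ℕ} (X : Set (PS m)) (n : ℕ) : Prop :=
  ZClosed X ∧ ZIrreducible X ∧ HasDim X n ∧
    ∀ x ∈ X, Module.finrank ℂ (tangentSubmodule X x) = n + 1

/-- `X` is nondegenerate: it is contained in no hyperplane. -/
def Nondegenerate {m : ℕ} (X : Set (PS m)) : Prop :=
  ∀ φ : (Fin m → ℂ) →ₗ[ℂ] ℂ, (∀ x ∈ X, ∀ v ∈ x.submodule, φ v = 0) → φ = 0

/-- The hypersurfaces `Q i = 0` cut out `X` scheme-theoretically: `X` is their
set-theoretic intersection, and at every point of `X` the `Q i` realize the full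
Zariski tangent space (i.e. their differentials span the conormal space, so they
generate the ideal sheaf of the smooth variety `X`). -/
def SchemeCutOutBy {m k : ℕ} (X : Set (PS m)) (Q : Fin k → MvPolynomial (Fin m) ℂ) : Prop :=
  X = {x | ∀ i, PVanish (Q i) x} ∧
    ∀ x ∈ X, ∀ p : MvPolynomial (Fin m) ℂ, (∀ y ∈ X, PVanish p y) →
      (⨅ i, LinearMap.ker (polyDiff (Q i) x.rep)) ≤ LinearMap.ker (polyDiff p x.rep)

/-- `X` is scheme-theoretically defined by `c` (linearly) independent quadratic equations. -/
def CutOutByQuadrics {m : ℕ} (X : Set (PS m)) (c : ℕ) : Prop :=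
  ∃ Q : Fin c → MvPolynomial (Fin m) ℂ,
    (∀ i, (Q i).IsHomogeneous 2) ∧ LinearIndependent ℂ Q ∧ SchemeCutOutBy X Q

/-- A quadratic variety: scheme-theoretically an intersection of quadrics. -/
def IsQuadratic {m : ℕ} (X : Set (PS m)) : Prop :=
  ∃ c : ℕ, CutOutByQuadrics X c

/-- `X ⊆ ℙ^{m-1}` of dimension `n` is a complete intersection: it is cut out
scheme-theoretically by exactly `codim X = (m - 1) - n` hypersurfaces. -/
def IsCompleteIntersection {m : ℕ} (X : Set (PS m)) (n : ℕ) : Prop :=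
  ∃ F : Fin (m - 1 - n) → MvPolynomial (Fin m) ℂ, ∃ d : Fin (m - 1 - n) → ℕ,
    (∀ i, (F i).IsHomogeneous (d i)) ∧ (∀ i, 1 ≤ d i) ∧ SchemeCutOutBy X F

/-- Lines in projective space: projectivizations of 2-dimensional subspaces. -/
def IsLine {m : ℕ} (L : Set (PS m)) : Prop :=
  ∃ W : Submodule ℂ (Fin m → ℂ), Module.finrank ℂ W = 2 ∧ L = {x | x.submodule ≤ W}

/-- `X` is covered by lines. -/
def CoveredByLines {m : ℕ} (X : Set (PS m)) : Prop :=
  ∀ x ∈ X, ∃ L : Set (PS m), IsLine L ∧ x ∈ L ∧ L ⊆ X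

/-- `X` and `Y` are projectively equivalent (via a linear isomorphism of the
ambient homogeneous coordinate spaces). -/
def ProjEquiv {m₁ m₂ : ℕ} (X : Set (PS m₁)) (Y : Set (PS m₂)) : Prop :=
  ∃ (f : (Fin m₁ → ℂ) →ₗ[ℂ] (Fin m₂ → ℂ)) (hf : Function.Injective f),
    Function.Surjective f ∧ Projectivization.map f hf '' X = Y

/-- `X ⊆ ℙ^{m₁-1}` is projectively equivalent to a hyperplane section of
`S ⊆ ℙ^{m₂-1}`: a linear embedding of the ambient space of `X` onto a hyperplane
carries `X` onto the corresponding hyperplane section of `S`. -/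
def ProjEquivToHyperplaneSection {m₁ m₂ : ℕ} (X : Set (PS m₁)) (S : Set (PS m₂)) : Prop :=
  ∃ (f : (Fin m₁ → ℂ) →ₗ[ℂ] (Fin m₂ → ℂ)) (hf : Function.Injective f),
    Module.finrank ℂ (LinearMap.range f) + 1 = m₂ ∧
    Projectivization.map f hf '' X = S ∩ {y | y.submodule ≤ LinearMap.range f}

/-! ### Explicit varieties: the Segre 3-fold, the Grassmannian `G(2,ℂ⁵)`,
the 10-dimensional spinor variety, cones, and Gushel–Mukai 6-folds. -/

/-- Index bookkeeping for the Segre embedding `ℙ¹ × ℙ² → ℙ⁵`. -/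
def segreIdx : Fin 6 → Fin 2 × Fin 3 :=
  ![(0, 0), (0, 1), (0, 2), (1, 0), (1, 1), (1, 2)]

/-- The Segre coordinates of a pair of vectors. -/
def segreVec (a : Fin 2 → ℂ) (b : Fin 3 → ℂ) : Fin 6 → ℂ :=
  fun k => a (segreIdx k).1 * b (segreIdx k).2

/-- The Segre 3-fold `ℙ¹ × ℙ² ⊆ ℙ⁵`. -/
def Segre12 : Set (PS 6) :=
  {x | ∃ (a : Fin 2 → ℂ) (b : Fin 3 → ℂ) (hv : segreVec a b ≠ 0),
    x = Projectivization.mk ℂ (segreVec a b) hv}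

/-- The pairs `i < j` in `Fin 5`, indexing Plücker coordinates. -/
def pluckerPair : Fin 10 → Fin 5 × Fin 5 :=
  ![(0, 1), (0, 2), (0, 3), (0, 4), (1, 2), (1, 3), (1, 4), (2, 3), (2, 4), (3, 4)]

/-- The Plücker coordinates of the 2-plane spanned by `a`, `b` in `ℂ⁵`. -/
def pluckerVec (a b : Fin 5 → ℂ) : Fin 10 → ℂ :=
  fun k => a (pluckerPair k).1 * b (pluckerPair k).2
    - a (pluckerPair k).2 * b (pluckerPair k).1

/-- The Grassmannian `G(2, ℂ⁵) ⊆ ℙ⁹` in its Plücker embedding. -/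
def Grass25 : Set (PS 10) :=
  {x | ∃ (a b : Fin 5 → ℂ) (hv : pluckerVec a b ≠ 0),
    x = Projectivization.mk ℂ (pluckerVec a b) hv}

/-- `pfc i` lists the four elements of `Fin 5 \ {i}`, in increasing order. -/
def pfc : Fin 5 → Fin 4 → Fin 5 :=
  ![![1, 2, 3, 4], ![0, 2, 3, 4], ![0, 1, 3, 4], ![0, 1, 2, 4], ![0, 1, 2, 3]]

/-- The sub-Pfaffian of a (skew-symmetric) `5 × 5` matrix obtained by deleting
the `i`-th row and column. -/
def subPfaffian (A : Fin 5 → Fin 5 → ℂ) (i : Fin 5) : ℂ :=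
  A (pfc i 0) (pfc i 1) * A (pfc i 2) (pfc i 3)
    - A (pfc i 0) (pfc i 2) * A (pfc i 1) (pfc i 3)
    + A (pfc i 0) (pfc i 3) * A (pfc i 1) (pfc i 2)

/-- The spinor coordinates `(1, (a_{ij})_{i<j}, (Pf_i(A))_i)` of a skew-symmetric
`5 × 5` matrix: the affine parametrization of the spinor embedding. -/
def spinorTail (A : Fin 5 → Fin 5 → ℂ) : Fin 15 → ℂ :=
  (Fin.append (fun t : Fin 10 => A (pluckerPair t).1 (pluckerPair t).2)
    (subPfaffian A) : Fin (10 + 5) → ℂ)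

def spinorVec (A : Fin 5 → Fin 5 → ℂ) : Fin 16 → ℂ :=
  fun k =>
    (Fin.cons (1 : ℂ) (spinorTail A) : Fin (15 + 1) → ℂ)
      (Fin.cast (show (16 : ℕ) = 15 + 1 by norm_num) k)

/-- The 10-dimensional spinor variety `S^{10} ⊆ ℙ^{15}`: the Zariski closure of
the image of the space of skew-symmetric `5 × 5` matrices under the
sub-Pfaffian (spinor) parametrization. -/
def Spinor10 : Set (PS 16) :=
  ZClosure {x | ∃ A : Fin 5 → Fin 5 → ℂ, (∀ i j, A j i = - A i j) ∧
    ∃ hv : spinorVec A ≠ 0, x = Projectivization.mk ℂ (spinorVec A) hv}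

/-- The cone with vertex `o` over a subset `Y` of projective space. -/
def ConeOver {m : ℕ} (o : PS m) (Y : Set (PS m)) : Set (PS m) :=
  {z | z = o ∨ ∃ y ∈ Y, z.submodule ≤ o.submodule ⊔ y.submodule}

/-- Gushel–Mukai 6-folds `Σ^6_{10} ⊆ ℙ^{10}`: smooth 6-dimensional sections of
the cone over the Plücker-embedded `G(2,ℂ⁵) ⊆ ℙ⁹ ⊆ ℙ^{10}` by a smooth quadric
hypersurface. -/
def IsGushelMukai6 (W : Set (PS 11)) : Prop :=
  ∃ (f : (Fin 10 → ℂ) →ₗ[ℂ] (Fin 11 → ℂ)) (hf : Function.Injective f)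
    (o : PS 11) (q : MvPolynomial (Fin 11) ℂ),
    ¬ o.submodule ≤ LinearMap.range f ∧
    q.IsHomogeneous 2 ∧
    (∀ v : Fin 11 → ℂ, MvPolynomial.eval v q = 0 →
      (∀ j, MvPolynomial.eval v (MvPolynomial.pderiv j q) = 0) → v = 0) ∧
    W = ConeOver o (Projectivization.map f hf '' Grass25) ∩ {x | PVanish q x} ∧
    SmoothVariety W 6

/-! ### Lines through a point, the Hilbert scheme of lines `L_x`, general points. -/

/-- The line through `x` with direction vector `v` (the projectivization of the
span of `x` and `v`). -/
def LineThrough {m : ℕ} (x : PS m) (v : Fin m → ℂ) : Set (PS m) :=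
  {y | y.submodule ≤ x.submodule ⊔ Submodule.span ℂ {v}}

/-- `W ⊆ ℙ^{n-1} = ℙ(T_x X)` is a model, via the tangent map, of the Hilbert
scheme `L_x` of lines on `X` through `x`:  a linear identification `j` of `ℂⁿ`
with a complement of the line `x̂` inside the (affine cone) tangent space of `X`
at `x` carries `W` onto the set of tangent directions of lines on `X` through `x`. -/
def IsVMRTModel {m n : ℕ} (X : Set (PS m)) (x : PS m) (W : Set (PS n)) : Prop :=
  ∃ j : (Fin n → ℂ) →ₗ[ℂ] (Fin m → ℂ), Function.Injective j ∧
    LinearMap.range j ⊓ x.submodule = ⊥ ∧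
    LinearMap.range j ⊔ x.submodule = tangentSubmodule X x ∧
    W = {u : PS n | LineThrough x (j u.rep) ⊆ X}

/-- `P` holds at all points of `X` off some proper Zariski-closed subset,
i.e. at a general point of `X`. -/
def GenericallyOn {m : ℕ} (X : Set (PS m)) (P : PS m → Prop) : Prop :=
  ∃ C : Set (PS m), ZClosed C ∧ ¬ X ⊆ C ∧ ∀ x ∈ X \ C, P x

/-- The locus swept out by the lines on `X` through `x`. -/
def LocusOfLines {m : ℕ} (X : Set (PS m)) (x : PS m) : Set (PS m) :=
  ⋃₀ {L | IsLine L ∧ x ∈ L ∧ L ⊆ X}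

/-! ### Products, morphisms, double covers, conics. -/

/-- Zariski-closed subsets of a product of projective spaces (cut out by
multihomogeneous polynomials in the two groups of variables). -/
def ZClosedProd {m₁ m₂ : ℕ} (S : Set (PS m₁ × PS m₂)) : Prop :=
  ∃ P : Set (MvPolynomial (Fin m₁ ⊕ Fin m₂) ℂ),
    S = {z | ∀ p ∈ P, ∀ v ∈ z.1.submodule, ∀ w ∈ z.2.submodule,
      MvPolynomial.eval (Sum.elim v w) p = 0}

/-- `f` restricts to a morphism of projective varieties `X → Y`
(its graph over `X` is Zariski closed). -/
def IsMorphismOn {m₁ m₂ : ℕ} (X : Set (PS m₁)) (Y : Set (PS m₂))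
    (f : PS m₁ → PS m₂) : Prop :=
  Set.MapsTo f X Y ∧ ZClosedProd {z : PS m₁ × PS m₂ | z.1 ∈ X ∧ z.2 = f z.1}

/-- A double cover `X → Y`: a finite surjective morphism of degree `2`. -/
def IsDoubleCover {m₁ m₂ : ℕ} (X : Set (PS m₁)) (Y : Set (PS m₂))
    (f : PS m₁ → PS m₂) : Prop :=
  IsMorphismOn X Y f ∧ Set.SurjOn f X Y ∧
    (∀ y ∈ Y, {x | x ∈ X ∧ f x = y}.Finite) ∧
    GenericallyOn Y (fun y => {x | x ∈ X ∧ f x = y}.ncard = 2)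

/-- Irreducible conics: irreducible plane sections of quadrics that are neither
lines nor full planes. -/
def IsIrreducibleConic {m : ℕ} (C : Set (PS m)) : Prop :=
  ∃ (W : Submodule ℂ (Fin m → ℂ)) (q : MvPolynomial (Fin m) ℂ),
    Module.finrank ℂ W = 3 ∧ q.IsHomogeneous 2 ∧
    C = {x | x.submodule ≤ W ∧ PVanish q x} ∧
    ZIrreducible C ∧ ¬ IsLine C ∧ C ≠ {x | x.submodule ≤ W}

/-- "P holds for two general points of X." -/
def GenericallyOnPairs {m : ℕ} (X : Set (PS m)) (P : PS m → PS m → Prop) : Prop :=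
  ∃ B : Set (PS m × PS m), ZClosedProd B ∧ ¬ X ×ˢ X ⊆ B ∧
    ∀ x ∈ X, ∀ y ∈ X, (x, y) ∉ B → P x y

/-- `X` is conic-connected: through two general points of `X` there passes an
irreducible conic contained in `X`. -/
def ConicConnected {m : ℕ} (X : Set (PS m)) : Prop :=
  GenericallyOnPairs X fun x y =>
    ∃ C : Set (PS m), IsIrreducibleConic C ∧ C ⊆ X ∧ x ∈ C ∧ y ∈ C

/-- An interpretation of the transcendental / cohomological invariants of
embedded projective varieties used in the paper: being Fano, the Fano index,
`Pic ≅ ℤ`, degrees of normal bundles of lines, the degree, and conditions on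
`H²`, `H⁴`, Chern classes and the second Chern character. -/
structure GeomInterp where
  /-- `X` is a Fano variety. -/
  IsFanoVariety : ∀ {m : ℕ}, Set (PS m) → Prop
  /-- The Fano index of `X`: the maximal `r` such that `r` divides `-K_X` in `Pic X`. -/
  fanoIndex : ∀ {m : ℕ}, Set (PS m) → ℕ
  /-- `Pic X ≅ ℤ`. -/
  PicIsZ : ∀ {m : ℕ}, Set (PS m) → Prop
  /-- `deg N_{ℓ/X}`, the degree of the normal bundle of a line `ℓ ⊆ X`. -/
  normalBundleDeg : ∀ {m : ℕ}, Set (PS m) → Set (PS m) → ℤ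
  /-- The degree of `X`, i.e. the self-intersection number `H^{dim X}`. -/
  degreeOf : ∀ {m : ℕ}, Set (PS m) → ℕ
  /-- `H²(X, ℤ) ≅ ℤ[H]`, generated by the hyperplane class. -/
  H2GenByHyperplane : ∀ {m : ℕ}, Set (PS m) → Prop
  /-- `H⁴(X, ℤ) ≅ ℤ[H²]`. -/
  H4GenByHyperplaneSq : ∀ {m : ℕ}, Set (PS m) → Prop
  /-- `c₁(X) = a·H` in `H²(X, ℤ)`. -/
  c1Eq : ∀ {m : ℕ}, Set (PS m) → ℤ → Prop
  /-- `c₂(X) = a·H²` in `H⁴(X, ℤ)`. -/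
  c2Eq : ∀ {m : ℕ}, Set (PS m) → ℤ → Prop
  /-- `ch₂(X) = (c₁(X)² - 2c₂(X))/2 = a·H²` in `H⁴(X, ℤ)`. -/
  ch2Eq : ∀ {m : ℕ}, Set (PS m) → ℤ → Prop

end PaperQV

open PaperQV

set_option linter.unusedSectionVars false

open MvPolynomial in
/-- The kernel of the substitution that kills the first `i` variables. -/
def killIdeal (d i : ℕ) : Ideal (MvPolynomial (Fin d) ℂ) :=
  RingHom.ker (MvPolynomial.aeval (R := ℂ)
    (fun j : Fin d => if (j : ℕ) < i then (0 : MvPolynomial (Fin d) ℂ) else X j))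

instance (d i : ℕ) : (killIdeal d i).IsPrime := RingHom.ker_isPrime _

open MvPolynomial in
theorem killIdeal_lt (d i : ℕ) (hi : i < d) : killIdeal d i < killIdeal d (i + 1) := by
  refine lt_of_le_of_ne ?_ ?_
  · intro p hp
    have hp : aeval (R := ℂ) (fun j : Fin d => if (j : ℕ) < i then
        (0 : MvPolynomial (Fin d) ℂ) else X j) p = 0 := hp
    have key : ((aeval (R := ℂ) (fun j : Fin d => if (j : ℕ) < i + 1 then
        (0 : MvPolynomial (Fin d) ℂ) else X j)).comp
        (aeval (R := ℂ) (fun j : Fin d => if (j : ℕ) < i then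
        (0 : MvPolynomial (Fin d) ℂ) else X j))) =
        (aeval (R := ℂ) (fun j : Fin d => if (j : ℕ) < i + 1 then
        (0 : MvPolynomial (Fin d) ℂ) else X j)) := by
      ext1 j
      by_cases h : (j : ℕ) < i
      · have : ¬ i < (j : ℕ) := by omega
        simp [h, this]
      · simp [h]
    show aeval (R := ℂ) _ p = 0
    rw [← key, AlgHom.comp_apply, hp, map_zero]
  · intro h
    have h1 : (X ⟨i, hi⟩ : MvPolynomial (Fin d) ℂ) ∈ killIdeal d (i + 1) := by
      simp [killIdeal, RingHom.mem_ker]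
    rw [← h] at h1
    simp [killIdeal, RingHom.mem_ker] at h1

theorem le_height_killIdeal (d i : ℕ) (hi : i ≤ d) : (i : ℕ∞) ≤ (killIdeal d i).height := by
  induction i with
  | zero => simp
  | succ i ih =>
    have := Ideal.height_add_one_le_of_lt_of_isPrime (killIdeal_lt d i hi)
    push_cast
    exact le_trans (by gcongr; exact ih (by omega)) this

open MvPolynomial in
theorem exists_common_zero {N d : ℕ} (hN : N < d) (P : Fin N → MvPolynomial (Fin d) ℂ)
    (h0 : ∀ i, eval 0 (P i) = 0) : ∃ v : Fin d → ℂ, v ≠ 0 ∧ ∀ i, eval v (P i) = 0 := by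
  by_contra! hcon
  set I := Ideal.span (Set.range P) with hI
  have hz : zeroLocus ℂ I = {0} := by
    rw [hI, zeroLocus_span]
    ext v
    simp only [Set.mem_range, forall_exists_index, Set.mem_ofPred_eq, Set.mem_singleton_iff]
    constructor
    · intro h
      by_contra hv
      obtain ⟨i, hi⟩ := hcon v hv
      exact hi (by simpa [aeval_eq_eval] using h _ i rfl)
    · rintro rfl p i rfl
      simpa [aeval_eq_eval] using h0 i
  have hrad : I.radical = killIdeal d d := by
    rw [← vanishingIdeal_zeroLocus_eq_radical (K := ℂ), hz]
    ext p
    rw [mem_vanishingIdeal_singleton_iff]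
    have hf : (fun j : Fin d => if (j : ℕ) < d then (0 : MvPolynomial (Fin d) ℂ) else X j)
      = fun j => C (0 : ℂ) := by
      funext j; simp
    have : aeval (R := ℂ) (fun j : Fin d => if (j : ℕ) < d then
        (0 : MvPolynomial (Fin d) ℂ) else X j) p = C (aeval (0 : Fin d → ℂ) p) := by
      rw [hf]
      have : (aeval (R := ℂ) (fun _ : Fin d => (C 0 : MvPolynomial (Fin d) ℂ))) =
        (Algebra.ofId ℂ (MvPolynomial (Fin d) ℂ)).comp (aeval (0 : Fin d → ℂ)) := by
        ext1 j; simp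
      rw [this]; rfl
    show _ ↔ aeval (R := ℂ) _ p = 0
    rw [this]; simp
  have hmin : killIdeal d d ∈ I.minimalPrimes := by
    refine ⟨⟨inferInstance, hrad ▸ Ideal.le_radical⟩, ?_⟩
    rintro J ⟨hJ, hIJ⟩ -
    rw [← hrad]
    exact hJ.radical_le_iff.2 hIJ
  have h1 := Ideal.height_le_card_of_mem_minimalPrimes_span (Set.finite_range P) hmin
  have h2 := le_height_killIdeal d d le_rfl
  have h3 : (Set.range P).ncard ≤ N := by
    rw [← Set.image_univ]
    refine (Set.ncard_image_le).trans ?_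
    simp [Set.ncard_univ]
  have : (d : ℕ∞) ≤ N := h2.trans (h1.trans (by exact_mod_cast h3))
  exact absurd (by exact_mod_cast this) (not_le.2 hN)

/-- Functions on a complex vector space that are polynomial along every linear map from a
coordinate space. -/
def PolyFun {E : Type*} [AddCommGroup E] [Module ℂ E] (f : E → ℂ) : Prop :=
  ∀ (n : ℕ) (L : (Fin n → ℂ) →ₗ[ℂ] E), ∃ P : MvPolynomial (Fin n) ℂ,
    ∀ a, f (L a) = MvPolynomial.eval a P

namespace PolyFun

variable {E E' : Type*} [AddCommGroup E] [Module ℂ E] [AddCommGroup E'] [Module ℂ E']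
  {f g : E → ℂ}

theorem const (c : ℂ) : PolyFun (fun _ : E => c) := fun _ _ => ⟨MvPolynomial.C c, by simp⟩

theorem add (hf : PolyFun f) (hg : PolyFun g) : PolyFun (fun v => f v + g v) := by
  intro n L
  obtain ⟨P, hP⟩ := hf n L
  obtain ⟨Q, hQ⟩ := hg n L
  exact ⟨P + Q, by simp [hP, hQ]⟩

theorem mul (hf : PolyFun f) (hg : PolyFun g) : PolyFun (fun v => f v * g v) := by
  intro n L
  obtain ⟨P, hP⟩ := hf n L
  obtain ⟨Q, hQ⟩ := hg n L
  exact ⟨P * Q, by simp [hP, hQ]⟩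

theorem neg (hf : PolyFun f) : PolyFun (fun v => -f v) := by
  intro n L
  obtain ⟨P, hP⟩ := hf n L
  exact ⟨-P, by simp [hP]⟩

theorem sub (hf : PolyFun f) (hg : PolyFun g) : PolyFun (fun v => f v - g v) := by
  simpa [sub_eq_add_neg] using hf.add hg.neg

theorem sum {ι : Type*} {s : Finset ι} {f : ι → E → ℂ} (h : ∀ i ∈ s, PolyFun (f i)) :
    PolyFun (fun v => ∑ i ∈ s, f i v) := by
  classical
  induction s using Finset.induction_on with
  | empty => simpa using const (E := E) 0
  | insert a s ha ih =>
    simp only [Finset.sum_insert ha]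
    exact (h a (by simp)).add (ih fun i hi => h i (by simp [hi]))

theorem prod {ι : Type*} {s : Finset ι} {f : ι → E → ℂ} (h : ∀ i ∈ s, PolyFun (f i)) :
    PolyFun (fun v => ∏ i ∈ s, f i v) := by
  classical
  induction s using Finset.induction_on with
  | empty => simpa using const (E := E) 1
  | insert a s ha ih =>
    simp only [Finset.prod_insert ha]
    exact (h a (by simp)).mul (ih fun i hi => h i (by simp [hi]))

theorem linear (φ : E →ₗ[ℂ] ℂ) : PolyFun (fun v => φ v) := by
  intro n L
  refine ⟨∑ i, MvPolynomial.C (φ (L (Pi.single i 1))) * MvPolynomial.X i, fun a => ?_⟩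
  conv_lhs => rw [← Finset.univ_sum_single a]
  simp only [map_sum, map_mul, MvPolynomial.eval_C, MvPolynomial.eval_X]
  refine Finset.sum_congr rfl fun i _ => ?_
  have : (Pi.single i (a i) : Fin n → ℂ) = a i • Pi.single i 1 := by
    rw [← Pi.single_smul']; simp
  rw [this, map_smul, map_smul, smul_eq_mul, mul_comm]

theorem det {ι : Type*} [Fintype ι] [DecidableEq ι] {A : E → Matrix ι ι ℂ}
    (h : ∀ i j, PolyFun (fun v => A v i j)) : PolyFun (fun v => (A v).det) := by
  simp only [Matrix.det_apply']
  exact sum fun σ _ => (const _).mul (prod fun i _ => h _ _)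

theorem comp_linear (hf : PolyFun f) (T : E' →ₗ[ℂ] E) : PolyFun (fun v => f (T v)) :=
  fun n L => hf n (T ∘ₗ L)

/-- A function that is polynomial in the coordinates of a linear family is polynomial. -/
theorem bilin (B : E →ₗ[ℂ] E →ₗ[ℂ] ℂ) : PolyFun (fun v => B v v) := by
  intro n L
  choose P hP using fun i : Fin n => (linear (B (L (Pi.single i 1)))) n L
  refine ⟨∑ i, MvPolynomial.X i * P i, fun a => ?_⟩
  have : L a = ∑ i, a i • L (Pi.single i 1) := by
    conv_lhs => rw [← Finset.univ_sum_single a]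
    rw [map_sum]
    refine Finset.sum_congr rfl fun i _ => ?_
    rw [← map_smul, ← Pi.single_smul']; simp
  have h2 : B (L a) = ∑ i, a i • B (L (Pi.single i 1)) := by
    rw [this]; simp only [map_sum, map_smul]
  refine (LinearMap.congr_fun h2 (L a)).trans ?_
  simp only [map_sum, LinearMap.sum_apply, LinearMap.smul_apply, smul_eq_mul, map_mul,
    MvPolynomial.eval_X]
  exact Finset.sum_congr rfl fun i _ => by rw [← hP i a]

/-- Restriction of a polynomial function to an affine line. -/
theorem line (hf : PolyFun f) (v w : E) : ∃ p : Polynomial ℂ, ∀ t, f (v + t • w) = p.eval t := by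
  let L : (Fin 2 → ℂ) →ₗ[ℂ] E :=
    LinearMap.toSpanSingleton ℂ E v ∘ₗ LinearMap.proj 0 +
      LinearMap.toSpanSingleton ℂ E w ∘ₗ LinearMap.proj 1
  obtain ⟨P, hP⟩ := hf 2 L
  refine ⟨MvPolynomial.aeval ![1, Polynomial.X] P, fun t => ?_⟩
  have h1 := hP ![1, t]
  simp only [L, LinearMap.add_apply, LinearMap.comp_apply, LinearMap.proj_apply,
    LinearMap.toSpanSingleton_apply, Matrix.cons_val_zero, Matrix.cons_val_one, one_smul] at h1
  rw [h1]
  have : (Polynomial.aeval t).comp (MvPolynomial.aeval (R := ℂ) ![1, Polynomial.X])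
      = MvPolynomial.aeval ![1, t] := by
    ext1 i; fin_cases i <;> simp
  have h2 := DFunLike.congr_fun this P
  simpa [MvPolynomial.aeval_eq_eval, Polynomial.aeval_def, Polynomial.eval₂_eq_eval_map] using h2.symm

/-- A polynomial function not vanishing at `v` does not vanish at `v + t • w` for some nonzero `t`. -/
theorem exists_ne_line (hf : PolyFun f) {v : E} (hv : f v ≠ 0) (w : E) (s : Finset ℂ) :
    ∃ t, t ∉ s ∧ f (v + t • w) ≠ 0 := by
  obtain ⟨p, hp⟩ := hf.line v w
  have hp0 : p ≠ 0 := by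
    rintro rfl; apply hv; simpa using hp 0
  obtain ⟨t, ht⟩ := Infinite.exists_notMem_finset (s ∪ p.roots.toFinset)
  simp only [Finset.mem_union, not_or, Multiset.mem_toFinset, Polynomial.mem_roots hp0] at ht
  exact ⟨t, ht.1, by rw [hp]; exact ht.2⟩

/-- Fewer than `dim E` polynomial functions vanishing at the origin have a nonzero common zero. -/
theorem exists_zero [FiniteDimensional ℂ E] {N : ℕ} {f : Fin N → E → ℂ}
    (hf : ∀ i, PolyFun (f i)) (h0 : ∀ i, f i 0 = 0) (hN : N < Module.finrank ℂ E) :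
    ∃ v : E, v ≠ 0 ∧ ∀ i, f i v = 0 := by
  let e := (Module.finBasis ℂ E).equivFun.symm
  choose P hP using fun i => hf i _ e.toLinearMap
  obtain ⟨a, ha, h⟩ := exists_common_zero hN P (fun i => by rw [← hP]; simpa using h0 i)
  exact ⟨e a, by simpa using ha, fun i => by rw [← h i, ← hP]; rfl⟩

theorem bilin₂ (B : E →ₗ[ℂ] E →ₗ[ℂ] ℂ) (S T : E' →ₗ[ℂ] E) : PolyFun (fun v => B (S v) (T v)) :=
  bilin (B.compl₁₂ S T)

end PolyFun

section Pencil

variable {G E : Type*} [AddCommGroup G] [Module ℂ G] [FiniteDimensional ℂ G]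
  [AddCommGroup E] [Module ℂ E]

/-- A vector lying in the image of every member of an everywhere injective pencil is zero. -/
theorem pencil_eq_zero (a b : G →ₗ[ℂ] E)
    (hinj : ∀ s t : ℂ, (s, t) ≠ (0, 0) → ∀ x, s • a x + t • b x = 0 → x = 0) {y : E}
    (hy : ∀ s t : ℂ, (s, t) ≠ (0, 0) → ∃ x, s • a x + t • b x = y) : y = 0 := by
  by_contra hy0
  choose g hg using fun τ : ℂ => hy 1 τ (by simp)
  simp only [one_smul] at hg
  obtain ⟨τ₀, hτ₀⟩ : ∃ τ₀, g τ₀ ∈ Submodule.span ℂ (g '' (Set.univ \ {τ₀})) := by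
    by_contra! h
    have : LinearIndependent ℂ g := linearIndependent_iff_notMem_span.2 h
    exact Set.infinite_univ (Set.finite_univ_iff.2 this.finite)
  set Ω := Submodule.span ℂ (Set.range g) with hΩ
  let a₀ : G →ₗ[ℂ] E := a + τ₀ • b
  have ha₀ : Function.Injective a₀ := by
    rw [injective_iff_map_eq_zero]
    intro x hx
    exact hinj 1 τ₀ (by simp) x (by simpa [a₀] using hx)
  have hbo : ∀ τ, τ ≠ τ₀ → b (g τ) ∈ Ω.map a₀ := by
    intro τ hτ
    have h1 : b (g τ) = (τ₀ - τ)⁻¹ • (a₀ (g τ) - a₀ (g τ₀)) := by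
      rw [eq_inv_smul_iff₀ (sub_ne_zero.2 hτ.symm)]
      have e1 : a₀ (g τ₀) = y := by simpa [a₀] using hg τ₀
      rw [e1, ← hg τ]
      simp only [a₀, LinearMap.add_apply, LinearMap.smul_apply, sub_smul]
      abel
    rw [h1]
    refine Submodule.smul_mem _ _ (Submodule.sub_mem _ ?_ ?_) <;>
    exact Submodule.mem_map_of_mem (Submodule.subset_span ⟨_, rfl⟩)
  have hb : ∀ x ∈ Ω, b x ∈ Ω.map a₀ := by
    have h1 : Submodule.span ℂ (g '' (Set.univ \ {τ₀})) ≤ (Ω.map a₀).comap b := by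
      rw [Submodule.span_le]
      rintro _ ⟨τ, ⟨-, hτ⟩, rfl⟩
      exact hbo τ (by simpa using hτ)
    have h2 : Ω ≤ (Ω.map a₀).comap b := by
      rw [hΩ, Submodule.span_le]
      rintro _ ⟨τ, rfl⟩
      by_cases hτ : τ = τ₀
      · subst hτ; exact h1 hτ₀
      · exact hbo τ hτ
    exact h2
  let e : Ω ≃ₗ[ℂ] Ω.map a₀ := Submodule.equivMapOfInjective a₀ ha₀ Ω
  let φ : Ω →ₗ[ℂ] Ω := e.symm.toLinearMap ∘ₗ (b.restrict hb)
  have hgne : g 0 ≠ 0 := by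
    intro h; apply hy0; rw [← hg 0, h]; simp
  have : Nontrivial Ω := ⟨⟨⟨g 0, Submodule.subset_span ⟨0, rfl⟩⟩, 0, by
    simpa [Subtype.ext_iff] using hgne⟩⟩
  obtain ⟨μ, hμ⟩ := Module.End.exists_eigenvalue φ
  obtain ⟨x, hx⟩ := hμ.exists_hasEigenvector
  have h1 : b.restrict hb x = e (μ • x) := by
    rw [← hx.apply_eq_smul]; simp [φ]
  have h2 : b x = μ • a₀ x := by
    have := congrArg Subtype.val h1
    simpa [e] using this
  apply hx.2
  have h3 := hinj (-μ) (1 - μ * τ₀) (by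
    intro h
    simp only [Prod.mk.injEq, neg_eq_zero] at h
    obtain ⟨rfl, h⟩ := h
    simp at h) x (by
      simp only [a₀, LinearMap.add_apply, LinearMap.smul_apply, smul_add, smul_smul] at h2
      rw [sub_smul, one_smul, neg_smul]
      nth_rewrite 1 [h2]
      abel)
  exact Subtype.ext h3

/-- Relative version of `pencil_eq_zero`. -/
theorem pencil_mem (a b : G →ₗ[ℂ] E) (K : Submodule ℂ G) (S : Submodule ℂ E)
    (hK : ∀ s t : ℂ, (s, t) ≠ (0, 0) → ∀ x, s • a x + t • b x ∈ S ↔ x ∈ K) {y : E}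
    (hy : ∀ s t : ℂ, (s, t) ≠ (0, 0) → ∃ x, y - (s • a x + t • b x) ∈ S) : y ∈ S := by
  have ha : K ≤ S.comap a := fun x hx => by simpa using (hK 1 0 (by simp) x).2 hx
  have hb : K ≤ S.comap b := fun x hx => by simpa using (hK 0 1 (by simp) x).2 hx
  rw [← Submodule.Quotient.mk_eq_zero]
  apply pencil_eq_zero (K.mapQ S a ha) (K.mapQ S b hb)
  · intro s t hst x hx
    obtain ⟨x, rfl⟩ := Submodule.Quotient.mk_surjective _ x
    simp only [Submodule.mapQ_apply, ← Submodule.Quotient.mk_smul, ← Submodule.Quotient.mk_add,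
      Submodule.Quotient.mk_eq_zero] at hx ⊢
    exact (hK s t hst x).1 hx
  · intro s t hst
    obtain ⟨x, hx⟩ := hy s t hst
    refine ⟨Submodule.Quotient.mk x, ?_⟩
    simp only [Submodule.mapQ_apply, ← Submodule.Quotient.mk_smul, ← Submodule.Quotient.mk_add]
    exact ((Submodule.Quotient.eq S).2 hx).symm

end Pencil

theorem even_finrank_of_skew {E : Type*} [AddCommGroup E] [Module ℂ E] [FiniteDimensional ℂ E]
    (B : E →ₗ[ℂ] E →ₗ[ℂ] ℂ) (hs : ∀ x y, B x y = -B y x)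
    (hn : ∀ x, (∀ y, B x y = 0) → x = 0) : Even (Module.finrank ℂ E) := by
  let b := Module.finBasis ℂ E
  set n := Module.finrank ℂ E
  let A : Matrix (Fin n) (Fin n) ℂ := Matrix.of fun i j => B (b i) (b j)
  have hA : A.det ≠ 0 := by
    intro h
    obtain ⟨v, hv, hvA⟩ := Matrix.exists_vecMul_eq_zero_iff.2 h
    have h0 : (∑ i, v i • b i) = 0 := by
      apply hn
      suffices hB : B (∑ i, v i • b i) = 0 by intro y; rw [hB]; rfl
      refine b.ext fun j => ?_
      have := congrFun hvA j
      simpa [Matrix.vecMul, dotProduct, A, LinearMap.sum_apply] using this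
    apply hv
    funext i
    exact Fintype.linearIndependent_iff.1 b.linearIndependent v h0 i
  have hT : A.transpose = -A := by
    ext i j
    simpa [A] using hs (b j) (b i)
  have hd : A.det = (-1) ^ n * A.det := by
    conv_lhs => rw [← Matrix.det_transpose, hT, Matrix.det_neg, Fintype.card_fin]
  by_contra hodd
  rw [Nat.not_even_iff_odd] at hodd
  rw [hodd.neg_one_pow] at hd
  apply hA
  linear_combination (1/2) * hd

section Minors

variable {E : Type*} [AddCommGroup E] [Module ℂ E]

theorem exists_dual_of_linearIndependent {r : ℕ} {y : Fin r → E} (hy : LinearIndependent ℂ y) :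
    ∃ φ : Fin r → E →ₗ[ℂ] ℂ, ∀ i j, φ i (y j) = if i = j then 1 else 0 := by
  classical
  let b := Module.Basis.span hy
  have : ∀ i, ∃ φ : E →ₗ[ℂ] ℂ, φ ∘ₗ (Submodule.span ℂ (Set.range y)).subtype = b.coord i :=
    fun i => LinearMap.exists_extend _
  choose φ hφ using this
  refine ⟨φ, fun i j => ?_⟩
  have h1 := LinearMap.congr_fun (hφ i) (b j)
  have h2 : ((b j : Submodule.span ℂ (Set.range y)) : E) = y j := congrArg Subtype.val (Module.Basis.span_apply hy j)
  simp only [LinearMap.comp_apply, Submodule.subtype_apply, h2] at h1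
  rw [h1, Module.Basis.coord_apply, Module.Basis.repr_self, Finsupp.single_apply]
  simp [eq_comm]

theorem exists_det_ne_zero {r : ℕ} {y : Fin r → E} (hy : LinearIndependent ℂ y) :
    ∃ φ : Fin r → E →ₗ[ℂ] ℂ, (Matrix.of fun i j => φ i (y j)).det ≠ 0 := by
  obtain ⟨φ, h⟩ := exists_dual_of_linearIndependent hy
  refine ⟨φ, ?_⟩
  have : (Matrix.of fun i j => φ i (y j)) = 1 := by
    ext i j; simp [h, Matrix.one_apply]
  rw [this]; simp

theorem linearIndependent_of_det_ne_zero {r : ℕ} {y : Fin r → E} (φ : Fin r → E →ₗ[ℂ] ℂ)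
    (h : (Matrix.of fun i j => φ i (y j)).det ≠ 0) : LinearIndependent ℂ y := by
  rw [Fintype.linearIndependent_iff]
  intro g hg
  by_contra hne
  push Not at hne
  apply h
  rw [← Matrix.exists_mulVec_eq_zero_iff]
  refine ⟨g, fun h0 => ?_, ?_⟩
  · obtain ⟨i, hi⟩ := hne
    exact hi (congrFun h0 i)
  · funext i
    have := congrArg (φ i) hg
    simpa [Matrix.mulVec, dotProduct, mul_comm] using this

variable {X Y : Type*} [AddCommGroup X] [Module ℂ X] [AddCommGroup Y] [Module ℂ Y]
  [FiniteDimensional ℂ Y]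

/-- The rank of a linear family of linear maps is lower semicontinuous. -/
theorem exists_polyFun_rank (A : E →ₗ[ℂ] X →ₗ[ℂ] Y) (v : E) {r : ℕ}
    (hr : r ≤ Module.finrank ℂ (LinearMap.range (A v))) :
    ∃ f : E → ℂ, PolyFun f ∧ f v ≠ 0 ∧
      ∀ w, f w ≠ 0 → r ≤ Module.finrank ℂ (LinearMap.range (A w)) := by
  let b := Module.finBasis ℂ (LinearMap.range (A v))
  choose x hx using fun i => (b i).2
  let y : Fin r → X := fun i => x (Fin.castLE hr i)
  have hli : LinearIndependent ℂ (fun i => A v (y i)) := by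
    have h1 : LinearIndependent ℂ (fun i => ((b i : LinearMap.range (A v)) : Y)) :=
      b.linearIndependent.map' (LinearMap.range (A v)).subtype (by simp)
    have h2 := h1.comp (Fin.castLE hr) (Fin.castLE_injective hr)
    convert h2 using 2 with i
    exact hx _
  obtain ⟨φ, hφ⟩ := exists_det_ne_zero hli
  refine ⟨fun w => (Matrix.of fun i j => φ i (A w (y j))).det, ?_, hφ, ?_⟩
  · refine PolyFun.det fun i j => ?_
    simpa using PolyFun.linear ((φ i) ∘ₗ (A.flip (y j)))
  · intro w hw
    have h := linearIndependent_of_det_ne_zero φ hw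
    have h2 : LinearIndependent ℂ
        (fun i => (⟨A w (y i), ⟨_, rfl⟩⟩ : LinearMap.range (A w))) :=
      LinearIndependent.of_comp (LinearMap.range (A w)).subtype (by exact h)
    simpa using h2.fintype_card_le_finrank

end Minors

section Orthogonality

variable {F : Type*} [AddCommGroup F] [Module ℂ F] [FiniteDimensional ℂ F]

/-- The orthogonal complement of a subspace for a bilinear form. -/
def perp (B : F →ₗ[ℂ] F →ₗ[ℂ] ℂ) (W : Submodule ℂ F) : Submodule ℂ F where
  carrier := {x | ∀ y ∈ W, B x y = 0}
  add_mem' := fun ha hb y hy => by simp [ha y hy, hb y hy]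
  zero_mem' := fun y _ => by simp
  smul_mem' := fun c x hx y hy => by simp [hx y hy]

variable {B : F →ₗ[ℂ] F →ₗ[ℂ] ℂ}

theorem mem_perp {W : Submodule ℂ F} {x : F} : x ∈ perp B W ↔ ∀ y ∈ W, B x y = 0 := Iff.rfl

theorem finrank_perp (hs : ∀ x y, B x y = B y x) (hn : ∀ x, (∀ y, B x y = 0) → x = 0)
    (W : Submodule ℂ F) :
    Module.finrank ℂ W + Module.finrank ℂ (perp B W) = Module.finrank ℂ F := by
  have h := LinearMap.BilinForm.finrank_add_finrank_orthogonal' (B := B) W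
  have hk : LinearMap.ker B = ⊥ := by
    rw [LinearMap.ker_eq_bot']
    intro x hx
    exact hn x fun y => by rw [hx]; rfl
  have hp : perp B W = LinearMap.BilinForm.orthogonal B W := by
    ext x
    rw [LinearMap.BilinForm.mem_orthogonal_iff, mem_perp]
    exact forall₂_congr fun y _ => by rw [hs]
  rw [hp, h]
  simp [hk]

theorem perp_perp (hs : ∀ x y, B x y = B y x) (hn : ∀ x, (∀ y, B x y = 0) → x = 0)
    (W : Submodule ℂ F) : perp B (perp B W) = W := by
  symm
  apply Submodule.eq_of_le_of_finrank_le
  · intro x hx y hy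
    rw [hs]; exact hy x hx
  · have h1 := finrank_perp hs hn W
    have h2 := finrank_perp hs hn (perp B W)
    omega

/-- A maximal isotropic subspace equals its orthogonal complement. -/
theorem perp_eq_self (hs : ∀ x y, B x y = B y x) (hn : ∀ x, (∀ y, B x y = 0) → x = 0)
    {W : Submodule ℂ F} (hW : ∀ x ∈ W, ∀ y ∈ W, B x y = 0)
    (hd : Module.finrank ℂ F ≤ 2 * Module.finrank ℂ W) : perp B W = W := by
  symm
  apply Submodule.eq_of_le_of_finrank_le (show W ≤ perp B W from fun x hx y hy => hW x hx y hy)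
  have := finrank_perp hs hn W
  omega

theorem two_mul_finrank_le (hs : ∀ x y, B x y = B y x) (hn : ∀ x, (∀ y, B x y = 0) → x = 0)
    {W : Submodule ℂ F} (hW : ∀ x ∈ W, ∀ y ∈ W, B x y = 0) :
    2 * Module.finrank ℂ W ≤ Module.finrank ℂ F := by
  have h1 : Module.finrank ℂ W ≤ Module.finrank ℂ (perp B W) :=
    Submodule.finrank_mono (show W ≤ perp B W from fun x hx y hy => hW x hx y hy)
  have := finrank_perp hs hn W
  omega

end Orthogonality

section Flat

variable {P L F : Type*} [AddCommGroup P] [Module ℂ P] [FiniteDimensional ℂ P]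
  [AddCommGroup L] [Module ℂ L] [FiniteDimensional ℂ L]
  [AddCommGroup F] [Module ℂ F] [FiniteDimensional ℂ F]

/-- The space swept out by a vector under a linear family of maps. -/
def orb (M : P →ₗ[ℂ] L →ₗ[ℂ] F) (z : L) : Submodule ℂ F := LinearMap.range (M.flip z)

/-- The members of a linear family of maps that kill a vector. -/
def stab (M : P →ₗ[ℂ] L →ₗ[ℂ] F) (z : L) : Submodule ℂ P := LinearMap.ker (M.flip z)

/-- The members of a linear family of maps that send `z` into the space swept out by `u`. -/
def link (M : P →ₗ[ℂ] L →ₗ[ℂ] F) (z u : L) : Submodule ℂ P := (orb M u).comap (M.flip z)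

variable {M : P →ₗ[ℂ] L →ₗ[ℂ] F}

theorem orb_mem (p : P) (z : L) : M p z ∈ orb M z := ⟨p, rfl⟩

theorem mem_stab {z : L} {p : P} : p ∈ stab M z ↔ M p z = 0 := Iff.rfl

theorem mem_link {z u : L} {p : P} : p ∈ link M z u ↔ M p z ∈ orb M u := Iff.rfl

theorem finrank_orb_add (z : L) :
    Module.finrank ℂ (orb M z) + Module.finrank ℂ (stab M z) = Module.finrank ℂ P :=
  LinearMap.finrank_range_add_finrank_ker _

theorem stab_le_link (z u : L) : stab M z ≤ link M z u := fun p hp => by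
  rw [mem_link, mem_stab.1 hp]; exact zero_mem _

theorem finrank_comap_add {E E' : Type*} [AddCommGroup E] [Module ℂ E] [FiniteDimensional ℂ E]
    [AddCommGroup E'] [Module ℂ E'] [FiniteDimensional ℂ E'] (T : E →ₗ[ℂ] E') (W : Submodule ℂ E') :
    Module.finrank ℂ (W.comap T) = Module.finrank ℂ (LinearMap.ker T) +
      Module.finrank ℂ (LinearMap.range T ⊓ W : Submodule ℂ E') := by
  have h := LinearMap.finrank_range_add_finrank_ker (T.domRestrict (W.comap T))
  have h1 : LinearMap.range (T.domRestrict (W.comap T)) = LinearMap.range T ⊓ W := by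
    ext y
    constructor
    · rintro ⟨x, rfl⟩
      exact ⟨⟨x, rfl⟩, x.2⟩
    · rintro ⟨⟨x, rfl⟩, hx⟩
      exact ⟨⟨x, hx⟩, rfl⟩
  have h2 : Module.finrank ℂ (LinearMap.ker (T.domRestrict (W.comap T))) =
      Module.finrank ℂ (LinearMap.ker T) := by
    have : LinearMap.ker T = (LinearMap.ker (T.domRestrict (W.comap T))).map
        (W.comap T).subtype := by
      ext x
      constructor
      · intro hx
        refine ⟨⟨x, ?_⟩, hx, rfl⟩
        rw [Submodule.mem_comap, LinearMap.mem_ker.1 hx]; exact zero_mem _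
      · rintro ⟨y, hy, rfl⟩
        exact hy
    rw [this]
    exact (LinearEquiv.finrank_eq (Submodule.equivMapOfInjective _ (Submodule.subtype_injective _) _))
  rw [h1, h2] at h
  omega

theorem finrank_link (z u : L) : Module.finrank ℂ (link M z u) =
    Module.finrank ℂ (stab M z) + Module.finrank ℂ (orb M z ⊓ orb M u : Submodule ℂ F) :=
  finrank_comap_add _ _

/-- A linear family of maps whose values span isotropic subspaces for a nondegenerate symmetric
bilinear form. -/
structure IsFlat (M : P →ₗ[ℂ] L →ₗ[ℂ] F) (B : F →ₗ[ℂ] F →ₗ[ℂ] ℂ) : Prop where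
  symm : ∀ x y, B x y = B y x
  nondeg : ∀ x, (∀ y, B x y = 0) → x = 0
  flat : ∀ p l, B (M p l) (M p l) = 0

/-- The vectors sweeping out a maximal isotropic subspace. -/
def IsLagr (M : P →ₗ[ℂ] L →ₗ[ℂ] F) (z : L) : Prop :=
  2 * Module.finrank ℂ (orb M z) = Module.finrank ℂ F

namespace IsFlat

variable {B : F →ₗ[ℂ] F →ₗ[ℂ] ℂ} (h : IsFlat M B)
include h

theorem self (p : P) (l m : L) : B (M p l) (M p m) = 0 := by
  have h1 := h.flat p (l + m)
  simp only [map_add, LinearMap.add_apply, h.flat, h.symm (M p m) (M p l)] at h1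
  linear_combination (1/2) * h1

theorem skew (p q : P) (l m : L) : B (M p l) (M q m) = -B (M q l) (M p m) := by
  have h1 := h.self (p + q) l m
  simp only [map_add, LinearMap.add_apply, h.self] at h1
  linear_combination h1

theorem isotropic {z : L} {x y : F} (hx : x ∈ orb M z) (hy : y ∈ orb M z) : B x y = 0 := by
  obtain ⟨p, rfl⟩ := hx
  obtain ⟨q, rfl⟩ := hy
  have h1 := h.skew p q z z
  rw [h.symm (M q z)] at h1
  show B (M p z) (M q z) = 0
  linear_combination (1/2) * h1

theorem two_mul_le (z : L) : 2 * Module.finrank ℂ (orb M z) ≤ Module.finrank ℂ F :=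
  two_mul_finrank_le h.symm h.nondeg fun _ hx _ hy => h.isotropic hx hy

theorem perp_orb {z : L} (hz : IsLagr M z) : perp B (orb M z) = orb M z :=
  perp_eq_self h.symm h.nondeg (fun _ hx _ hy => h.isotropic hx hy) hz.ge

theorem mem_orb_iff {z : L} (hz : IsLagr M z) {x : F} :
    x ∈ orb M z ↔ ∀ p, B x (M p z) = 0 := by
  rw [← h.perp_orb hz, mem_perp]
  exact ⟨fun hx p => hx _ (orb_mem p z), fun hx y ⟨p, hp⟩ => hp ▸ hx p⟩

theorem mem_orb_of_stab {z : L} (hz : IsLagr M z) {p : P} (hp : M p z = 0) (l : L) :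
    M p l ∈ orb M z := by
  rw [h.mem_orb_iff hz]
  intro q
  rw [h.skew, hp, map_zero, neg_zero]

theorem link_comm {z u : L} (hz : IsLagr M z) (hu : IsLagr M u) : link M z u = link M u z := by
  ext p
  rw [mem_link, mem_link, h.mem_orb_iff hz, h.mem_orb_iff hu]
  refine forall_congr' fun q => ?_
  rw [h.skew, neg_eq_zero, h.symm]

theorem mem_link_iff {z u : L} (hu : IsLagr M u) {p : P} :
    p ∈ link M z u ↔ ∀ q, B (M p z) (M q u) = 0 := by
  rw [mem_link, h.mem_orb_iff hu]

theorem finrank_stab {z u : L} (hz : IsLagr M z) (hu : IsLagr M u) :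
    Module.finrank ℂ (stab M z) = Module.finrank ℂ (stab M u) := by
  have h1 := finrank_orb_add (M := M) z
  have h2 := finrank_orb_add (M := M) u
  unfold IsLagr at hz hu
  omega

theorem even_sub {z u : L} (hz : IsLagr M z) (hu : IsLagr M u) :
    Even (Module.finrank ℂ (orb M z) -
      Module.finrank ℂ (orb M z ⊓ orb M u : Submodule ℂ F)) := by
  obtain ⟨C, hC⟩ := Submodule.exists_isCompl (link M z u)
  have h1 := Submodule.finrank_add_eq_of_isCompl hC
  have h2 := finrank_orb_add (M := M) z
  have h3 := finrank_link (M := M) z u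
  have h4 : Module.finrank ℂ (orb M z) -
      Module.finrank ℂ (orb M z ⊓ orb M u : Submodule ℂ F) = Module.finrank ℂ C := by omega
  rw [h4]
  let Om : P →ₗ[ℂ] P →ₗ[ℂ] ℂ := B.compl₁₂ (M.flip z) (M.flip u)
  have hOm : ∀ p q, Om p q = B (M p z) (M q u) := fun p q => rfl
  have hsk : ∀ p q, Om p q = -Om q p := by
    intro p q
    rw [hOm, hOm, h.skew]
  refine even_finrank_of_skew (Om.compl₁₂ C.subtype C.subtype) (fun x y => hsk x y) ?_
  intro x hx
  have hxl : (x : P) ∈ link M z u := by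
    rw [h.mem_link_iff hu]
    intro q
    obtain ⟨y, hy, w, hw, rfl⟩ := Submodule.mem_sup.1 (hC.sup_eq_top ▸ Submodule.mem_top : q ∈ _)
    have e1 : Om x y = 0 := by
      rw [hsk, hOm, (h.mem_link_iff hu).1 hy, neg_zero]
    have e2 : Om x w = 0 := hx ⟨w, hw⟩
    rw [← hOm, map_add, e1, e2, add_zero]
  have := hC.disjoint.le_bot ⟨hxl, x.2⟩
  exact Subtype.ext this

/-- If two swept-out spaces meet, then some member of the family takes proportional values. -/
theorem exists_proportional {z u : L} (hz : IsLagr M z) (hu : IsLagr M u)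
    (hW : orb M z ⊓ orb M u ≠ ⊥) : ∃ p, ∃ ν : ℂ, M p z ≠ 0 ∧ M p u = ν • M p z := by
  obtain ⟨σ, hσ⟩ := LinearMap.exists_rightInverse_of_surjective (M.flip z).rangeRestrict
    (LinearMap.range_rangeRestrict _)
  let W : Submodule ℂ F := orb M z ⊓ orb M u
  have hs : ∀ y : orb M z, M (σ y) z = y := fun y =>
    congrArg Subtype.val (LinearMap.congr_fun hσ y)
  let τ : W →ₗ[ℂ] P := σ ∘ₗ Submodule.inclusion inf_le_left
  have ht : ∀ y : W, M (τ y) z = y := fun y => hs _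
  have hmem : ∀ y : W, (M.flip u ∘ₗ τ) y ∈ W := by
    intro y
    refine ⟨?_, orb_mem _ _⟩
    have h1 : τ y ∈ link M z u := by rw [mem_link, ht]; exact y.2.2
    rw [h.link_comm hz hu, mem_link] at h1
    exact h1
  let T : Module.End ℂ W := (M.flip u ∘ₗ τ).codRestrict W hmem
  have : Nontrivial W := Submodule.nontrivial_iff_ne_bot.2 hW
  obtain ⟨ν, hν⟩ := Module.End.exists_eigenvalue T
  obtain ⟨y, hy⟩ := hν.exists_hasEigenvector
  refine ⟨τ y, ν, ?_, ?_⟩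
  · rw [ht]; exact fun h0 => hy.2 (Subtype.ext h0)
  · have := congrArg Subtype.val hy.apply_eq_smul
    rw [ht]; exact this

end IsFlat

end Flat

section Singular

variable {E W W' : Type*} [AddCommGroup E] [Module ℂ E] [FiniteDimensional ℂ E]
  [AddCommGroup W] [Module ℂ W] [FiniteDimensional ℂ W]
  [AddCommGroup W'] [Module ℂ W'] [FiniteDimensional ℂ W']

/-- Fewer polynomial functions vanishing at the origin than the dimension of a subspace have a
common nonzero zero in that subspace. -/
theorem PolyFun.exists_mem_zero {ι : Type*} [Fintype ι] (R : Submodule ℂ E) {f : ι → E → ℂ}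
    (hf : ∀ i, PolyFun (f i)) (h0 : ∀ i, f i 0 = 0) (hN : Fintype.card ι < Module.finrank ℂ R) :
    ∃ v ∈ R, v ≠ 0 ∧ ∀ i, f i v = 0 := by
  let e := Fintype.equivFin ι
  obtain ⟨v, hv, h⟩ := PolyFun.exists_zero (E := R) (f := fun i v => f (e.symm i) v)
    (fun i => (hf _).comp_linear R.subtype) (fun i => by simpa using h0 _) hN
  exact ⟨v, v.2, by simpa using hv, fun i => by simpa using h (e i)⟩

/-- A linear family of square systems degenerates somewhere on the common zero locus of few
polynomial functions. -/
theorem PolyFun.exists_singular {ι : Type*} [Fintype ι] (R : Submodule ℂ E) {f : ι → E → ℂ}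
    (hf : ∀ i, PolyFun (f i)) (h0 : ∀ i, f i 0 = 0)
    (hN : Fintype.card ι + 1 < Module.finrank ℂ R) (T : E →ₗ[ℂ] W →ₗ[ℂ] W')
    (hW : Module.finrank ℂ W' ≤ Module.finrank ℂ W) (hW0 : 0 < Module.finrank ℂ W) :
    ∃ v ∈ R, v ≠ 0 ∧ (∀ i, f i v = 0) ∧ ∃ y, y ≠ 0 ∧ T v y = 0 := by
  rcases hW.lt_or_eq with hlt | heq
  · obtain ⟨v, hvR, hv, h⟩ := PolyFun.exists_mem_zero R hf h0 (by omega)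
    have : LinearMap.ker (T v) ≠ ⊥ := by
      intro hk
      have := LinearMap.finrank_le_finrank_of_injective (LinearMap.ker_eq_bot.1 hk)
      omega
    obtain ⟨y, hy, hy0⟩ := Submodule.exists_mem_ne_zero_of_ne_bot this
    exact ⟨v, hvR, hv, h, y, hy0, hy⟩
  let φ : W' ≃ₗ[ℂ] W := LinearEquiv.ofFinrankEq _ _ heq
  let b := Module.finBasis ℂ W
  let D : E → ℂ := fun v => LinearMap.det (φ.toLinearMap ∘ₗ T v)
  have hD : PolyFun D := by
    have : D = fun v => (Matrix.of fun i j => b.coord i (φ (T v (b j)))).det := by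
      funext v
      simp only [D]
      rw [← LinearMap.det_toMatrix b]
      congr 1
      ext i j
      rw [LinearMap.toMatrix_apply]
      rfl
    rw [this]
    refine PolyFun.det fun i j => ?_
    exact PolyFun.linear (b.coord i ∘ₗ φ.toLinearMap ∘ₗ T.flip (b j))
  obtain ⟨v, hvR, hv, h⟩ := PolyFun.exists_mem_zero (ι := Option ι) R
    (f := fun i => Option.elim i D f)
    (by rintro (_ | i); exacts [hD, hf i])
    (by
      rintro (_ | i)
      · simp only [Option.elim, D, map_zero, LinearMap.comp_zero]
        have : Nontrivial W := Module.finrank_pos_iff.1 hW0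
        exact LinearMap.det_zero''
      · exact h0 i)
    (by simpa using hN)
  refine ⟨v, hvR, hv, fun i => h (some i), ?_⟩
  have hd : LinearMap.det (φ.toLinearMap ∘ₗ T v) = 0 := h none
  have := LinearMap.bot_lt_ker_of_det_eq_zero hd
  obtain ⟨y, hy, hy0⟩ := Submodule.exists_mem_ne_zero_of_ne_bot this.ne'
  refine ⟨y, hy0, ?_⟩
  have : φ (T v y) = 0 := hy
  simpa using this

end Singular

section Const

variable {P L F : Type*} [AddCommGroup P] [Module ℂ P] [FiniteDimensional ℂ P]
  [AddCommGroup L] [Module ℂ L] [FiniteDimensional ℂ L]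
  [AddCommGroup F] [Module ℂ F] [FiniteDimensional ℂ F]
  {M : P →ₗ[ℂ] L →ₗ[ℂ] F} {B : F →ₗ[ℂ] F →ₗ[ℂ] ℂ}

namespace IsFlat

/-- The vectors sweeping out a maximal isotropic subspace are dense in every direction. -/
theorem exists_isLagr_line (h : IsFlat M B) {z : L} (hz : IsLagr M z) (l : L) :
    ∃ t : ℂ, t ≠ 0 ∧ IsLagr M (z + t • l) := by
  obtain ⟨f, hf, hfz, hfr⟩ := exists_polyFun_rank M.flip z (r := Module.finrank ℂ (orb M z)) le_rfl
  obtain ⟨t, ht, hft⟩ := hf.exists_ne_line hfz l {0}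
  refine ⟨t, by simpa using ht, ?_⟩
  have h1 := hfr _ hft
  have h2 := h.two_mul_le (z + t • l)
  have h3 : Module.finrank ℂ (orb M z) ≤ Module.finrank ℂ (orb M (z + t • l)) := h1
  unfold IsLagr at hz ⊢
  omega

theorem apply_mem_of_forall (h : IsFlat M B) {z : L} (hz : IsLagr M z) {U : Submodule ℂ F}
    {p : P} (hU : ∀ u, IsLagr M u → M p u ∈ U) (l : L) : M p l ∈ U := by
  obtain ⟨t, ht, hl⟩ := h.exists_isLagr_line hz l
  have h1 := U.sub_mem (hU _ hl) (hU _ hz)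
  rw [map_add, add_sub_cancel_left, map_smul] at h1
  exact (U.smul_mem_iff ht).1 h1

theorem apply_mem_of_const (h : IsFlat M B) {z : L} (hz : IsLagr M z)
    (hU : ∀ u, IsLagr M u → orb M u = orb M z) (p : P) (l : L) : M p l ∈ orb M z :=
  h.apply_mem_of_forall hz (fun u hu => hU u hu ▸ orb_mem p u) l

theorem finrank_orb_eq {z u : L} (hz : IsLagr M z) (hu : IsLagr M u) :
    Module.finrank ℂ (orb M z) = Module.finrank ℂ (orb M u) := by
  unfold IsLagr at hz hu
  omega

theorem orb_eq_of_le {z u : L} (hz : IsLagr M z) (hu : IsLagr M u)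
    (hle : Module.finrank ℂ (orb M z) ≤ Module.finrank ℂ (orb M z ⊓ orb M u : Submodule ℂ F)) :
    orb M u = orb M z := by
  have h1 : orb M z ⊓ orb M u = orb M z := Submodule.eq_of_le_of_finrank_le inf_le_left hle
  have h2 : orb M z ⊓ orb M u = orb M u :=
    Submodule.eq_of_le_of_finrank_le inf_le_right (finrank_orb_eq hz hu ▸ hle)
  rw [← h2, h1]

/-- If two swept-out spaces meet in a subspace common to all of them, and every member of the
family kills a generic vector, then these spaces coincide. -/
theorem orb_le_of_inf_le (h : IsFlat M B) (hker : ∀ p, ∃ z, IsLagr M z ∧ M p z = 0)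
    {C : Submodule ℂ F} {l m : L} (hl : IsLagr M l) (hm : IsLagr M m)
    (hC : orb M l ⊓ orb M m ≤ C) (hC' : ∀ n, IsLagr M n → C ≤ orb M n) : orb M l ≤ C := by
  have hCM : ∀ c ∈ C, ∀ p n, B c (M p n) = 0 := by
    intro c hc p n
    have := h.apply_mem_of_forall hl (U := LinearMap.ker (B c)) (p := p)
      (fun u hu => h.isotropic (hC' u hu hc) (orb_mem p u)) n
    exact this
  have hrank : ∀ n, IsLagr M n → Module.finrank ℂ (C.comap (M.flip n)) =
      Module.finrank ℂ (stab M n) + Module.finrank ℂ C := by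
    intro n hn
    have h1 := finrank_comap_add (M.flip n) C
    have h2 : LinearMap.range (M.flip n) ⊓ C = C := inf_eq_right.2 (hC' n hn)
    rw [h2] at h1
    exact h1
  have hlm : C.comap (M.flip l) = link M l m := by
    ext p
    exact ⟨fun hp => hC' m hm hp, fun hp => hC ⟨orb_mem p l, hp⟩⟩
  have hml : C.comap (M.flip m) = link M m l := by
    ext p
    exact ⟨fun hp => hC' l hl hp, fun hp => hC ⟨hp, orb_mem p m⟩⟩
  have hPi : ∀ p, M p l ∈ C → ∀ n, M p n ∈ C := by
    intro p hp n
    have hp' : M p m ∈ C := by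
      have : p ∈ C.comap (M.flip m) := by
        rw [hml, ← h.link_comm hl hm, ← hlm]; exact hp
      exact this
    refine hC ⟨?_, ?_⟩
    · refine (h.mem_orb_iff hl).2 fun q => ?_
      rw [h.skew, h.symm, hCM _ hp, neg_zero]
    · refine (h.mem_orb_iff hm).2 fun q => ?_
      rw [h.skew, h.symm, hCM _ hp', neg_zero]
  rintro _ ⟨p, rfl⟩
  obtain ⟨z, hz, hpz⟩ := hker p
  have hle : C.comap (M.flip l) ≤ C.comap (M.flip z) := fun q hq => hPi q hq z
  have heq : C.comap (M.flip l) = C.comap (M.flip z) :=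
    Submodule.eq_of_le_of_finrank_le hle (by
      rw [hrank _ hl, hrank _ hz, h.finrank_stab hl hz])
  have : p ∈ C.comap (M.flip l) := by
    rw [heq, Submodule.mem_comap, LinearMap.flip_apply, hpz]
    exact zero_mem _
  exact this

end IsFlat

/-- The data of a flat family together with a locus, cut out by few equations, of vectors
sweeping out maximal isotropic subspaces. -/
structure FlatLocus {e : ℕ} (M : P →ₗ[ℂ] L →ₗ[ℂ] F) (B : F →ₗ[ℂ] F →ₗ[ℂ] ℂ)
    (g : Fin e → L → ℂ) : Prop extends IsFlat M B where
  poly : ∀ i, PolyFun (g i)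
  zero : ∀ i, g i 0 = 0
  lagr : ∀ z, z ≠ 0 → (∀ i, g i z = 0) → IsLagr M z
  line : ∀ z, z ≠ 0 → (∀ i, g i z = 0) → ∃ u, ∀ s t : ℂ, (s, t) ≠ (0, 0) →
    s • z + t • u ≠ 0 ∧ ∀ i, g i (s • z + t • u) = 0

variable {e : ℕ} {g : Fin e → L → ℂ}

namespace FlatLocus

theorem exists_mem (h : FlatLocus M B g) (R : Submodule ℂ L) (hR : e < Module.finrank ℂ R) :
    ∃ z ∈ R, z ≠ 0 ∧ ∀ i, g i z = 0 :=
  PolyFun.exists_mem_zero R h.poly h.zero (by simpa using hR)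

theorem finrank_ker (h : FlatLocus M B g) (p : P) :
    2 * Module.finrank ℂ L ≤ 2 * Module.finrank ℂ (LinearMap.ker (M p)) + Module.finrank ℂ F := by
  have h1 := LinearMap.finrank_range_add_finrank_ker (M p)
  have h2 := two_mul_finrank_le h.symm h.nondeg (W := LinearMap.range (M p)) (by
    rintro _ ⟨x, rfl⟩ _ ⟨y, rfl⟩
    exact h.self p x y)
  omega

theorem stab_ne (h : FlatLocus M B g) {z : L} (hz0 : z ≠ 0) (hz : ∀ i, g i z = 0)
    (hodd : ∀ u v, IsLagr M u → IsLagr M v → orb M u ⊓ orb M v ≠ ⊥) :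
    ∃ u, u ≠ 0 ∧ (∀ i, g i u = 0) ∧ ∃ p, M p u = 0 ∧ ∃ l, M p l ≠ 0 := by
  obtain ⟨u, hu⟩ := h.line z hz0 hz
  have hu1 := hu 0 1 (by simp)
  simp only [zero_smul, one_smul, zero_add] at hu1
  have hzl := h.lagr z hz0 hz
  have hul := h.lagr u hu1.1 hu1.2
  obtain ⟨p, ν, h1, h2⟩ := h.exists_proportional hzl hul (hodd z u hzl hul)
  have h3 := hu (-ν) 1 (by simp)
  refine ⟨_, h3.1, h3.2, p, ?_, z, h1⟩
  rw [map_add, map_smul, map_smul, h2]; module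

theorem const_three (h : FlatLocus M B g) (hF : Module.finrank ℂ F = 6) (he : e = 1)
    (hL : Module.finrank ℂ L = 6) :
    ∃ z, z ≠ 0 ∧ (∀ i, g i z = 0) ∧ ∀ p l, M p l ∈ orb M z := by
  obtain ⟨z₀, -, hz₀, hgz₀⟩ := h.exists_mem ⊤ (by rw [finrank_top]; omega)
  have hz₀l := h.lagr z₀ hz₀ hgz₀
  have hr3 : ∀ u, IsLagr M u → Module.finrank ℂ (orb M u) = 3 := by
    intro u hu; unfold IsLagr at hu; omega
  have hker : ∀ p, ∃ z, IsLagr M z ∧ M p z = 0 := by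
    intro p
    have := h.finrank_ker p
    obtain ⟨z, hz, hz0, hg⟩ := h.exists_mem (LinearMap.ker (M p)) (by omega)
    exact ⟨z, h.lagr z hz0 hg, hz⟩
  have hdim : ∀ u v, IsLagr M u → IsLagr M v →
      Module.finrank ℂ (orb M u ⊓ orb M v : Submodule ℂ F) = 1 ∨ orb M v = orb M u := by
    intro u v hu hv
    have h1 := h.even_sub hu hv
    rw [hr3 u hu] at h1
    have h2 : Module.finrank ℂ (orb M u ⊓ orb M v : Submodule ℂ F) ≤ 3 := by
      rw [← hr3 u hu]; exact Submodule.finrank_mono inf_le_left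
    have h3 : Module.finrank ℂ (orb M u ⊓ orb M v : Submodule ℂ F) = 1 ∨
        Module.finrank ℂ (orb M u ⊓ orb M v : Submodule ℂ F) = 3 := by
      obtain ⟨k, hk⟩ := h1
      omega
    refine h3.imp_right fun h3 => IsFlat.orb_eq_of_le hu hv ?_
    rw [h3, hr3 u hu]
  by_cases hconst : ∀ u v, IsLagr M u → IsLagr M v → orb M v = orb M u
  · exact ⟨z₀, hz₀, hgz₀, h.apply_mem_of_const hz₀l fun u hu => hconst _ _ hz₀l hu⟩
  exfalso
  push Not at hconst
  obtain ⟨l, m, hl, hm, hlm⟩ := hconst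
  have hlm1 := (hdim l m hl hm).resolve_right hlm
  -- no member of the family has rank one
  have hrank : ∀ p, (∃ n, M p n ≠ 0) → 2 ≤ Module.finrank ℂ (LinearMap.range (M p)) := by
    rintro p ⟨n, hn⟩
    by_contra hlt
    have hr1 : Module.finrank ℂ (LinearMap.range (M p)) ≤ 1 := by omega
    have hC' : ∀ u, IsLagr M u → LinearMap.range (M p) ≤ orb M u := by
      intro u hu
      by_cases hpu : M p u = 0
      · rintro _ ⟨x, rfl⟩
        exact h.mem_orb_of_stab hu hpu x
      · have h1 : ℂ ∙ (M p u) = LinearMap.range (M p) := by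
          apply Submodule.eq_of_le_of_finrank_le
          · rw [Submodule.span_singleton_le_iff_mem]; exact ⟨u, rfl⟩
          · rw [finrank_span_singleton hpu]; exact hr1
        rw [← h1, Submodule.span_singleton_le_iff_mem]
        exact orb_mem p u
    have hpos : 0 < Module.finrank ℂ (LinearMap.range (M p)) := by
      rw [Module.finrank_pos_iff_exists_ne_zero]
      exact ⟨⟨M p n, n, rfl⟩, fun h0 => hn (congrArg Subtype.val h0)⟩
    have heq : LinearMap.range (M p) = orb M l ⊓ orb M m :=
      Submodule.eq_of_le_of_finrank_le (le_inf (hC' l hl) (hC' m hm)) (by omega)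
    have := Submodule.finrank_mono (h.orb_le_of_inf_le hker hl hm heq.ge hC')
    rw [hr3 l hl] at this
    omega
  let K : Submodule ℂ P := LinearMap.ker M
  have hK : ∀ u, K ≤ stab M u := fun u p hp => by
    rw [mem_stab, LinearMap.mem_ker.1 hp]; rfl
  have hKlm : stab M l ⊓ stab M m = K := by
    apply le_antisymm _ (le_inf (hK l) (hK m))
    rintro p ⟨hpl, hpm⟩
    by_contra hp
    have h1 : ∃ n, M p n ≠ 0 := by
      by_contra! hcon
      exact hp (LinearMap.mem_ker.2 (LinearMap.ext hcon))
    have h2 : LinearMap.range (M p) ≤ orb M l ⊓ orb M m := by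
      rintro _ ⟨x, rfl⟩
      exact ⟨h.mem_orb_of_stab hl hpl x, h.mem_orb_of_stab hm hpm x⟩
    have := Submodule.finrank_mono h2
    have := hrank p h1
    omega
  have hcod : ∀ u, IsLagr M u → Module.finrank ℂ (stab M u) ≤ Module.finrank ℂ K + 1 := by
    intro u hu
    rw [h.finrank_stab hu hl, ← hKlm]
    have h1 : stab M l ⊔ stab M m ≤ link M l m :=
      sup_le (stab_le_link l m) (h.link_comm hl hm ▸ stab_le_link m l)
    have h2 := Submodule.finrank_mono h1
    have h3 := Submodule.finrank_sup_add_finrank_inf_eq (stab M l) (stab M m)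
    rw [finrank_link, hlm1] at h2
    have h4 := h.finrank_stab hl hm
    omega
  have hne : ∀ u v, IsLagr M u → IsLagr M v → orb M u ⊓ orb M v ≠ ⊥ := by
    intro u v hu hv h0
    rcases hdim u v hu hv with h1 | h1
    · rw [h0, finrank_bot] at h1; omega
    · rw [h1, inf_idem] at h0
      have := hr3 u hu
      rw [h0, finrank_bot] at this; omega
  obtain ⟨z, hz0, hgz, p, hpz, hp⟩ := h.stab_ne hz₀ hgz₀ hne
  have hz := h.lagr z hz0 hgz
  have hpK : p ∉ K := by
    intro hpK
    obtain ⟨n, hn⟩ := hp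
    exact hn (by rw [LinearMap.mem_ker.1 hpK]; rfl)
  have hstab : ∀ u, IsLagr M u → M p u = 0 → stab M u = K ⊔ ℂ ∙ p := by
    intro u hu hpu
    symm
    have hlt : K < K ⊔ ℂ ∙ p := by
      refine lt_of_le_of_ne le_sup_left fun h0 => hpK ?_
      rw [h0]; exact Submodule.mem_sup_right (Submodule.mem_span_singleton_self p)
    have := Submodule.finrank_lt_finrank_of_lt hlt
    have := hcod u hu
    refine Submodule.eq_of_le_of_finrank_le (sup_le (hK u) ?_) (by omega)
    rw [Submodule.span_singleton_le_iff_mem]; exact hpu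
  have horb : ∀ u, IsLagr M u → M p u = 0 → orb M u = orb M z := by
    intro u hu hpu
    refine (hdim z u hz hu).resolve_left fun h1 => ?_
    have h2 : LinearMap.range (M p) ≤ orb M z ⊓ orb M u := by
      rintro _ ⟨x, rfl⟩
      exact ⟨h.mem_orb_of_stab hz hpz x, h.mem_orb_of_stab hu hpu x⟩
    have := Submodule.finrank_mono h2
    have := hrank p hp
    omega
  obtain ⟨σ, hσ⟩ := LinearMap.exists_rightInverse_of_surjective (M.flip z).rangeRestrict
    (LinearMap.range_rangeRestrict _)
  have hs : ∀ y : orb M z, M (σ y) z = y := fun y =>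
    congrArg Subtype.val (LinearMap.congr_fun hσ y)
  obtain ⟨π, hπ⟩ := Submodule.exists_isCompl (orb M z)
  let T : L →ₗ[ℂ] orb M z →ₗ[ℂ] orb M z :=
    (M.flip.compl₁₂ LinearMap.id σ).compr₂ (Submodule.projectionOnto _ _ hπ)
  obtain ⟨u, huR, hu0, hgu, y, hy0, hy⟩ := PolyFun.exists_singular (LinearMap.ker (M p))
    h.poly h.zero (by have := h.finrank_ker p; simp; omega) T le_rfl (by rw [hr3 z hz]; omega)
  have hul := h.lagr u hu0 hgu
  have hmem : M (σ y) u ∈ orb M z := horb u hul huR ▸ orb_mem _ u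
  have h0 : M (σ y) u = 0 := by
    have h1 : T u y = ⟨M (σ y) u, hmem⟩ :=
      Submodule.projectionOnto_apply_left hπ ⟨M (σ y) u, hmem⟩
    rw [hy] at h1
    exact (congrArg Subtype.val h1).symm
  have h1 : σ y ∈ stab M z := by
    rw [hstab z hz hpz, ← hstab u hul huR]; exact h0
  apply hy0
  apply Subtype.ext
  rw [← hs y]; exact h1

theorem const_two (h : FlatLocus M B g) (hF : Module.finrank ℂ F = 4) (he : e = 2)
    (hL : Module.finrank ℂ L = 8) :
    ∃ z, z ≠ 0 ∧ (∀ i, g i z = 0) ∧ ∀ p l, M p l ∈ orb M z := by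
  obtain ⟨z₀, -, hz₀, hgz₀⟩ := h.exists_mem ⊤ (by rw [finrank_top]; omega)
  have hz₀l := h.lagr z₀ hz₀ hgz₀
  refine ⟨z₀, hz₀, hgz₀, h.apply_mem_of_const hz₀l fun u hu => ?_⟩
  have hr2 : ∀ u, IsLagr M u → Module.finrank ℂ (orb M u) = 2 := by
    intro u hu; unfold IsLagr at hu; omega
  have hker : ∀ p, ∃ z, IsLagr M z ∧ M p z = 0 := by
    intro p
    have := h.finrank_ker p
    obtain ⟨z, hz, hz0, hg⟩ := h.exists_mem (LinearMap.ker (M p)) (by omega)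
    exact ⟨z, h.lagr z hz0 hg, hz⟩
  apply IsFlat.orb_eq_of_le hz₀l hu
  by_contra hlt
  have h1 := h.even_sub hz₀l hu
  rw [hr2 _ hz₀l] at h1 hlt
  have h2 : Module.finrank ℂ (orb M z₀ ⊓ orb M u : Submodule ℂ F) = 0 := by
    obtain ⟨k, hk⟩ := h1
    omega
  have h3 := h.orb_le_of_inf_le hker hz₀l hu (Submodule.finrank_eq_zero.1 h2).le
    (fun _ _ => bot_le)
  have := hr2 _ hz₀l
  rw [le_bot_iff.1 h3, finrank_bot] at this
  omega

theorem const_one (h : FlatLocus M B g) (hF : Module.finrank ℂ F = 2) (he : e = 3)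
    (hL : Module.finrank ℂ L = 10) :
    ∃ z, z ≠ 0 ∧ (∀ i, g i z = 0) ∧ ∀ p l, M p l ∈ orb M z := by
  obtain ⟨z₀, -, hz₀, hgz₀⟩ := h.exists_mem ⊤ (by rw [finrank_top]; omega)
  have hz₀l := h.lagr z₀ hz₀ hgz₀
  refine ⟨z₀, hz₀, hgz₀, h.apply_mem_of_const hz₀l fun u hu => ?_⟩
  apply IsFlat.orb_eq_of_le hz₀l hu
  have h1 := h.even_sub hz₀l hu
  have h2 : Module.finrank ℂ (orb M z₀) = 1 := by unfold IsLagr at hz₀l; omega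
  obtain ⟨k, hk⟩ := h1
  omega

theorem const (h : FlatLocus M B g) {r : ℕ} (hr : 1 ≤ r) (he : 1 ≤ e) (hre : r + e = 4)
    (hF : Module.finrank ℂ F = 2 * r) (hL : Module.finrank ℂ L = 4 + 2 * e) :
    ∃ z, z ≠ 0 ∧ (∀ i, g i z = 0) ∧ ∀ p l, M p l ∈ orb M z := by
  obtain rfl | rfl | rfl : r = 1 ∨ r = 2 ∨ r = 3 := by omega
  · exact h.const_one hF (by omega) (by omega)
  · exact h.const_two hF (by omega) (by omega)
  · exact h.const_three hF (by omega) (by omega)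

end FlatLocus

end Const

/-- Linear independence of a pair of vectors. -/
def Indep {E : Type*} [AddCommGroup E] [Module ℂ E] (x y : E) : Prop :=
  ∀ s t : ℂ, s • x + t • y = 0 → s = 0 ∧ t = 0

namespace Indep

variable {E : Type*} [AddCommGroup E] [Module ℂ E] {x y : E}

theorem symm (h : Indep x y) : Indep y x := fun s t hst =>
  (h t s (by rw [add_comm]; exact hst)).symm

theorem left_ne (h : Indep x y) : x ≠ 0 := by
  rintro rfl
  simpa using h 1 0

theorem right_ne (h : Indep x y) : y ≠ 0 := h.symm.left_ne

theorem comb_ne (h : Indep x y) {s t : ℂ} (hst : (s, t) ≠ (0, 0)) : s • x + t • y ≠ 0 := by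
  intro h0
  obtain ⟨rfl, rfl⟩ := h s t h0
  exact hst rfl

theorem of_ne (hx : x ≠ 0) (hy : ∀ s : ℂ, y ≠ s • x) : Indep x y := by
  intro s t hst
  by_cases ht : t = 0
  · subst ht
    simp only [zero_smul, add_zero, smul_eq_zero] at hst
    exact ⟨hst.resolve_right hx, rfl⟩
  · exfalso
    apply hy (-(t⁻¹ * s))
    have h1 : t⁻¹ • (s • x + t • y) = 0 := by rw [hst, smul_zero]
    rw [smul_add, smul_smul, inv_smul_smul₀ ht] at h1
    rw [neg_smul]
    exact eq_neg_of_add_eq_zero_right h1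

theorem or_eq_smul (hx : x ≠ 0) (y : E) : Indep x y ∨ ∃ s : ℂ, y = s • x := by
  by_cases h : ∃ s : ℂ, y = s • x
  · exact Or.inr h
  · exact Or.inl (of_ne hx fun s hs => h ⟨s, hs⟩)

end Indep

section Skew

variable {P : Type*} [AddCommGroup P] [Module ℂ P] [FiniteDimensional ℂ P]

/-- A skew form factoring through the rank two quotient of another one is proportional to it. -/
theorem exists_smul_of_skew {Om β : P →ₗ[ℂ] P →ₗ[ℂ] ℂ} (hOm : ∀ x y, Om x y = -Om y x)
    (hβ : ∀ x y, β x y = -β y x) {R : Submodule ℂ P}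
    (hR : Module.finrank ℂ P ≤ Module.finrank ℂ R + 2) (hOR : ∀ x ∈ R, ∀ y, Om x y = 0)
    (hβR : ∀ x ∈ R, ∀ y, β x y = 0) (h0 : ∃ x y, Om x y ≠ 0) :
    ∃ t : ℂ, ∀ x y, β x y = t * Om x y := by
  obtain ⟨a, b, hab⟩ := h0
  have hOs : ∀ x, Om x x = 0 := fun x => by linear_combination (1/2) * hOm x x
  have hβs : ∀ x, β x x = 0 := fun x => by linear_combination (1/2) * hβ x x
  let T : P →ₗ[ℂ] ℂ × ℂ := (Om a).prod (Om b)
  have hT : LinearMap.range T = ⊤ := by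
    rw [LinearMap.range_eq_top]
    rintro ⟨s, t⟩
    refine ⟨(s / Om a b) • b + (-t / Om a b) • a, ?_⟩
    ext
    · simp [T, hOs, hab]
    · simp [T, hOs, hOm b a]; field_simp
  have h1 := LinearMap.finrank_range_add_finrank_ker T
  rw [hT, finrank_top, Module.finrank_prod, Module.finrank_self] at h1
  have hRT : R = LinearMap.ker T := by
    apply Submodule.eq_of_le_of_finrank_le
    · intro x hx
      rw [LinearMap.mem_ker]
      ext
      · simp [T, hOm a x, hOR x hx]
      · simp [T, hOm b x, hOR x hx]
    · omega
  refine ⟨β a b / Om a b, fun x y => ?_⟩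
  have hdec : ∀ x, x - (Om x b / Om a b) • a - (Om a x / Om a b) • b ∈ R := by
    intro x
    rw [hRT, LinearMap.mem_ker]
    ext
    · simp [T, hOs]; field_simp; ring
    · simp [T, hOs, hOm b a, hOm b x]; field_simp; ring
  have hred : ∀ (γ : P →ₗ[ℂ] P →ₗ[ℂ] ℂ), (∀ x y, γ x y = -γ y x) → (∀ x ∈ R, ∀ y, γ x y = 0) →
      γ x y = ((Om x b / Om a b) * (Om a y / Om a b) - (Om a x / Om a b) * (Om y b / Om a b)) *
        γ a b := by
    intro γ hγ hγR
    have hγs : ∀ x, γ x x = 0 := fun x => by linear_combination (1/2) * hγ x x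
    obtain ⟨r, hr, hx⟩ : ∃ r ∈ R, x = r + ((Om x b / Om a b) • a + (Om a x / Om a b) • b) :=
      ⟨_, hdec x, by abel⟩
    obtain ⟨r', hr', hy⟩ : ∃ r ∈ R, y = r + ((Om y b / Om a b) • a + (Om a y / Om a b) • b) :=
      ⟨_, hdec y, by abel⟩
    have hγR' : ∀ x ∈ R, ∀ y, γ y x = 0 := fun x hx y => by rw [hγ, hγR x hx, neg_zero]
    generalize Om x b / Om a b = s at *
    generalize Om a x / Om a b = s' at *
    generalize Om y b / Om a b = u at *
    generalize Om a y / Om a b = u' at *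
    subst hx hy
    simp only [map_add, LinearMap.add_apply, hγR _ hr, hγR' _ hr', map_smul, LinearMap.smul_apply,
      hγs, smul_eq_mul, hγ b a]
    ring
  rw [hred β hβ hβR, hred Om hOm hOR]
  field_simp

end Skew

section Four

variable {P L F : Type*} [AddCommGroup P] [Module ℂ P] [FiniteDimensional ℂ P]
  [AddCommGroup L] [Module ℂ L] [FiniteDimensional ℂ L]
  [AddCommGroup F] [Module ℂ F] [FiniteDimensional ℂ F]
  {M : P →ₗ[ℂ] L →ₗ[ℂ] F} {B : F →ₗ[ℂ] F →ₗ[ℂ] ℂ}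

/-- The pairing between two swept-out spaces, as a form on the family of maps. -/
def pairForm (M : P →ₗ[ℂ] L →ₗ[ℂ] F) (B : F →ₗ[ℂ] F →ₗ[ℂ] ℂ) (z u : L) : P →ₗ[ℂ] P →ₗ[ℂ] ℂ :=
  B.compl₁₂ (M.flip z) (M.flip u)

theorem pairForm_apply (z u : L) (p q : P) : pairForm M B z u p q = B (M p z) (M q u) := rfl

theorem IsFlat.pairForm_skew (h : IsFlat M B) (z u : L) (p q : P) :
    pairForm M B z u p q = -pairForm M B z u q p := h.skew p q z u

/-- A flat family of maps from a four-dimensional space, every nonzero vector of which sweeps out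
a maximal isotropic subspace of dimension four. -/
structure FlatFour (M : P →ₗ[ℂ] L →ₗ[ℂ] F) (B : F →ₗ[ℂ] F →ₗ[ℂ] ℂ) : Prop extends IsFlat M B where
  dimL : Module.finrank ℂ L = 4
  dimF : Module.finrank ℂ F = 8
  lagr : ∀ z, z ≠ 0 → IsLagr M z

namespace FlatFour

variable (h : FlatFour M B)
include h

theorem finrank_orb {z : L} (hz : z ≠ 0) : Module.finrank ℂ (orb M z) = 4 := by
  have h1 := h.lagr z hz
  have h2 := h.dimF
  unfold IsLagr at h1
  omega

theorem finrank_stab_add {z : L} (hz : z ≠ 0) :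
    Module.finrank ℂ (stab M z) + 4 = Module.finrank ℂ P := by
  have := finrank_orb_add (M := M) z
  rw [h.finrank_orb hz] at this
  omega

theorem stab_eq_of_le {z u : L} (hz : z ≠ 0) (hu : u ≠ 0) (hle : stab M z ≤ stab M u) :
    stab M z = stab M u :=
  Submodule.eq_of_le_of_finrank_le hle (by
    have := h.finrank_stab_add hz; have := h.finrank_stab_add hu; omega)

/-- Some other swept-out space meets a given one. -/
theorem exists_meet {z : L} (hz : z ≠ 0) : ∃ u, Indep z u ∧ orb M z ⊓ orb M u ≠ ⊥ := by
  obtain ⟨R, hR⟩ := Submodule.exists_isCompl (ℂ ∙ z)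
  have hRd := Submodule.finrank_add_eq_of_isCompl hR
  rw [finrank_span_singleton hz, h.dimL] at hRd
  obtain ⟨σ, hσ⟩ : ∃ σ : orb M z →ₗ[ℂ] P, (M.flip z).rangeRestrict ∘ₗ σ = LinearMap.id :=
    LinearMap.exists_rightInverse_of_surjective (M.flip z).rangeRestrict
      (LinearMap.range_rangeRestrict _)
  have hs : ∀ y : orb M z, M (σ y) z = y := fun y =>
    congrArg Subtype.val (LinearMap.congr_fun hσ y)
  let T : L →ₗ[ℂ] orb M z →ₗ[ℂ] Module.Dual ℂ (orb M z) :=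
    LinearMap.mk₂ ℂ (fun u y => (B y).comp ((M.flip u).comp σ))
      (fun u u' y => by ext; simp [LinearMap.add_comp]) (fun c u y => by ext; simp [LinearMap.smul_comp])
      (fun u y y' => by ext; simp) (fun c u y => by ext; simp)
  obtain ⟨u, huR, hu0, -, y, hy0, hy⟩ := PolyFun.exists_singular (ι := Empty) (f := fun i => i.elim)
    R (fun i => i.elim) (fun i => i.elim) (by simp; omega) T (by rw [Subspace.dual_finrank_eq])
    (by rw [h.finrank_orb hz]; omega)
  have hzu : Indep z u := by
    refine Indep.of_ne hz fun s hs => hu0 ?_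
    exact (Submodule.mem_bot ℂ).1 (hR.disjoint.le_bot
      ⟨Submodule.mem_span_singleton.2 ⟨s, hs.symm⟩, huR⟩)
  refine ⟨u, hzu, fun h0 => hy0 ?_⟩
  apply Subtype.ext
  have : (y : F) ∈ orb M z ⊓ orb M u := by
    refine ⟨y.2, (h.mem_orb_iff (h.lagr u hu0)).2 fun q => ?_⟩
    have h1 : σ ⟨M q z, orb_mem q z⟩ - q ∈ stab M z := by
      rw [mem_stab, map_sub, LinearMap.sub_apply]
      exact sub_eq_zero.2 (hs _)
    have h2 : B y (M (σ ⟨M q z, orb_mem q z⟩) u) = 0 :=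
      LinearMap.congr_fun hy (⟨M q z, orb_mem q z⟩ : orb M z)
    have h3 : B y (M (σ ⟨M q z, orb_mem q z⟩ - q) u) = 0 := by
      obtain ⟨p, hp⟩ := y.2
      rw [← hp]
      show B (M p z) _ = 0
      rw [h.skew, mem_stab.1 h1, map_zero, LinearMap.zero_apply, neg_zero]
    rw [map_sub, LinearMap.sub_apply, map_sub, h2, zero_sub, neg_eq_zero] at h3
    exact h3
  rw [h0] at this
  exact this

/-- No vector is killed only by the zero members of the family. -/
theorem exists_stab {z : L} (hz : z ≠ 0) : ∃ p, M p z = 0 ∧ M p ≠ 0 := by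
  by_contra! hcon
  have hK : stab M z ≤ LinearMap.ker M := fun p hp => hcon p hp
  obtain ⟨u, hzu, hne⟩ := h.exists_meet hz
  obtain ⟨p, ν, h1, h2⟩ := h.exists_proportional (h.lagr z hz) (h.lagr u hzu.right_ne) hne
  have h3 : (-ν) • z + (1 : ℂ) • u ≠ 0 := hzu.comb_ne (by simp)
  have h4 : stab M z ≤ stab M ((-ν) • z + (1 : ℂ) • u) := fun p hp => by
    rw [mem_stab, LinearMap.mem_ker.1 (hK hp)]; rfl
  have h5 : p ∈ stab M ((-ν) • z + (1 : ℂ) • u) := by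
    rw [mem_stab, map_add, map_smul, map_smul, h2]; module
  rw [← h.stab_eq_of_le hz h3 h4] at h5
  exact h1 h5

/-- Any two swept-out spaces meet. -/
theorem meet {z u : L} (hzu : Indep z u) : orb M z ⊓ orb M u ≠ ⊥ := by
  intro h0
  have hz := h.lagr z hzu.left_ne
  have hu := h.lagr u hzu.right_ne
  have h1 := finrank_link (M := M) z u
  rw [h0, finrank_bot, add_zero] at h1
  have h2 : stab M z = link M z u :=
    Submodule.eq_of_le_of_finrank_le (stab_le_link z u) h1.le
  have h3 := finrank_link (M := M) u z
  rw [inf_comm, h0, finrank_bot, add_zero] at h3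
  have h4 : stab M u = link M u z :=
    Submodule.eq_of_le_of_finrank_le (stab_le_link u z) h3.le
  obtain ⟨p, hpz, hp⟩ := h.exists_stab hzu.left_ne
  have hpu : p ∈ stab M u := by
    rw [h4, h.link_comm hu hz, ← h2]; exact hpz
  apply hp
  ext l
  have : M p l ∈ orb M z ⊓ orb M u :=
    ⟨h.mem_orb_of_stab hz hpz l, h.mem_orb_of_stab hu hpu l⟩
  rw [h0] at this
  exact this

theorem finrank_inf {z u : L} (hzu : Indep z u) (hne : orb M u ≠ orb M z) :
    Module.finrank ℂ (orb M z ⊓ orb M u : Submodule ℂ F) = 2 := by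
  have hz := h.lagr z hzu.left_ne
  have hu := h.lagr u hzu.right_ne
  have h1 := h.even_sub hz hu
  rw [h.finrank_orb hzu.left_ne] at h1
  have h2 : Module.finrank ℂ (orb M z ⊓ orb M u : Submodule ℂ F) ≠ 0 := fun h0 =>
    h.meet hzu (Submodule.finrank_eq_zero.1 h0)
  have h3 : Module.finrank ℂ (orb M z ⊓ orb M u : Submodule ℂ F) < 4 := by
    by_contra hlt
    exact hne (IsFlat.orb_eq_of_le hz hu (by rw [h.finrank_orb hzu.left_ne]; omega))
  obtain ⟨k, hk⟩ := h1
  omega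

end FlatFour

end Four

section Quartic

variable {P L F : Type*} [AddCommGroup P] [Module ℂ P] [FiniteDimensional ℂ P]
  [AddCommGroup L] [Module ℂ L] [FiniteDimensional ℂ L]
  [AddCommGroup F] [Module ℂ F] [FiniteDimensional ℂ F]
  {M : P →ₗ[ℂ] L →ₗ[ℂ] F} {B : F →ₗ[ℂ] F →ₗ[ℂ] ℂ}

/-- A nonzero vector and a nonzero vector of a complement are independent. -/
theorem Indep.of_isCompl {z u : L} {R : Submodule ℂ L} (hR : IsCompl (ℂ ∙ z) R) (hz : z ≠ 0)
    (hu : u ∈ R) (hu0 : u ≠ 0) : Indep z u :=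
  Indep.of_ne hz fun s hs => hu0 <| (Submodule.mem_bot ℂ).1 <| hR.disjoint.le_bot
    ⟨Submodule.mem_span_singleton.2 ⟨s, hs.symm⟩, hu⟩

/-- A skew form vanishes on the span of a subspace of its kernel and one further direction. -/
theorem skew_eq_zero_of_sup {Om : P →ₗ[ℂ] P →ₗ[ℂ] ℂ} (hOm : ∀ x y, Om x y = -Om y x)
    {R S K : Submodule ℂ P} (hR : ∀ x ∈ R, ∀ y, Om x y = 0) (hKR : K ≤ R) (hKS : K ≤ S)
    (hd : Module.finrank ℂ S = Module.finrank ℂ K + 1) {x y : P} (hx : x ∈ R ⊔ S)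
    (hy : y ∈ R ⊔ S) : Om x y = 0 := by
  have hself : ∀ x, Om x x = 0 := fun x => by linear_combination (1/2) * hOm x x
  obtain ⟨e, heS, heK⟩ : ∃ e ∈ S, e ∉ K := by
    by_contra! hcon
    have := Submodule.finrank_mono (show S ≤ K from hcon)
    omega
  have hS : S = K ⊔ ℂ ∙ e := by
    symm
    apply Submodule.eq_of_le_of_finrank_le
      (sup_le hKS ((Submodule.span_singleton_le_iff_mem _ _).2 heS))
    have : K < K ⊔ ℂ ∙ e := lt_of_le_of_ne le_sup_left fun h0 =>
      heK (h0 ▸ Submodule.mem_sup_right (Submodule.mem_span_singleton_self e))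
    have := Submodule.finrank_lt_finrank_of_lt this
    omega
  have hdec : ∀ x ∈ R ⊔ S, ∃ r ∈ R, ∃ a : ℂ, x = r + a • e := by
    intro x hx
    obtain ⟨r, hr, s, hs, rfl⟩ := Submodule.mem_sup.1 hx
    rw [hS] at hs
    obtain ⟨k, hk, e', he', rfl⟩ := Submodule.mem_sup.1 hs
    obtain ⟨a, rfl⟩ := Submodule.mem_span_singleton.1 he'
    exact ⟨r + k, R.add_mem hr (hKR hk), a, by abel⟩
  have hR' : ∀ x ∈ R, ∀ y, Om y x = 0 := fun x hx y => by rw [hOm, hR x hx, neg_zero]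
  obtain ⟨r, hr, a, rfl⟩ := hdec x hx
  obtain ⟨r', hr', a', rfl⟩ := hdec y hy
  simp [hR _ hr, hR' _ hr', hself]

/-- In a modular lattice of subspaces meeting in general position. -/
theorem le_sup_inf_of_finrank {A C D K : Submodule ℂ P} (hT : A ⊓ C ⊓ D ≤ K)
    (hA : Module.finrank ℂ A = Module.finrank ℂ K + 2)
    (hAC : Module.finrank ℂ (A ⊓ C : Submodule ℂ P) = Module.finrank ℂ K + 1)
    (hAD : Module.finrank ℂ (A ⊓ D : Submodule ℂ P) = Module.finrank ℂ K + 1) :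
    A ≤ C ⊔ (A ⊓ D) := by
  have e := Submodule.finrank_sup_add_finrank_inf_eq (A ⊓ C) (A ⊓ D)
  have e1 : (A ⊓ C) ⊓ (A ⊓ D) ≤ K :=
    le_trans (le_inf inf_le_left (inf_le_right.trans inf_le_right)) hT
  have e2 := Submodule.finrank_mono e1
  have e3 : (A ⊓ C) ⊔ (A ⊓ D) = A :=
    Submodule.eq_of_le_of_finrank_le (sup_le inf_le_left inf_le_left) (by omega)
  calc A = (A ⊓ C) ⊔ (A ⊓ D) := e3.symm
    _ ≤ C ⊔ (A ⊓ D) := sup_le_sup_right inf_le_right _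

namespace FlatFour

variable (h : FlatFour M B)
include h

theorem finrank_link_of_ne {z u : L} (hzu : Indep z u) (hne : orb M u ≠ orb M z) :
    Module.finrank ℂ (link M z u) = Module.finrank ℂ (stab M z) + 2 := by
  rw [finrank_link, h.finrank_inf hzu hne]

theorem exists_pairForm_ne {z u : L} (hzu : Indep z u) (hne : orb M u ≠ orb M z) :
    ∃ p q, pairForm M B z u p q ≠ 0 := by
  by_contra! hcon
  apply hne
  apply IsFlat.orb_eq_of_le (h.lagr z hzu.left_ne) (h.lagr u hzu.right_ne)
  apply Submodule.finrank_mono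
  refine le_inf le_rfl ?_
  rintro _ ⟨p, rfl⟩
  exact (h.mem_orb_iff (h.lagr u hzu.right_ne)).2 fun q => hcon p q

theorem pairForm_of_mem_link {z u : L} (hu : u ≠ 0) {p : P} (hp : p ∈ link M z u) (q : P) :
    pairForm M B z u p q = 0 := (h.mem_link_iff (h.lagr u hu)).1 hp q

/-- A symmetric form vanishing on the spaces swept out by a line of vectors is a multiple of the
given one on pairs of them. -/
theorem exists_smul_form {w u : L} (hwu : Indep w u) (hne : orb M u ≠ orb M w)
    (n : F →ₗ[ℂ] F →ₗ[ℂ] ℂ) (hs : ∀ x y, n x y = n y x)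
    (hn : ∀ s t : ℂ, ∀ x ∈ orb M (s • w + t • u), ∀ y ∈ orb M (s • w + t • u), n x y = 0) :
    ∃ t : ℂ, ∀ x ∈ orb M w, ∀ y ∈ orb M u, n x y = t * B x y := by
  have hu : ∀ x ∈ orb M u, ∀ y ∈ orb M u, n x y = 0 := by simpa using hn 0 1
  have hw : ∀ x ∈ orb M w, ∀ y ∈ orb M w, n x y = 0 := by simpa using hn 1 0
  obtain ⟨t, ht⟩ := exists_smul_of_skew (Om := pairForm M B w u)
    (β := n.compl₁₂ (M.flip w) (M.flip u)) (R := link M w u)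
    (h.pairForm_skew w u) (by
      intro p q
      show n (M p w) (M q u) = -n (M q w) (M p u)
      have h1 := hn 1 1 (M p (w + u)) ⟨p, by simp⟩ (M q (w + u)) ⟨q, by simp⟩
      simp only [map_add, LinearMap.add_apply, hw _ (orb_mem p w) _ (orb_mem q w),
        hu _ (orb_mem p u) _ (orb_mem q u), hs (M p u)] at h1
      linear_combination h1)
    (by rw [h.finrank_link_of_ne hwu hne]; have := h.finrank_stab_add hwu.left_ne; omega)
    (fun p hp => h.pairForm_of_mem_link hwu.right_ne hp)
    (fun p hp q => hu _ hp _ (orb_mem q u)) (h.exists_pairForm_ne hwu hne)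
  refine ⟨t, ?_⟩
  rintro _ ⟨p, rfl⟩ _ ⟨q, rfl⟩
  exact ht p q

variable (hdist : ∀ z u, Indep z u → orb M u ≠ orb M z)
include hdist

theorem finrank_link_inf {z v v' : L}
    (hv : ∀ s t : ℂ, (s, t) ≠ (0, 0) → Indep z (s • v + t • v')) :
    Module.finrank ℂ (link M z v ⊓ link M z v' : Submodule ℂ P) =
      Module.finrank ℂ (stab M z) + 1 := by
  have h1 : Indep z v := by simpa using hv 1 0 (by simp)
  have h2 : Indep z v' := by simpa using hv 0 1 (by simp)
  have d := h.finrank_stab_add h1.left_ne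
  have d1 := h.finrank_link_of_ne h1 (hdist _ _ h1)
  have d2 := h.finrank_link_of_ne h2 (hdist _ _ h2)
  have dd := Submodule.finrank_sup_add_finrank_inf_eq (link M z v) (link M z v')
  have hle := Submodule.finrank_le (link M z v ⊔ link M z v')
  have hKle : stab M z ≤ link M z v ⊓ link M z v' :=
    le_inf (stab_le_link _ _) (stab_le_link _ _)
  have hadd : ∀ (s t : ℂ) p q, pairForm M B z (s • v + t • v') p q =
      s * pairForm M B z v p q + t * pairForm M B z v' p q := by
    intro s t p q
    simp [pairForm_apply]
  have hgt : Module.finrank ℂ (stab M z) <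
      Module.finrank ℂ (link M z v ⊓ link M z v' : Submodule ℂ P) := by
    by_contra hlt
    have hK := Submodule.eq_of_le_of_finrank_le hKle (not_lt.1 hlt)
    have htop : link M z v ⊔ link M z v' = ⊤ := Submodule.eq_top_of_finrank_eq (by
      rw [← hK] at dd; omega)
    have h3 := hv 1 1 (by simp)
    have hle' : link M z ((1:ℂ) • v + (1:ℂ) • v') ≤ stab M z := by
      intro p hp
      have e : ∀ q, pairForm M B z v p q = -pairForm M B z v' p q := fun q => by
        have := h.pairForm_of_mem_link h3.right_ne hp q
        rw [hadd] at this
        linear_combination this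
      have e1 : ∀ q, pairForm M B z v p q = 0 := by
        intro q
        obtain ⟨a, ha, b, hb, rfl⟩ := Submodule.mem_sup.1 (htop ▸ Submodule.mem_top : q ∈ _)
        have f1 : pairForm M B z v p a = 0 := by
          rw [h.pairForm_skew, h.pairForm_of_mem_link h1.right_ne ha, neg_zero]
        have f2 : pairForm M B z v p b = 0 := by
          rw [e, h.pairForm_skew, h.pairForm_of_mem_link h2.right_ne hb, neg_zero, neg_zero]
        rw [map_add, f1, f2, add_zero]
      rw [hK]
      refine ⟨(h.mem_link_iff (h.lagr _ h1.right_ne)).2 e1,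
        (h.mem_link_iff (h.lagr _ h2.right_ne)).2 fun q => ?_⟩
      have := e q
      rw [e1] at this
      exact neg_eq_zero.1 this.symm
    have := Submodule.finrank_mono hle'
    rw [h.finrank_link_of_ne h3 (hdist _ _ h3)] at this
    omega
  have hlt : Module.finrank ℂ (link M z v ⊓ link M z v' : Submodule ℂ P) <
      Module.finrank ℂ (stab M z) + 2 := by
    by_contra hge
    have e1 : link M z v ⊓ link M z v' = link M z v :=
      Submodule.eq_of_le_of_finrank_le inf_le_left (by omega)
    have e2 : link M z v ≤ link M z v' := by rw [← e1]; exact inf_le_right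
    obtain ⟨t, ht⟩ := exists_smul_of_skew (Om := pairForm M B z v) (β := pairForm M B z v')
      (R := link M z v) (h.pairForm_skew _ _) (h.pairForm_skew _ _) (by omega)
      (fun p hp => h.pairForm_of_mem_link h1.right_ne hp)
      (fun p hp => h.pairForm_of_mem_link h2.right_ne (e2 hp))
      (h.exists_pairForm_ne h1 (hdist _ _ h1))
    have h3 := hv (-t) 1 (by simp)
    obtain ⟨p, q, hpq⟩ := h.exists_pairForm_ne h3 (hdist _ _ h3)
    apply hpq
    rw [hadd, ht]
    ring
  omega

/-- Either all swept-out spaces share a vector, or their pairings with a given one vanish on a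
common hyperplane. -/
theorem dichotomy {z : L} (hz : z ≠ 0) : (∃ c, c ≠ 0 ∧ ∀ u, u ≠ 0 → c ∈ orb M u) ∨
    ∃ H : Submodule ℂ P, stab M z ≤ H ∧ Module.finrank ℂ H + 1 = Module.finrank ℂ P ∧
      ∀ p ∈ H, ∀ q ∈ H, ∀ u, B (M p z) (M q u) = 0 := by
  obtain ⟨R, hR⟩ := Submodule.exists_isCompl (ℂ ∙ z)
  have hRd := Submodule.finrank_add_eq_of_isCompl hR
  rw [finrank_span_singleton hz, h.dimL] at hRd
  let b := Module.finBasisOfFinrankEq ℂ R (show Module.finrank ℂ R = 3 by omega)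
  have hdec : ∀ u : L, ∃ (s : ℂ) (c : Fin 3 → ℂ), u = s • z + ∑ i, c i • (b i : L) := by
    intro u
    obtain ⟨x, hx, y, hy, rfl⟩ := Submodule.mem_sup.1 (hR.sup_eq_top ▸ Submodule.mem_top : u ∈ _)
    obtain ⟨s, rfl⟩ := Submodule.mem_span_singleton.1 hx
    refine ⟨s, fun i => b.repr ⟨y, hy⟩ i, ?_⟩
    have := congrArg Subtype.val (b.sum_repr ⟨y, hy⟩)
    simp only [Submodule.coe_sum, Submodule.coe_smul] at this
    rw [this]
  have hne : ∀ i, (b i : L) ≠ 0 := fun i h0 => b.ne_zero i (Subtype.ext h0)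
  have hind : ∀ i, Indep z (b i) := fun i => Indep.of_isCompl hR hz (b i).2 (hne i)
  have hpair : ∀ i j, i ≠ j → ∀ s t : ℂ, (s, t) ≠ (0, 0) →
      Indep z (s • (b i : L) + t • (b j : L)) := by
    intro i j hij s t hst
    refine Indep.of_isCompl hR hz (R.add_mem (R.smul_mem _ (b i).2) (R.smul_mem _ (b j).2)) ?_
    intro h0
    have h1 : s • b i + t • b j = 0 := Subtype.ext h0
    have h2 := congrArg (fun x => b.repr x i) h1
    have h3 := congrArg (fun x => b.repr x j) h1
    simp [hij, hij.symm] at h2 h3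
    exact hst (by rw [h2, h3])
  have hform : ∀ (s : ℂ) (c : Fin 3 → ℂ) p q, B (M p z) (M q (s • z + ∑ i, c i • (b i : L))) =
      ∑ i, c i * pairForm M B z (b i) p q := by
    intro s c p q
    rw [map_add, map_add, map_smul, map_smul, h.isotropic (orb_mem p z) (orb_mem q z)]
    simp [pairForm_apply]
  obtain ⟨r, hrdef⟩ : ∃ r : Fin 3 → Submodule ℂ P, ∀ i, r i = link M z (b i) := ⟨_, fun _ => rfl⟩
  have hr : ∀ i, Module.finrank ℂ (r i) = Module.finrank ℂ (stab M z) + 2 := fun i =>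
    hrdef i ▸ h.finrank_link_of_ne (hind i) (hdist _ _ (hind i))
  have hrr : ∀ i j, i ≠ j → Module.finrank ℂ (r i ⊓ r j : Submodule ℂ P) =
      Module.finrank ℂ (stab M z) + 1 := fun i j hij =>
    hrdef i ▸ hrdef j ▸ h.finrank_link_inf hdist (hpair i j hij)
  have hK : ∀ i, stab M z ≤ r i := fun i => hrdef i ▸ stab_le_link _ _
  have hr0 : ∀ i, ∀ p ∈ r i, ∀ q, pairForm M B z (b i) p q = 0 := fun i p hp =>
    h.pairForm_of_mem_link (hne i) (hrdef i ▸ hp)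
  have d := h.finrank_stab_add hz
  by_cases hT : r 0 ⊓ r 1 ⊓ r 2 ≤ stab M z
  · right
    obtain ⟨r0, e0⟩ : ∃ r0, r0 = r 0 := ⟨_, rfl⟩
    obtain ⟨r1, e1⟩ : ∃ r1, r1 = r 1 := ⟨_, rfl⟩
    obtain ⟨r2, e2⟩ : ∃ r2, r2 = r 2 := ⟨_, rfl⟩
    have h01 := hrr 0 1 (by decide)
    have h02 := hrr 0 2 (by decide)
    have h12 := hrr 1 2 (by decide)
    have h0 := hr 0
    have h1 := hr 1
    have h2 := hr 2
    have k0 := hK 0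
    have k1 := hK 1
    have k2 := hK 2
    have l0 := hr0 0
    have l1 := hr0 1
    have l2 := hr0 2
    rw [← e0, ← e1, ← e2] at hT
    rw [← e0] at h01 h02 h0 k0 l0
    rw [← e1] at h01 h12 h1 k1 l1
    rw [← e2] at h02 h12 h2 k2 l2
    have hH1 : r0 ⊔ (r1 ⊓ r2) ≤ r1 ⊔ (r0 ⊓ r2) :=
      sup_le (le_sup_inf_of_finrank hT h0 h01 h02) (inf_le_left.trans le_sup_left)
    have hH2 : r0 ⊔ (r1 ⊓ r2) ≤ r2 ⊔ (r0 ⊓ r1) :=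
      sup_le (le_sup_inf_of_finrank (by rwa [inf_right_comm]) h0 h02 h01)
        (inf_le_right.trans le_sup_left)
    refine ⟨r0 ⊔ (r1 ⊓ r2), k0.trans le_sup_left, ?_, ?_⟩
    · have e := Submodule.finrank_sup_add_finrank_inf_eq r0 (r1 ⊓ r2)
      have e1 : r0 ⊓ (r1 ⊓ r2) = stab M z :=
        le_antisymm (by rwa [← inf_assoc]) (le_inf k0 (le_inf k1 k2))
      rw [e1] at e
      omega
    · intro p hp q hq u
      obtain ⟨s, c, rfl⟩ := hdec u
      have f0 := skew_eq_zero_of_sup (h.pairForm_skew _ _) l0 k0 (le_inf k1 k2) h12 hp hq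
      have f1 := skew_eq_zero_of_sup (h.pairForm_skew _ _) l1 k1 (le_inf k0 k2) h02 (hH1 hp) (hH1 hq)
      have f2 := skew_eq_zero_of_sup (h.pairForm_skew _ _) l2 k2 (le_inf k0 k1) h01 (hH2 hp) (hH2 hq)
      rw [hform, Fin.sum_univ_three, f0, f1, f2]
      simp
  · left
    obtain ⟨p, hp, hpK⟩ := SetLike.not_le_iff_exists.1 hT
    refine ⟨M p z, hpK, fun u hu => (h.mem_orb_iff (h.lagr u hu)).2 fun q => ?_⟩
    have key : ∀ i, pairForm M B z (b i) p q = 0 := by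
      intro i
      refine hr0 i p ?_ q
      fin_cases i
      · exact hp.1.1
      · exact hp.1.2
      · exact hp.2
    obtain ⟨s, c, rfl⟩ := hdec u
    rw [hform]
    simp [key]

end FlatFour

/-- A flat four-dimensional family together with quadratic forms satisfying a cubic identity, one
of which is the given form. -/
structure Quartic (M : P →ₗ[ℂ] L →ₗ[ℂ] F) (B : F →ₗ[ℂ] F →ₗ[ℂ] ℂ)
    (N : P →ₗ[ℂ] F →ₗ[ℂ] F →ₗ[ℂ] ℂ) (q : P) : Prop extends FlatFour M B where
  Nsymm : ∀ p x y, N p x y = N p y x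
  cubic : ∀ p l, N p (M p l) (M p l) = 0
  Mq : M q = 0
  Nq : ∀ x y, N q x y = B x y

namespace Quartic

variable {N : P →ₗ[ℂ] F →ₗ[ℂ] F →ₗ[ℂ] ℂ} {q : P} (h : Quartic M B N q)
include h

theorem N_of_stab {p : P} {z : L} (hp : M p z = 0) {x y : F} (hx : x ∈ orb M z)
    (hy : y ∈ orb M z) : N p x y = 0 := by
  have h1 : ∀ x ∈ orb M z, N p x x = 0 := by
    rintro _ ⟨r, rfl⟩
    have h2 := h.cubic (p + r) z
    simp only [map_add, LinearMap.add_apply, hp, zero_add, h.cubic, add_zero] at h2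
    exact h2
  have h2 := h1 _ (Submodule.add_mem _ hx hy)
  simp only [map_add, LinearMap.add_apply, h1 x hx, h1 y hy, h.Nsymm p y x] at h2
  linear_combination (1/2) * h2

theorem const_of_eq {z u : L} (hzu : Indep z u) (heq : orb M u = orb M z) (p : P) :
    (∀ l, M p l ∈ orb M z) ∧ ∀ x ∈ orb M z, ∀ y ∈ orb M z, N p x y = 0 := by
  set U := orb M z with hU
  have horb : ∀ s t : ℂ, (s, t) ≠ (0, 0) → orb M (s • z + t • u) = U := by
    intro s t hst
    apply Submodule.eq_of_le_of_finrank_le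
    · rintro _ ⟨p, rfl⟩
      show M p _ ∈ U
      rw [map_add, map_smul, map_smul]
      exact U.add_mem (U.smul_mem _ (orb_mem p z)) (U.smul_mem _ (heq ▸ orb_mem p u))
    · rw [hU, h.finrank_orb hzu.left_ne, h.finrank_orb (hzu.comb_ne hst)]
  let G : Submodule ℂ P :=
    { carrier := {p | (∀ l, M p l ∈ U) ∧ ∀ x ∈ U, ∀ y ∈ U, N p x y = 0}
      add_mem' := fun ha hb => ⟨fun l => by simpa using U.add_mem (ha.1 l) (hb.1 l),
        fun x hx y hy => by simp [ha.2 x hx y hy, hb.2 x hx y hy]⟩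
      zero_mem' := by simp
      smul_mem' := fun c a ha => ⟨fun l => by simpa using U.smul_mem c (ha.1 l),
        fun x hx y hy => by simp [ha.2 x hx y hy]⟩ }
  have hG : ∀ s t : ℂ, (s, t) ≠ (0, 0) → stab M (s • z + t • u) ≤ G := by
    intro s t hst p hp
    refine ⟨fun l => ?_, fun x hx y hy => ?_⟩
    · rw [← horb s t hst]
      exact h.mem_orb_of_stab (h.lagr _ (hzu.comb_ne hst)) hp l
    · rw [← horb s t hst] at hx hy
      exact h.N_of_stab hp hx hy
  suffices htop : G = ⊤ from (htop ▸ Submodule.mem_top : p ∈ G)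
  by_contra htop
  obtain ⟨φ, hφ0, hφ⟩ := Submodule.exists_le_ker_of_lt_top G (lt_top_iff_ne_top.2 htop)
  apply hφ0
  let a : P →ₗ[ℂ] U := (M.flip z).codRestrict U fun p => orb_mem p z
  let b : P →ₗ[ℂ] U := (M.flip u).codRestrict U fun p => heq ▸ orb_mem p u
  have hab : ∀ (s t : ℂ) p, ((s • a + t • b) p : F) = M p (s • z + t • u) := by
    intro s t p
    rw [map_add, map_smul, map_smul]
    rfl
  refine pencil_eq_zero (G := Module.Dual ℂ U) (E := Module.Dual ℂ P) a.dualMap b.dualMap ?_ ?_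
  · intro s t hst ψ hψ
    ext ⟨y, hy⟩
    rw [← horb s t hst] at hy
    obtain ⟨p, rfl⟩ := hy
    have h1 := LinearMap.congr_fun hψ p
    have h2 : (⟨(M.flip (s • z + t • u)) p, by rw [← horb s t hst]; exact orb_mem p _⟩ : U) =
        (s • a + t • b) p := Subtype.ext (hab s t p).symm
    rw [h2]
    simpa using h1
  · intro s t hst
    have h1 : φ ∈ LinearMap.range (s • a + t • b).dualMap := by
      rw [LinearMap.range_dualMap_eq_dualAnnihilator_ker, Submodule.mem_dualAnnihilator]
      intro p hp
      refine hφ (hG s t hst ?_)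
      rw [mem_stab, ← hab, LinearMap.mem_ker.1 hp]
      rfl
    obtain ⟨ψ, rfl⟩ := h1
    refine ⟨ψ, ?_⟩
    ext p
    simp

end Quartic

end Quartic

/-- Linear independence of a triple of vectors. -/
def Indep3 {E : Type*} [AddCommGroup E] [Module ℂ E] (x y z : E) : Prop :=
  ∀ a b c : ℂ, a • x + b • y + c • z = 0 → a = 0 ∧ b = 0 ∧ c = 0

namespace Indep3

variable {E : Type*} [AddCommGroup E] [Module ℂ E] {x y z : E}

theorem rotate (h : Indep3 x y z) : Indep3 y z x := fun a b c h0 => by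
  obtain ⟨h1, h2, h3⟩ := h c a b (by rw [← h0]; abel)
  exact ⟨h2, h3, h1⟩

theorem indep (h : Indep3 x y z) (s t : ℂ) (hst : (s, t) ≠ (0, 0)) :
    Indep x (s • y + t • z) := by
  intro a b h0
  obtain ⟨h1, h2, h3⟩ := h a (b * s) (b * t) (by rw [← h0]; module)
  refine ⟨h1, by_contra fun hb => hst ?_⟩
  rw [(mul_eq_zero.1 h2).resolve_left hb, (mul_eq_zero.1 h3).resolve_left hb]

theorem indep_left (h : Indep3 x y z) : Indep x y := by simpa using h.indep 1 0 (by simp)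

theorem indep_right (h : Indep3 x y z) : Indep x z := by simpa using h.indep 0 1 (by simp)

theorem exists_of_finrank [FiniteDimensional ℂ E] (W : Submodule ℂ E)
    (hW : 3 ≤ Module.finrank ℂ W) : ∃ x ∈ W, ∃ y ∈ W, ∃ z ∈ W, Indep3 x y z := by
  obtain ⟨f, hf⟩ := exists_linearIndependent_of_le_finrank hW
  refine ⟨f 0, (f 0).2, f 1, (f 1).2, f 2, (f 2).2, fun a b c h0 => ?_⟩
  have h1 := Fintype.linearIndependent_iff.1 hf ![a, b, c] (by
    rw [Fin.sum_univ_three]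
    exact Subtype.ext h0)
  exact ⟨h1 0, h1 1, h1 2⟩

end Indep3

section TypeTwo

variable {P L F : Type*} [AddCommGroup P] [Module ℂ P] [FiniteDimensional ℂ P]
  [AddCommGroup L] [Module ℂ L] [FiniteDimensional ℂ L]
  [AddCommGroup F] [Module ℂ F] [FiniteDimensional ℂ F]
  {M : P →ₗ[ℂ] L →ₗ[ℂ] F} {B : F →ₗ[ℂ] F →ₗ[ℂ] ℂ}

namespace FlatFour

variable (h : FlatFour M B)
include h

/-- A member of the family sending one vector into a subspace common to all swept-out spaces
takes values in the space swept out by that vector. -/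
theorem apply_mem_of_common {E : Submodule ℂ F} (hE : ∀ u, u ≠ 0 → E ≤ orb M u) {p : P} {u : L}
    (hu : u ≠ 0) (hp : M p u ∈ E) (l : L) : M p l ∈ orb M u := by
  refine (h.mem_orb_iff (h.lagr u hu)).2 fun q => ?_
  rw [h.skew, neg_eq_zero]
  by_cases hl : l = 0
  · simp [hl]
  · exact h.isotropic (orb_mem q l) (hE l hl hp)

theorem finrank_comap_common {E : Submodule ℂ F} {u : L} (hE : E ≤ orb M u) :
    Module.finrank ℂ (E.comap (M.flip u)) = Module.finrank ℂ (stab M u) + Module.finrank ℂ E := by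
  have h1 := finrank_comap_add (M.flip u) E
  rw [show LinearMap.range (M.flip u) ⊓ E = E from inf_eq_right.2 hE] at h1
  exact h1

variable (hdist : ∀ z u, Indep z u → orb M u ≠ orb M z)
include hdist

/-- The swept-out spaces have no common plane. -/
theorem not_common_plane {E : Submodule ℂ F} (hE : ∀ u, u ≠ 0 → E ≤ orb M u)
    (hd : Module.finrank ℂ E = 2) : False := by
  have hL : 0 < Module.finrank ℂ L := by rw [h.dimL]; norm_num
  have : Nontrivial L := Module.finrank_pos_iff.1 hL
  obtain ⟨z, hz⟩ := exists_ne (0 : L)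
  have hconst : ∀ u, u ≠ 0 → E.comap (M.flip u) ≤ E.comap (M.flip z) := by
    intro u hu p hp
    rcases Indep.or_eq_smul hu z with hind | ⟨s, rfl⟩
    · have h1 : M p z ∈ orb M u ⊓ orb M z :=
        ⟨h.apply_mem_of_common hE hu hp z, orb_mem p z⟩
      have h2 : E = orb M u ⊓ orb M z :=
        Submodule.eq_of_le_of_finrank_le (le_inf (hE u hu) (hE z hz))
          (by rw [h.finrank_inf hind (hdist _ _ hind), hd])
      rw [← h2] at h1
      exact h1
    · show M p (s • u) ∈ E
      rw [map_smul]
      exact E.smul_mem s hp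
  obtain ⟨C, hC⟩ := Submodule.exists_isCompl (E.comap (M.flip z))
  have hCd := Submodule.finrank_add_eq_of_isCompl hC
  rw [h.finrank_comap_common (hE z hz), hd] at hCd
  have hk := h.finrank_stab_add hz
  obtain ⟨D, hD⟩ := Submodule.exists_isCompl (perp B E)
  have hDd := Submodule.finrank_add_eq_of_isCompl hD
  have hpd := finrank_perp h.symm h.nondeg E
  have hEp : E ≤ perp B E := fun x hx y hy => h.isotropic (hE z hz hx) (hE z hz hy)
  have hED : (E ⊔ D) ⊓ perp B E ≤ E := by
    rintro x ⟨hx, hx'⟩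
    obtain ⟨a, ha, d, hd, rfl⟩ := Submodule.mem_sup.1 hx
    have h1 : d ∈ perp B E := by
      have := (perp B E).sub_mem hx' (hEp ha)
      rwa [add_sub_cancel_left] at this
    have h2 : d = 0 := (Submodule.mem_bot ℂ).1 (hD.disjoint.le_bot ⟨h1, hd⟩)
    rw [h2, add_zero]
    exact ha
  have hsd := Submodule.finrank_sup_add_finrank_inf_eq E D
  have hinf : E ⊓ D = ⊥ := eq_bot_iff.2 ((inf_le_inf_right D hEp).trans hD.disjoint.le_bot)
  rw [hinf, finrank_bot] at hsd
  have hq := Submodule.finrank_quotient_add_finrank (E ⊔ D)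
  have hF := h.dimF
  obtain ⟨p, hpC, hp0, -, y, hy0, hy⟩ := PolyFun.exists_singular (ι := Empty)
    (f := fun i => i.elim) C (fun i => i.elim) (fun i => i.elim) (by simp; omega)
    (M.compr₂ (E ⊔ D).mkQ) (by rw [h.dimL]; omega) hL
  apply hp0
  refine (Submodule.mem_bot ℂ).1 (hC.disjoint.le_bot ⟨hconst y hy0 ?_, hpC⟩)
  apply hED
  refine ⟨?_, fun e he => h.isotropic (orb_mem p y) (hE y hy0 he)⟩
  rw [LinearMap.compr₂_apply, Submodule.mkQ_apply, Submodule.Quotient.mk_eq_zero] at hy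
  exact hy

/-- If all swept-out spaces share a vector, some member of the family has rank one with that
image. -/
theorem exists_rank_one {c : F} (hc : c ≠ 0) (hcU : ∀ u, u ≠ 0 → c ∈ orb M u) :
    ∃ (p : P) (l : L →ₗ[ℂ] ℂ), l ≠ 0 ∧ ∀ x, M p x = l x • c := by
  obtain ⟨z, -, u, -, v, -, h3⟩ := Indep3.exists_of_finrank (⊤ : Submodule ℂ L)
    (by rw [finrank_top, h.dimL]; norm_num)
  have hzu := h3.indep_left
  have hz := hzu.left_ne
  have hu := hzu.right_ne
  have hC : ∀ u, u ≠ 0 → ℂ ∙ c ≤ orb M u := fun u hu =>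
    (Submodule.span_singleton_le_iff_mem _ _).2 (hcU u hu)
  have hmem : ∀ p, p ∈ (ℂ ∙ c).comap (M.flip z) ⊓ (ℂ ∙ c).comap (M.flip u) →
      ∀ x, M p x ∈ ℂ ∙ c := by
    rintro p ⟨hpz, hpu⟩
    by_contra! hcon
    obtain ⟨x, hx⟩ := hcon
    have hpE : ∀ l, M p l ∈ orb M z ⊓ orb M u := fun l =>
      ⟨h.apply_mem_of_common hC hz hpz l, h.apply_mem_of_common hC hu hpu l⟩
    have hEd := h.finrank_inf hzu (hdist _ _ hzu)
    have hspan : ∀ y, y ∈ orb M z ⊓ orb M u → y ∉ ℂ ∙ c → ∀ n, c ∈ orb M n → y ∈ orb M n →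
        orb M z ⊓ orb M u ≤ orb M n := by
      intro y hy hyc n hcn hyn
      have h1 : ℂ ∙ c < (ℂ ∙ c) ⊔ ℂ ∙ y := lt_of_le_of_ne le_sup_left fun h0 =>
        hyc (h0 ▸ Submodule.mem_sup_right (Submodule.mem_span_singleton_self y))
      have h2 := Submodule.finrank_lt_finrank_of_lt h1
      rw [finrank_span_singleton hc] at h2
      have h3 : (ℂ ∙ c) ⊔ ℂ ∙ y = orb M z ⊓ orb M u :=
        Submodule.eq_of_le_of_finrank_le
          (sup_le (le_inf (hC z hz) (hC u hu)) ((Submodule.span_singleton_le_iff_mem _ _).2 hy))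
          (by omega)
      rw [← h3]
      exact sup_le ((Submodule.span_singleton_le_iff_mem _ _).2 hcn)
        ((Submodule.span_singleton_le_iff_mem _ _).2 hyn)
    refine h.not_common_plane hdist (E := orb M z ⊓ orb M u) (fun n hn => ?_) hEd
    by_cases hnc : M p n ∈ ℂ ∙ c
    · exact hspan (M p x) (hpE x) hx n (hcU n hn) (h.apply_mem_of_common hC hn hnc x)
    · exact hspan (M p n) (hpE n) hnc n (hcU n hn) (orb_mem p n)
  have dz := h.finrank_comap_common (hC z hz)
  have du := h.finrank_comap_common (hC u hu)
  rw [finrank_span_singleton hc] at dz du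
  have hle : (ℂ ∙ c).comap (M.flip z) ⊔ (ℂ ∙ c).comap (M.flip u) ≤ link M z u := by
    refine sup_le (fun p hp => hC u hu hp) ?_
    rw [h.link_comm (h.lagr z hz) (h.lagr u hu)]
    exact fun p hp => hC z hz hp
  have hle' := Submodule.finrank_mono hle
  rw [h.finrank_link_of_ne hzu (hdist _ _ hzu)] at hle'
  have hsum := Submodule.finrank_sup_add_finrank_inf_eq ((ℂ ∙ c).comap (M.flip z))
    ((ℂ ∙ c).comap (M.flip u))
  have kz := h.finrank_stab_add hz
  have ku := h.finrank_stab_add hu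
  obtain ⟨p, hp, hp0⟩ : ∃ p ∈ (ℂ ∙ c).comap (M.flip z) ⊓ (ℂ ∙ c).comap (M.flip u), M p ≠ 0 := by
    by_contra! hcon
    have h1 : (ℂ ∙ c).comap (M.flip z) ⊓ (ℂ ∙ c).comap (M.flip u) ≤ stab M z := fun p hp => by
      rw [mem_stab, hcon p hp]; rfl
    have h2 := Submodule.eq_of_le_of_finrank_le h1 (by omega)
    obtain ⟨p, hpz, hp⟩ := h.exists_stab hz
    exact hp (hcon p (h2 ▸ hpz))
  obtain ⟨φ, hφ⟩ := exists_dual_of_linearIndependent (r := 1) (y := fun _ => c)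
    (LinearIndependent.of_subsingleton 0 hc)
  have hφc : φ 0 c = 1 := by simpa using hφ 0 0
  have hval : ∀ x, M p x = φ 0 (M p x) • c := by
    intro x
    obtain ⟨s, hs⟩ := Submodule.mem_span_singleton.1 (hmem p hp x)
    rw [← hs, map_smul, hφc, smul_eq_mul, mul_one]
  refine ⟨p, φ 0 ∘ₗ M p, fun h0 => hp0 ?_, hval⟩
  ext x
  rw [hval]
  have : φ 0 (M p x) = 0 := LinearMap.congr_fun h0 x
  rw [this, zero_smul]
  rfl

/-- The proportionality factor of `exists_smul_form` does not depend on the vectors. -/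
theorem exists_smul_form_pair {w a b : L} (hwab : Indep3 w a b)
    (n : F →ₗ[ℂ] F →ₗ[ℂ] ℂ) (hs : ∀ x y, n x y = n y x)
    (hn : ∀ v ∈ Submodule.span ℂ {w, a, b}, ∀ x ∈ orb M v, ∀ y ∈ orb M v, n x y = 0) :
    ∃ t : ℂ, ∀ x ∈ orb M w, (∀ y ∈ orb M a, n x y = t * B x y) ∧
      ∀ y ∈ orb M b, n x y = t * B x y := by
  have hspan : ∀ r s t : ℂ, r • w + (s • a + t • b) ∈ Submodule.span ℂ {w, a, b} := by
    intro r s t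
    exact add_mem (Submodule.smul_mem _ _ (Submodule.subset_span (by simp)))
      (add_mem (Submodule.smul_mem _ _ (Submodule.subset_span (by simp)))
        (Submodule.smul_mem _ _ (Submodule.subset_span (by simp))))
  have key : ∀ s t : ℂ, (s, t) ≠ (0, 0) → ∃ τ : ℂ, ∀ x ∈ orb M w,
      ∀ y ∈ orb M (s • a + t • b), n x y = τ * B x y := by
    intro s t hst
    refine h.exists_smul_form (hwab.indep s t hst) (hdist _ _ (hwab.indep s t hst)) n hs ?_
    intro r r'
    refine hn _ ?_
    rw [smul_add, smul_smul, smul_smul]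
    exact hspan _ _ _
  obtain ⟨ta, ha⟩ := key 1 0 (by simp)
  obtain ⟨tb, hb⟩ := key 0 1 (by simp)
  obtain ⟨τ, ht⟩ := key 1 1 (by simp)
  simp only [one_smul, zero_smul, add_zero, zero_add] at ha hb ht
  have hzero : ∀ p q, pairForm M B w ((τ - ta) • a + (τ - tb) • b) p q = 0 := by
    intro p q
    have h1 := ht _ (orb_mem p w) _ (orb_mem q (a + b))
    have h2 := ha _ (orb_mem p w) _ (orb_mem q a)
    have h3 := hb _ (orb_mem p w) _ (orb_mem q b)
    rw [map_add, map_add, map_add, h2, h3] at h1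
    rw [pairForm_apply, map_add, map_add, map_smul, map_smul, map_smul, map_smul, smul_eq_mul,
      smul_eq_mul]
    linear_combination -h1
  have hst : (τ - ta, τ - tb) = ((0 : ℂ), (0 : ℂ)) := by
    by_contra hst
    have hind := hwab.indep _ _ hst
    obtain ⟨p, q, hpq⟩ := h.exists_pairForm_ne hind (hdist _ _ hind)
    exact hpq (hzero p q)
  obtain ⟨h1, h2⟩ := Prod.mk.inj hst
  refine ⟨τ, fun x hx => ⟨fun y hy => ?_, fun y hy => ?_⟩⟩
  · rw [ha x hx y hy]; linear_combination -(B x y) * h1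
  · rw [hb x hx y hy]; linear_combination -(B x y) * h2

/-- Three independent vectors sweep out the orthogonal complement of a common vector. -/
theorem perp_le_sup {c : F} (hc : c ≠ 0) (hcU : ∀ u, u ≠ 0 → c ∈ orb M u) {w a b : L}
    (hwab : Indep3 w a b) {x : F} (hx : B c x = 0) : x ∈ orb M w ⊔ orb M a ⊔ orb M b := by
  have hwa := hwab.indep_left
  have hwb := hwab.indep_right
  have hd : Module.finrank ℂ (orb M w ⊔ orb M a : Submodule ℂ F) = 6 := by
    have e := Submodule.finrank_sup_add_finrank_inf_eq (orb M w) (orb M a)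
    rw [h.finrank_inf hwa (hdist _ _ hwa), h.finrank_orb hwa.left_ne,
      h.finrank_orb hwa.right_ne] at e
    omega
  have hlt : orb M w ⊔ orb M a < orb M w ⊔ orb M a ⊔ orb M b := by
    refine lt_of_le_of_ne le_sup_left fun h0 => ?_
    have hle : orb M b ≤ orb M w ⊔ orb M a := h0 ▸ le_sup_right
    have hinf : orb M w ⊓ orb M a ≤ orb M b := by
      rw [← h.perp_orb (h.lagr b hwb.right_ne)]
      rintro x ⟨hx1, hx2⟩ y hy
      obtain ⟨y1, hy1, y2, hy2, rfl⟩ := Submodule.mem_sup.1 (hle hy)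
      rw [map_add, h.isotropic hx1 hy1, h.isotropic hx2 hy2, add_zero]
    have hlink : link M w a ≤ link M w b := fun p hp => hinf ⟨orb_mem p w, hp⟩
    have e := h.finrank_link_inf hdist hwab.indep
    rw [inf_eq_left.2 hlink, h.finrank_link_of_ne hwa (hdist _ _ hwa)] at e
    omega
  have hlt' := Submodule.finrank_lt_finrank_of_lt hlt
  have hperp := finrank_perp h.symm h.nondeg (ℂ ∙ c)
  rw [finrank_span_singleton hc, h.dimF] at hperp
  have hU : ∀ u, u ≠ 0 → orb M u ≤ perp B (ℂ ∙ c) := by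
    intro u hu y hy d hd
    exact h.isotropic hy ((Submodule.span_singleton_le_iff_mem _ _).2 (hcU u hu) hd)
  have heq : orb M w ⊔ orb M a ⊔ orb M b = perp B (ℂ ∙ c) :=
    Submodule.eq_of_le_of_finrank_le (sup_le (sup_le (hU _ hwa.left_ne) (hU _ hwa.right_ne))
      (hU _ hwb.right_ne)) (by omega)
  rw [heq]
  intro d hd
  obtain ⟨s, rfl⟩ := Submodule.mem_span_singleton.1 hd
  rw [map_smul, h.symm, hx, smul_zero]

end FlatFour

/-- A flat quartic family whose swept-out spaces share a vector contains a degenerate member. -/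
theorem Quartic.exists_rank_one {N : P →ₗ[ℂ] F →ₗ[ℂ] F →ₗ[ℂ] ℂ} {q : P} (h : Quartic M B N q)
    (hdist : ∀ z u, Indep z u → orb M u ≠ orb M z) {c : F} (hc : c ≠ 0)
    (hcU : ∀ u, u ≠ 0 → c ∈ orb M u) :
    ∃ (p : P) (t : ℂ) (l : L →ₗ[ℂ] ℂ), l ≠ 0 ∧ (∀ x, M p x = l x • c) ∧
      ∀ x y, B c x = 0 → B c y = 0 → N p x y = t * B x y := by
  obtain ⟨p, l, hl, hp⟩ := h.toFlatFour.exists_rank_one hdist hc hcU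
  have hker : 3 ≤ Module.finrank ℂ (LinearMap.ker l) := by
    have h1 := LinearMap.finrank_range_add_finrank_ker l
    have h2 := Submodule.finrank_le (LinearMap.range l)
    rw [Module.finrank_self] at h2
    rw [h.dimL] at h1
    omega
  obtain ⟨w, hw, a, ha, b, hb, h3⟩ := Indep3.exists_of_finrank _ hker
  have hn : ∀ v ∈ LinearMap.ker l, ∀ x ∈ orb M v, ∀ y ∈ orb M v, N p x y = 0 := by
    intro v hv x hx y hy
    exact h.N_of_stab (by rw [hp, LinearMap.mem_ker.1 hv, zero_smul]) hx hy
  have hspan : ∀ x y z, x ∈ LinearMap.ker l → y ∈ LinearMap.ker l → z ∈ LinearMap.ker l →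
      ∀ v ∈ Submodule.span ℂ {x, y, z}, v ∈ LinearMap.ker l := by
    intro x y z hx hy hz v hv
    refine Submodule.span_le.2 ?_ hv
    rintro _ (rfl | rfl | rfl) <;> assumption
  obtain ⟨t, ht⟩ := h.exists_smul_form_pair hdist h3 (N p) (h.Nsymm p)
    fun v hv => hn v (hspan _ _ _ hw ha hb v hv)
  obtain ⟨t', ht'⟩ := h.exists_smul_form_pair hdist h3.rotate (N p) (h.Nsymm p)
    fun v hv => hn v (hspan _ _ _ ha hb hw v hv)
  have htt : t' = t := by
    obtain ⟨r, s, hrs⟩ := h.exists_pairForm_ne h3.indep_left (hdist _ _ h3.indep_left)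
    have e1 := (ht _ (orb_mem r w)).1 _ (orb_mem s a)
    have e2 := (ht' _ (orb_mem s a)).2 _ (orb_mem r w)
    rw [h.Nsymm, h.symm] at e2
    rw [e2] at e1
    exact mul_right_cancel₀ hrs e1
  subst htt
  refine ⟨p, t', l, hl, hp, fun x y hx hy => ?_⟩
  obtain ⟨x', hx', x3, hx3, rfl⟩ := Submodule.mem_sup.1 (h.perp_le_sup hdist hc hcU h3 hx)
  obtain ⟨x1, hx1, x2, hx2, rfl⟩ := Submodule.mem_sup.1 hx'
  obtain ⟨y', hy', y3, hy3, rfl⟩ := Submodule.mem_sup.1 (h.perp_le_sup hdist hc hcU h3 hy)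
  obtain ⟨y1, hy1, y2, hy2, rfl⟩ := Submodule.mem_sup.1 hy'
  simp only [map_add, LinearMap.add_apply, hn _ hw _ hx1 _ hy1, hn _ ha _ hx2 _ hy2,
    hn _ hb _ hx3 _ hy3, h.isotropic hx1 hy1, h.isotropic hx2 hy2, h.isotropic hx3 hy3,
    (ht _ hx1).1 _ hy2, (ht _ hx1).2 _ hy3, (ht' _ hx2).1 _ hy3, (ht' _ hx2).2 _ hy1,
    h.Nsymm p x3 y1, h.Nsymm p x3 y2, (ht _ hy1).2 _ hx3, (ht' _ hy2).1 _ hx3, h.symm x3]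
  ring

end TypeTwo

section TypeOne

variable {P L F : Type*} [AddCommGroup P] [Module ℂ P] [FiniteDimensional ℂ P]
  [AddCommGroup L] [Module ℂ L] [FiniteDimensional ℂ L]
  [AddCommGroup F] [Module ℂ F] [FiniteDimensional ℂ F]
  {M : P →ₗ[ℂ] L →ₗ[ℂ] F} {B : F →ₗ[ℂ] F →ₗ[ℂ] ℂ}
  {N : P →ₗ[ℂ] F →ₗ[ℂ] F →ₗ[ℂ] ℂ} {q : P}

/-- A hyperplane and a vector outside it span. -/
theorem Submodule.exists_sub_smul_mem {H : Submodule ℂ P}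
    (hH : Module.finrank ℂ H + 1 = Module.finrank ℂ P) {p₁ : P} (hp₁ : p₁ ∉ H) (p : P) :
    ∃ s : ℂ, p - s • p₁ ∈ H := by
  have h1 : H < H ⊔ ℂ ∙ p₁ := lt_of_le_of_ne le_sup_left fun h0 =>
    hp₁ (h0 ▸ Submodule.mem_sup_right (Submodule.mem_span_singleton_self p₁))
  have h2 := Submodule.finrank_lt_finrank_of_lt h1
  have h3 : H ⊔ ℂ ∙ p₁ = ⊤ := Submodule.eq_top_of_finrank_eq (by
    have := Submodule.finrank_le (H ⊔ ℂ ∙ p₁); omega)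
  obtain ⟨a, ha, b, hb, rfl⟩ := Submodule.mem_sup.1 (h3 ▸ Submodule.mem_top : p ∈ _)
  obtain ⟨s, rfl⟩ := Submodule.mem_span_singleton.1 hb
  exact ⟨s, by rwa [add_sub_cancel_right]⟩

/-- A flat four-dimensional family, a hyperplane of which takes values in a fixed maximal
isotropic subspace. -/
structure TypeOne (M : P →ₗ[ℂ] L →ₗ[ℂ] F) (B : F →ₗ[ℂ] F →ₗ[ℂ] ℂ)
    (N : P →ₗ[ℂ] F →ₗ[ℂ] F →ₗ[ℂ] ℂ) (q : P) (H : Submodule ℂ P) (p₁ : P)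
    (G : Submodule ℂ F) : Prop extends Quartic M B N q where
  dist : ∀ z u, Indep z u → orb M u ≠ orb M z
  finH : Module.finrank ℂ H + 1 = Module.finrank ℂ P
  hyper : ∀ p, ∃ s : ℂ, p - s • p₁ ∈ H
  stab_le : ∀ w, w ≠ 0 → stab M w ≤ H
  mem : ∀ p ∈ H, ∀ x, M p x ∈ G
  finG : Module.finrank ℂ G = 4
  perpG : perp B G = G
  inj : ∀ x, M p₁ x ∈ G → x = 0

theorem FlatFour.exists_hyperplane (h : FlatFour M B)
    (hdist : ∀ z u, Indep z u → orb M u ≠ orb M z)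
    (hII : ¬ ∃ c, c ≠ 0 ∧ ∀ u, u ≠ 0 → c ∈ orb M u) :
    ∃ H : Submodule ℂ P, Module.finrank ℂ H + 1 = Module.finrank ℂ P ∧
      (∀ w, w ≠ 0 → stab M w ≤ H) ∧ ∀ p ∈ H, ∀ q ∈ H, ∀ x y, B (M p x) (M q y) = 0 := by
  choose! H hKH hHd hH using fun z (hz : z ≠ 0) => (h.dichotomy hdist hz).resolve_left hII
  have hsup : ∀ {z p}, z ≠ 0 → p ∉ H z → ∀ r, ∃ s : ℂ, r - s • p ∈ H z := fun hz hp =>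
    Submodule.exists_sub_smul_mem (hHd _ hz) hp
  have hle : ∀ w, w ≠ 0 → ∀ u, u ≠ 0 → stab M w ≤ H u := by
    intro w hw u hu p hp
    by_contra hpu
    rcases Indep.or_eq_smul hu w with hind | ⟨s, rfl⟩
    · obtain ⟨a, b, hab⟩ := h.exists_pairForm_ne hind (hdist _ _ hind)
      apply hab
      have hz1 : ∀ r, pairForm M B u w r p = 0 := fun r => by
        rw [pairForm_apply, mem_stab.1 hp, map_zero]
      have hz2 : ∀ r, pairForm M B u w p r = 0 := fun r => by rw [h.pairForm_skew, hz1, neg_zero]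
      obtain ⟨s, hs⟩ := hsup hu hpu a
      obtain ⟨t, ht⟩ := hsup hu hpu b
      have := hH u hu _ hs _ ht w
      rw [← pairForm_apply] at this
      simpa [hz1, hz2] using this
    · apply hpu
      apply hKH u hu
      rw [mem_stab, map_smul] at hp
      exact (smul_eq_zero.1 hp).resolve_left fun h0 => hw (by rw [h0, zero_smul])
  have hL : 0 < Module.finrank ℂ L := by rw [h.dimL]; norm_num
  have : Nontrivial L := Module.finrank_pos_iff.1 hL
  obtain ⟨z, hz⟩ := exists_ne (0 : L)
  refine ⟨H z, hHd z hz, fun w hw => hle w hw z hz, ?_⟩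
  by_contra hcon
  have hnot : ∃ u, ∃ p ∈ H z, ∃ r ∈ H z, ∃ y, B (M p u) (M r y) ≠ 0 := by
    by_contra! h0
    exact hcon fun p hp r hr x y => h0 x p hp r hr y
  obtain ⟨u, p, hp, r, hr, y, hpy⟩ := hnot
  have hkill : ∀ v, (∃ p ∈ H z, ∃ r ∈ H z, ∃ y, B (M p v) (M r y) ≠ 0) →
      ∀ w, w ≠ 0 → ∀ p' ∈ stab M w, ∀ b, B (M p' z) (M b v) = 0 := by
    rintro v ⟨p, hp, r, hr, y, hpy⟩ w hw p' hp' b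
    have hv : v ≠ 0 := by rintro rfl; simp at hpy
    have hne : ¬ H v ≤ H z := by
      intro hle'
      have := Submodule.eq_of_le_of_finrank_le hle' (by have := hHd z hz; have := hHd v hv; omega)
      rw [← this] at hp hr
      exact hpy (hH v hv p hp r hr y)
    obtain ⟨e, hev, hez⟩ := SetLike.not_le_iff_exists.1 hne
    obtain ⟨s, hs⟩ := hsup hz hez b
    have e1 := hH z hz p' (hle w hw z hz hp') _ hs v
    have e2 := hH v hv _ hev p' (hle w hw v hv hp') z
    rw [h.symm] at e2
    simpa [e2] using e1
  have hall : ∀ w, w ≠ 0 → stab M w ≤ stab M z := by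
    intro w hw p' hp'
    by_contra hne
    apply hII
    refine ⟨M p' z, hne, fun v hv => (h.mem_orb_iff (h.lagr v hv)).2 fun b => ?_⟩
    have hu := hkill u ⟨p, hp, r, hr, y, hpy⟩ w hw p' hp' b
    by_cases hv' : ∃ p ∈ H z, ∃ r ∈ H z, ∃ y, B (M p v) (M r y) ≠ 0
    · exact hkill v hv' w hw p' hp' b
    · push Not at hv'
      have h1 := hkill (v + u) ⟨p, hp, r, hr, y, by simpa [hv' p hp r hr y] using hpy⟩ w hw p' hp' b
      simpa [hu] using h1
  obtain ⟨p', hpz, hp0⟩ := h.exists_stab hz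
  apply hp0
  ext w
  by_cases hw : w = 0
  · simp [hw]
  · have : p' ∈ stab M w := by rw [h.stab_eq_of_le hw hz (hall w hw)]; exact hpz
    exact this

theorem Quartic.exists_typeOne (h : Quartic M B N q)
    (hdist : ∀ z u, Indep z u → orb M u ≠ orb M z)
    (hII : ¬ ∃ c, c ≠ 0 ∧ ∀ u, u ≠ 0 → c ∈ orb M u) :
    ∃ H p₁ G, TypeOne M B N q H p₁ G := by
  obtain ⟨H, hHd, hKH, hH⟩ := h.exists_hyperplane hdist hII
  obtain ⟨z, -, u, -, v, -, h3⟩ := Indep3.exists_of_finrank (⊤ : Submodule ℂ L)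
    (by rw [finrank_top, h.dimL]; norm_num)
  have hz := h3.indep_left.left_ne
  obtain ⟨p₁, hp₁⟩ : ∃ p₁, p₁ ∉ H := by
    by_contra! hcon
    have : H = ⊤ := eq_top_iff.2 fun x _ => hcon x
    rw [this, finrank_top] at hHd
    omega
  have hhyp := Submodule.exists_sub_smul_mem hHd hp₁
  let G : Submodule ℂ F := Submodule.span ℂ {y | ∃ p ∈ H, ∃ x, M p x = y}
  have hmem : ∀ p ∈ H, ∀ x, M p x ∈ G := fun p hp x => Submodule.subset_span ⟨p, hp, x, rfl⟩
  have hiso : ∀ x ∈ G, ∀ y ∈ G, B x y = 0 := by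
    intro x hx y hy
    refine Submodule.span_induction (p := fun x _ => B x y = 0) ?_ (by simp)
      (fun a b _ _ ha hb => by simp [ha, hb]) (fun s a _ ha => by simp [ha]) hx
    rintro _ ⟨p, hp, x, rfl⟩
    refine Submodule.span_induction (p := fun y _ => B (M p x) y = 0) ?_ (by simp)
      (fun a b _ _ ha hb => by simp [ha, hb]) (fun s a _ ha => by simp [ha]) hy
    rintro _ ⟨r, hr, y, rfl⟩
    exact hH p hp r hr x y
  have hG4 := two_mul_finrank_le h.symm h.nondeg hiso
  rw [h.dimF] at hG4
  have hmap : ∀ w, w ≠ 0 → Module.finrank ℂ (H.map (M.flip w)) = 3 := by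
    intro w hw
    have e := LinearMap.finrank_range_add_finrank_ker ((M.flip w).domRestrict H)
    rw [LinearMap.range_domRestrict, LinearMap.ker_domRestrict] at e
    have e2 : Module.finrank ℂ ((LinearMap.ker (M.flip w)).submoduleOf H) =
        Module.finrank ℂ (stab M w) :=
      (Submodule.submoduleOfEquivOfLe (hKH w hw)).finrank_eq
    have e3 := h.finrank_stab_add hw
    change _ + Module.finrank ℂ ((LinearMap.ker (M.flip w)).submoduleOf H) = _ at e
    omega
  have hmapG : ∀ w, H.map (M.flip w) ≤ G := by
    rintro w _ ⟨p, hp, rfl⟩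
    exact hmem p hp w
  have hGe : Module.finrank ℂ G = 4 := by
    by_contra hne
    have h3' := Submodule.finrank_mono (hmapG z)
    rw [hmap z hz] at h3'
    have heq : ∀ w, w ≠ 0 → H.map (M.flip w) = G := fun w hw =>
      Submodule.eq_of_le_of_finrank_le (hmapG w) (by rw [hmap w hw]; omega)
    have hGb : G ≠ ⊥ := by
      intro h0
      rw [h0, finrank_bot] at h3'
      omega
    obtain ⟨c, hc, hc0⟩ := Submodule.exists_mem_ne_zero_of_ne_bot hGb
    refine hII ⟨c, hc0, fun w hw => ?_⟩
    rw [← heq w hw] at hc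
    obtain ⟨p, -, rfl⟩ := hc
    exact orb_mem p w
  refine ⟨H, p₁, G, { h with
    dist := hdist, finH := hHd, hyper := hhyp, stab_le := hKH, mem := hmem, finG := hGe, perpG := perp_eq_self h.symm h.nondeg hiso (by rw [h.dimF, hGe]), inj := ?_ }⟩
  intro x hx
  by_contra hx0
  have hxG : orb M x = G := by
    apply Submodule.eq_of_le_of_finrank_le
    · rintro _ ⟨p, rfl⟩
      obtain ⟨s, hs⟩ := hhyp p
      have := G.add_mem (hmem _ hs x) (G.smul_mem s hx)
      rw [map_sub, map_smul, LinearMap.sub_apply, LinearMap.smul_apply, sub_add_cancel] at this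
      exact this
    · rw [hGe, h.finrank_orb hx0]
  obtain ⟨y, hy⟩ : ∃ y, Indep x y := by
    rcases Indep.or_eq_smul hx0 z with hi | ⟨s, rfl⟩
    · exact ⟨_, hi⟩
    rcases Indep.or_eq_smul hx0 u with hi | ⟨t, rfl⟩
    · exact ⟨_, hi⟩
    obtain ⟨h1, h2⟩ := h3.indep_left t (-s) (by module)
    rw [neg_eq_zero] at h2
    rw [h2, zero_smul] at hz
    exact absurd rfl hz
  have e1 := h.finrank_inf hy (hdist _ _ hy)
  have e2 : H.map (M.flip y) ≤ orb M x ⊓ orb M y := by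
    refine le_inf (hxG ▸ hmapG y) ?_
    rintro _ ⟨p, -, rfl⟩
    exact orb_mem p y
  have e3 := Submodule.finrank_mono e2
  rw [hmap y hy.right_ne, e1] at e3
  omega

end TypeOne

section Skew

variable {L : Type*} [AddCommGroup L] [Module ℂ L] [FiniteDimensional ℂ L]

/-- A pencil of alternating forms on a four-dimensional space one of which has a kernel on which
another one is nonzero contains a nondegenerate form. -/
theorem exists_nondeg_of_skew (hL : Module.finrank ℂ L = 4) {ω ω' : L →ₗ[ℂ] L →ₗ[ℂ] ℂ}
    (hs : ∀ x y, ω x y = -ω y x) (hs' : ∀ x y, ω' x y = -ω' y x) (hω : ω ≠ 0) {z u : L}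
    (hz : ω z = 0) (hu : ω u = 0) (hzu : ω' z u ≠ 0) :
    ∃ s : ℂ, ∀ x, (∀ y, (ω' + s • ω) x y = 0) → x = 0 := by
  have hd : ∀ x, ω x x = 0 := fun x => by linear_combination (1/2) * hs x x
  have hd' : ∀ x, ω' x x = 0 := fun x => by linear_combination (1/2) * hs' x x
  obtain ⟨a, b, hab⟩ : ∃ a b, ω a b ≠ 0 := by
    by_contra! h0
    exact hω (LinearMap.ext fun a => LinearMap.ext fun b => h0 a b)
  have hproj : ∀ a, ∃ a', ω' z a' = 0 ∧ ω' u a' = 0 ∧ ∀ b, ω a' b = ω a b := by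
    intro a
    refine ⟨a - (ω' a u / ω' z u) • z + (ω' a z / ω' z u) • u, ?_, ?_, fun b => ?_⟩
    · simp only [map_add, map_sub, map_smul, hd', smul_eq_mul, hs' a z]
      field_simp
      ring
    · simp only [map_add, map_sub, map_smul, hd', smul_eq_mul, hs' u z, hs' a u]
      field_simp
      ring
    · simp [hz, hu]
  obtain ⟨a', haz, hau, ha⟩ := hproj a
  obtain ⟨b', hbz, hbu, hb⟩ := hproj b
  have hab' : ω a' b' = ω a b := by rw [ha, hs, hb, ← hs]
  refine ⟨(1 - ω' a' b') / ω a b, ?_⟩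
  set s := (1 - ω' a' b') / ω a b with hsdef
  set θ := ω' + s • ω with hθ
  have θs : ∀ x y, θ x y = -θ y x := fun x y => by
    simp only [hθ, LinearMap.add_apply, LinearMap.smul_apply, smul_eq_mul, hs x y, hs' x y]; ring
  have θd : ∀ x, θ x x = 0 := fun x => by linear_combination (1/2) * θs x x
  have e1 : θ a' b' = 1 := by
    simp only [hθ, LinearMap.add_apply, LinearMap.smul_apply, smul_eq_mul, hab', hsdef]
    field_simp
    ring
  have e2 : θ z u = ω' z u := by simp [hθ, hz]
  have e3 : θ z a' = 0 := by simp [hθ, hz, haz]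
  have e4 : θ z b' = 0 := by simp [hθ, hz, hbz]
  have e5 : θ u a' = 0 := by simp [hθ, hu, hau]
  have e6 : θ u b' = 0 := by simp [hθ, hu, hbu]
  have key : ∀ c0 c1 c2 c3 : ℂ, (∀ y, θ (c0 • z + c1 • u + c2 • a' + c3 • b') y = 0) →
      c0 = 0 ∧ c1 = 0 ∧ c2 = 0 ∧ c3 = 0 := by
    intro c0 c1 c2 c3 h0
    have k1 := h0 z
    have k2 := h0 u
    have k3 := h0 a'
    have k4 := h0 b'
    simp only [map_add, map_smul, LinearMap.add_apply, LinearMap.smul_apply, smul_eq_mul, θd,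
      θs u z, θs a' z, θs b' z, θs a' u, θs b' u, θs b' a', e1, e2, e3, e4, e5, e6, mul_zero,
      add_zero, zero_add, neg_zero, mul_one, mul_neg, neg_eq_zero, mul_eq_zero, hzu, or_false]
      at k1 k2 k3 k4
    exact ⟨k2, k1, k4, k3⟩
  have hli : LinearIndependent ℂ ![z, u, a', b'] := by
    rw [Fintype.linearIndependent_iff]
    intro c hc
    simp only [Fin.sum_univ_four, Matrix.cons_val] at hc
    obtain ⟨h0, h1, h2, h3⟩ := key (c 0) (c 1) (c 2) (c 3) (fun y => by
      rw [hc, map_zero, LinearMap.zero_apply])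
    intro i
    fin_cases i <;> assumption
  have hsp := hli.span_eq_top_of_card_eq_finrank' (by simp [hL])
  intro x hx
  obtain ⟨c, rfl⟩ := (Submodule.mem_span_range_iff_exists_fun ℂ).1
    (hsp ▸ Submodule.mem_top : x ∈ Submodule.span ℂ (Set.range ![z, u, a', b']))
  simp only [Fin.sum_univ_four, Matrix.cons_val] at hx ⊢
  obtain ⟨h0, h1, h2, h3⟩ := key _ _ _ _ hx
  simp [h0, h1, h2, h3]

/-- The kernel of an alternating form on a four-dimensional space is not a line. -/
theorem exists_indep_of_skew (hL : Module.finrank ℂ L = 4) {ω : L →ₗ[ℂ] L →ₗ[ℂ] ℂ}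
    (hs : ∀ x y, ω x y = -ω y x) {z : L} (hz0 : z ≠ 0) (hz : ω z = 0) :
    ∃ u, Indep z u ∧ ω u = 0 := by
  obtain ⟨R, hR⟩ := Submodule.exists_isCompl (ℂ ∙ z)
  have hRd := Submodule.finrank_add_eq_of_isCompl hR
  rw [finrank_span_singleton hz0, hL] at hRd
  by_contra! hcon
  have hev := even_finrank_of_skew (ω.compl₁₂ R.subtype R.subtype) (fun x y => hs x y) (by
    intro x hx
    by_contra hx0
    refine hcon x (Indep.of_isCompl hR hz0 x.2 fun h0 => hx0 (Subtype.ext h0)) ?_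
    ext y
    obtain ⟨a, ha, b, hb, rfl⟩ := Submodule.mem_sup.1
      (hR.sup_eq_top ▸ Submodule.mem_top : y ∈ (ℂ ∙ z) ⊔ R)
    obtain ⟨s, rfl⟩ := Submodule.mem_span_singleton.1 ha
    have h1 : ω x z = 0 := by rw [hs, hz]; simp
    have h2 := hx ⟨b, hb⟩
    change ω x b = 0 at h2
    simp [h1, h2])
  have : Module.finrank ℂ R = 3 := by omega
  rw [this] at hev
  exact absurd hev (by decide)

end Skew

namespace TypeOne

variable {P L F : Type*} [AddCommGroup P] [Module ℂ P] [FiniteDimensional ℂ P]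
  [AddCommGroup L] [Module ℂ L] [FiniteDimensional ℂ L]
  [AddCommGroup F] [Module ℂ F] [FiniteDimensional ℂ F]
  {M : P →ₗ[ℂ] L →ₗ[ℂ] F} {B : F →ₗ[ℂ] F →ₗ[ℂ] ℂ}
  {N : P →ₗ[ℂ] F →ₗ[ℂ] F →ₗ[ℂ] ℂ} {q : P} {H : Submodule ℂ P} {p₁ : P} {G : Submodule ℂ F}
  (h : TypeOne M B N q H p₁ G)
include h

theorem iso {x y : F} (hx : x ∈ G) (hy : y ∈ G) : B x y = 0 := by
  rw [← h.perpG] at hx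
  exact hx y hy

theorem exists_decomp (v : F) : ∃ g ∈ G, ∃ y, v = g + M p₁ y := by
  have hinj : Function.Injective (M p₁) := by
    rw [← LinearMap.ker_eq_bot, LinearMap.ker_eq_bot']
    exact fun x hx => h.inj x (by rw [hx]; exact G.zero_mem)
  have h1 := LinearMap.finrank_range_of_inj hinj
  have h2 : G ⊓ LinearMap.range (M p₁) = ⊥ := by
    rw [eq_bot_iff]
    rintro _ ⟨hg, y, rfl⟩
    rw [h.inj y hg, map_zero]
    exact Submodule.zero_mem _
  have h3 := Submodule.finrank_sup_add_finrank_inf_eq G (LinearMap.range (M p₁))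
  rw [h2, finrank_bot, h1, h.finG, h.dimL] at h3
  have h4 : G ⊔ LinearMap.range (M p₁) = ⊤ :=
    Submodule.eq_top_of_finrank_eq (by rw [h.dimF]; omega)
  obtain ⟨g, hg, _, ⟨y, rfl⟩, hv⟩ := Submodule.mem_sup.1 (h4 ▸ Submodule.mem_top : v ∈ _)
  exact ⟨g, hg, y, hv.symm⟩

theorem eq_zero_of_mem {g : F} (hg : g ∈ G) (h0 : ∀ y, B g (M p₁ y) = 0) : g = 0 := by
  refine h.nondeg _ fun v => ?_
  obtain ⟨g', hg', y, rfl⟩ := h.exists_decomp v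
  rw [map_add, h.iso hg hg', h0, add_zero]

theorem omega_skew (p : P) (x y : L) : B (M p x) (M p₁ y) = -B (M p y) (M p₁ x) := by
  rw [h.skew, h.symm]

theorem exists_bijective : ∃ p ∈ H, Function.Injective (M p) := by
  have hLpos : 0 < Module.finrank ℂ L := by rw [h.dimL]; norm_num
  have : Nontrivial L := Module.finrank_pos_iff.1 hLpos
  obtain ⟨z, hz⟩ := exists_ne (0 : L)
  obtain ⟨p, hpz, hp0⟩ := h.exists_stab hz
  have hp : p ∈ H := h.stab_le z hz hpz
  let ω : P → L →ₗ[ℂ] L →ₗ[ℂ] ℂ := fun p => B.compl₁₂ (M p) (M p₁)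
  have hω : ∀ p x y, ω p x y = B (M p x) (M p₁ y) := fun p x y => rfl
  have hker : ∀ p ∈ H, ∀ x, (∀ y, ω p x y = 0) → M p x = 0 := fun p hp x hx =>
    h.eq_zero_of_mem (h.mem p hp x) hx
  obtain ⟨u, hzu, hu⟩ := exists_indep_of_skew h.dimL (ω := ω p) (h.omega_skew p) hz
    (by ext y; simp [hω, hpz])
  obtain ⟨a, b, hab⟩ := h.exists_pairForm_ne hzu (h.dist _ _ hzu)
  obtain ⟨p', hp', hne⟩ : ∃ p' ∈ H, ω p' z u ≠ 0 := by
    by_contra! hcon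
    apply hab
    obtain ⟨s, hs⟩ := h.hyper a
    obtain ⟨t, ht⟩ := h.hyper b
    have e1 := h.iso (h.mem _ hs z) (h.mem _ ht u)
    have e2 := hcon _ hs
    have e3 := hcon _ ht
    rw [hω] at e2 e3
    have e4 := h.skew p₁ (b - t • p₁) z u
    have e5 := h.self p₁ z u
    rw [pairForm_apply]
    have ea : M a = M (a - s • p₁) + s • M p₁ := by rw [← map_smul, ← map_add, sub_add_cancel]
    have eb : M b = M (b - t • p₁) + t • M p₁ := by rw [← map_smul, ← map_add, sub_add_cancel]
    rw [ea, eb]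
    simp only [LinearMap.add_apply, LinearMap.smul_apply, map_add, map_smul, smul_eq_mul, e1, e2, e4, e3, e5]
    simp
  obtain ⟨s, hs⟩ := exists_nondeg_of_skew h.dimL (h.omega_skew p) (h.omega_skew p')
    (ω := ω p) (ω' := ω p') (by
      intro h0
      apply hp0
      ext x
      exact hker p hp x fun y => by rw [h0]; rfl)
    (by ext y; simp [hω, hpz]) hu hne
  refine ⟨p' + s • p, H.add_mem hp' (H.smul_mem s hp), ?_⟩
  rw [← LinearMap.ker_eq_bot, LinearMap.ker_eq_bot']
  intro x hx
  refine hs x fun y => ?_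
  have : (ω p' + s • ω p) x y = B (M (p' + s • p) x) (M p₁ y) := by simp [hω]
  rw [this, hx]; simp

theorem N_zero {p : P} (hp : p ∈ H) {x y : F} (hx : x ∈ G) (hy : y ∈ G) : N p x y = 0 := by
  have hfull : ∀ p ∈ H, 4 ≤ Module.finrank ℂ (LinearMap.range (M p)) → ∀ g ∈ G, N p g g = 0 := by
    intro p hp hr g hg
    have : LinearMap.range (M p) = G := Submodule.eq_of_le_of_finrank_le (by
      rintro _ ⟨x, rfl⟩; exact h.mem p hp x) (by rw [h.finG]; exact hr)
    rw [← this] at hg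
    obtain ⟨x, rfl⟩ := hg
    exact h.cubic p x
  obtain ⟨p', hp', hinj⟩ := h.exists_bijective
  have hr' : 4 ≤ Module.finrank ℂ (LinearMap.range (M p')) := by
    rw [LinearMap.finrank_range_of_inj hinj, h.dimL]
  have hdiag : ∀ g ∈ G, N p g g = 0 := by
    intro g hg
    obtain ⟨f, hf, hf0, hfr⟩ := exists_polyFun_rank M p' hr'
    obtain ⟨t, ht, hft⟩ := hf.exists_ne_line hf0 p {0}
    have e1 := hfull _ (H.add_mem hp' (H.smul_mem t hp)) (hfr _ hft) g hg
    simp only [map_add, map_smul, LinearMap.add_apply, LinearMap.smul_apply, hfull p' hp' hr' g hg,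
      zero_add, smul_eq_mul, mul_eq_zero] at e1
    exact e1.resolve_left (by simpa using ht)
  have e := hdiag _ (G.add_mem hx hy)
  simp only [map_add, LinearMap.add_apply, hdiag x hx, hdiag y hy, h.Nsymm p y x] at e
  linear_combination (1/2) * e

end TypeOne

namespace TypeOne

variable {P L F : Type*} [AddCommGroup P] [Module ℂ P] [FiniteDimensional ℂ P]
  [AddCommGroup L] [Module ℂ L] [FiniteDimensional ℂ L]
  [AddCommGroup F] [Module ℂ F] [FiniteDimensional ℂ F]
  {M : P →ₗ[ℂ] L →ₗ[ℂ] F} {B : F →ₗ[ℂ] F →ₗ[ℂ] ℂ}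
  {N : P →ₗ[ℂ] F →ₗ[ℂ] F →ₗ[ℂ] ℂ} {q : P} {H : Submodule ℂ P} {p₁ : P} {G : Submodule ℂ F}

/-- The form induced by the transversal member of the family on the common zero space of the
hyperplane. -/
def residual (M : P →ₗ[ℂ] L →ₗ[ℂ] F) (B : F →ₗ[ℂ] F →ₗ[ℂ] ℂ) (N : P →ₗ[ℂ] F →ₗ[ℂ] F →ₗ[ℂ] ℂ)
    (p₁ : P) (G : Submodule ℂ F) : (L × G) →ₗ[ℂ] (L × G) →ₗ[ℂ] ℂ :=
  B.compl₁₂ (M p₁ ∘ₗ LinearMap.fst ℂ L G) (G.subtype ∘ₗ LinearMap.snd ℂ L G) +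
    B.compl₁₂ (G.subtype ∘ₗ LinearMap.snd ℂ L G) (M p₁ ∘ₗ LinearMap.fst ℂ L G) +
    (N p₁).compl₁₂ (G.subtype ∘ₗ LinearMap.snd ℂ L G) (G.subtype ∘ₗ LinearMap.snd ℂ L G)

theorem residual_apply (x y : L × G) : residual M B N p₁ G x y =
    B (M p₁ x.1) y.2 + B x.2 (M p₁ y.1) + N p₁ x.2 y.2 := rfl

/-- Members of the hyperplane and vectors, viewed as functionals on the common zero space. -/
def coupling (M : P →ₗ[ℂ] L →ₗ[ℂ] F) (B : F →ₗ[ℂ] F →ₗ[ℂ] ℂ) (N : P →ₗ[ℂ] F →ₗ[ℂ] F →ₗ[ℂ] ℂ)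
    (p₁ : P) (H : Submodule ℂ P) (G : Submodule ℂ F) : H →ₗ[ℂ] L →ₗ[ℂ] Module.Dual ℂ (L × G) :=
  LinearMap.mk₂ ℂ (fun p z => B.flip (M p₁ z) ∘ₗ M p ∘ₗ LinearMap.fst ℂ L G +
      N p (M p₁ z) ∘ₗ G.subtype ∘ₗ LinearMap.snd ℂ L G)
    (fun p p' z => by ext <;> simp) (fun c p z => by ext <;> simp)
    (fun p z z' => by ext <;> simp) (fun c p z => by ext <;> simp)

theorem coupling_apply (p : H) (z : L) (y : L × G) : coupling M B N p₁ H G p z y =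
    B (M p y.1) (M p₁ z) + N p (M p₁ z) y.2 := rfl

variable (h : TypeOne M B N q H p₁ G)
include h

theorem residual_symm (x y : L × G) : residual M B N p₁ G x y = residual M B N p₁ G y x := by
  rw [residual_apply, residual_apply, h.symm (M p₁ x.1), h.symm x.2, h.Nsymm]; ring

theorem residual_nondeg (x : L × G) (hx : ∀ y, residual M B N p₁ G x y = 0) : x = 0 := by
  obtain ⟨l, g, hg⟩ := x
  have e1 : g = 0 := h.eq_zero_of_mem hg fun y => by
    have := hx (y, 0)
    simpa [residual_apply] using this
  subst e1
  have e2 : M p₁ l ∈ perp B G := fun g' hg' => by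
    have := hx (0, ⟨g', hg'⟩)
    simpa [residual_apply] using this
  rw [h.perpG] at e2
  rw [h.inj l e2]
  rfl

theorem exists_of_orth {z : L} (hz : z ≠ 0) {g : F} (hg : g ∈ G) (h0 : B g (M p₁ z) = 0) :
    ∃ p ∈ H, M p z = g := by
  have hmap : Module.finrank ℂ (H.map (M.flip z)) = 3 := by
    have e := LinearMap.finrank_range_add_finrank_ker ((M.flip z).domRestrict H)
    rw [LinearMap.range_domRestrict, LinearMap.ker_domRestrict] at e
    have e2 : Module.finrank ℂ ((LinearMap.ker (M.flip z)).submoduleOf H) =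
        Module.finrank ℂ (stab M z) :=
      (Submodule.submoduleOfEquivOfLe (h.stab_le z hz)).finrank_eq
    have e3 := h.finrank_stab_add hz
    have e4 := h.finH
    change _ + Module.finrank ℂ ((LinearMap.ker (M.flip z)).submoduleOf H) = _ at e
    omega
  have hle : H.map (M.flip z) ≤ G ⊓ LinearMap.ker (B.flip (M p₁ z)) := by
    rintro _ ⟨p, hp, rfl⟩
    refine ⟨h.mem p hp z, ?_⟩
    have e := h.omega_skew p z z
    show B (M p z) (M p₁ z) = 0
    linear_combination (1/2) * e
  have hlt : G ⊓ LinearMap.ker (B.flip (M p₁ z)) < G := by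
    refine lt_of_le_of_ne inf_le_left fun heq => hz (h.inj z ?_)
    rw [← h.perpG]
    intro g hg
    rw [← heq] at hg
    rw [h.symm]
    exact hg.2
  have h1 := Submodule.finrank_lt_finrank_of_lt hlt
  rw [h.finG] at h1
  have heq := Submodule.eq_of_le_of_finrank_le hle (by omega)
  have hmem : g ∈ H.map (M.flip z) := heq ▸ ⟨hg, h0⟩
  obtain ⟨p, hp, rfl⟩ := hmem
  exact ⟨p, hp, rfl⟩

theorem q_mem : q ∈ H := by
  have hLpos : 0 < Module.finrank ℂ L := by rw [h.dimL]; norm_num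
  have : Nontrivial L := Module.finrank_pos_iff.1 hLpos
  obtain ⟨z, hz⟩ := exists_ne (0 : L)
  exact h.stab_le z hz (by rw [mem_stab, h.Mq]; rfl)

theorem residual_self {z : L} (hz : z ≠ 0) {y : L × G}
    (hy : ∀ p, coupling M B N p₁ H G p z y = 0) : residual M B N p₁ G y y = 0 := by
  obtain ⟨l, g, hg⟩ := y
  have e1 := hy ⟨q, h.q_mem⟩
  rw [coupling_apply] at e1
  simp only [h.Mq, h.Nq, LinearMap.zero_apply, map_zero, zero_add] at e1
  obtain ⟨p, hp, rfl⟩ := h.exists_of_orth hz hg (by rw [h.symm]; exact e1)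
  have e2 := hy ⟨p, hp⟩
  rw [coupling_apply] at e2
  have c0 := h.cubic p₁ z
  have c1 := h.cubic (p₁ + p) z
  have c2 := h.cubic (p₁ - p) z
  have e3 := h.omega_skew p l z
  have e4 := h.symm (M p₁ l) (M p z)
  simp only [map_add, map_sub, LinearMap.add_apply, LinearMap.sub_apply, c0,
    h.Nsymm _ (M p z) (M p₁ z)] at c1 c2
  rw [residual_apply]
  dsimp only at e2 ⊢
  linear_combination (1/2) * (c1 + c2) - 2 * e2 + 2 * e3 + e4

theorem finrank_prod : Module.finrank ℂ (L × G) = 8 := by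
  rw [Module.finrank_prod, h.dimL, h.finG]

theorem exists_flatFour : ∃ m : H →ₗ[ℂ] L →ₗ[ℂ] (L × G),
    FlatFour m (residual M B N p₁ G) ∧
      ∀ p z y, residual M B N p₁ G (m p z) y = coupling M B N p₁ H G p z y := by
  set β := residual M B N p₁ G with hβ
  have hinj : Function.Injective β := by
    rw [← LinearMap.ker_eq_bot, LinearMap.ker_eq_bot']
    exact fun x hx => h.residual_nondeg x fun y => by rw [← hβ, hx]; rfl
  let e : (L × G) ≃ₗ[ℂ] Module.Dual ℂ (L × G) :=
    LinearMap.linearEquivOfInjective β hinj (Subspace.dual_finrank_eq).symm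
  let m : H →ₗ[ℂ] L →ₗ[ℂ] (L × G) := (coupling M B N p₁ H G).compr₂ e.symm.toLinearMap
  have hm : ∀ p z y, β (m p z) y = coupling M B N p₁ H G p z y := by
    intro p z y
    have : e (m p z) = coupling M B N p₁ H G p z := e.apply_symm_apply _
    exact LinearMap.congr_fun this y
  refine ⟨m, ?_, hm⟩
  have hs : ∀ x y, β x y = β y x := h.residual_symm
  have hn : ∀ x, (∀ y, β x y = 0) → x = 0 := h.residual_nondeg
  have hperp : ∀ z, z ≠ 0 → ∀ x ∈ perp β (orb m z), β x x = 0 := by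
    intro z hz x hx
    refine h.residual_self hz fun p => ?_
    rw [← hm, hs]
    exact hx _ (orb_mem p z)
  have hiso : ∀ z, z ≠ 0 → ∀ x ∈ perp β (orb m z), ∀ y ∈ perp β (orb m z), β x y = 0 := by
    intro z hz x hx y hy
    have e1 := hperp z hz _ (Submodule.add_mem _ hx hy)
    simp only [map_add, LinearMap.add_apply, hperp z hz x hx, hperp z hz y hy, hs y x] at e1
    linear_combination (1/2) * e1
  have hupper : ∀ z, z ≠ 0 → Module.finrank ℂ (orb m z) ≤ 4 := by
    intro z hz
    obtain ⟨g₀, hg₀, hne⟩ : ∃ g₀ ∈ G, B g₀ (M p₁ z) ≠ 0 := by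
      by_contra! hcon
      refine hz (h.inj z ?_)
      rw [← h.perpG]
      intro g hg
      rw [h.symm]
      exact hcon g hg
    let K : Submodule ℂ P := stab M z ⊓ LinearMap.ker ((N.flip (M p₁ z)).flip g₀)
    have hK : Module.finrank ℂ (stab M z) ≤ Module.finrank ℂ K + 1 := by
      have e1 := Submodule.finrank_sup_add_finrank_inf_eq (stab M z)
        (LinearMap.ker ((N.flip (M p₁ z)).flip g₀))
      have e2 := LinearMap.finrank_range_add_finrank_ker ((N.flip (M p₁ z)).flip g₀)
      have e3 := Submodule.finrank_le (LinearMap.range ((N.flip (M p₁ z)).flip g₀))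
      have e4 := Submodule.finrank_le (stab M z ⊔ LinearMap.ker ((N.flip (M p₁ z)).flip g₀))
      rw [Module.finrank_self] at e3
      change _ + Module.finrank ℂ K = _ at e1
      omega
    have hKH : K ≤ H := inf_le_left.trans (h.stab_le z hz)
    have hKm : K.submoduleOf H ≤ stab m z := by
      rintro p ⟨hp1, hp2⟩
      change M p z = 0 at hp1
      change N p (M p₁ z) g₀ = 0 at hp2
      refine hn _ fun y => ?_
      show β (m p z) y = 0
      rw [hm, coupling_apply, h.omega_skew, hp1]
      obtain ⟨l, g, hg⟩ := y
      obtain ⟨r, hr, hrg⟩ := h.exists_of_orth hz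
        (G.sub_mem hg (G.smul_mem (B g (M p₁ z) / B g₀ (M p₁ z)) hg₀)) (by simp [hne])
      have e1 := h.N_of_stab hp1 (orb_mem p₁ z) (orb_mem r z)
      rw [hrg, map_sub, map_smul, hp2] at e1
      simpa using e1
    have e1 := Submodule.finrank_mono hKm
    rw [(Submodule.submoduleOfEquivOfLe hKH).finrank_eq] at e1
    have e2 := finrank_orb_add (M := m) z
    have e3 := h.finrank_stab_add hz
    have e4 := h.finH
    omega
  have hall : ∀ z, z ≠ 0 → Module.finrank ℂ (orb m z) = 4 ∧ perp β (orb m z) = orb m z := by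
    intro z hz
    have e1 := two_mul_finrank_le hs hn (hiso z hz)
    have e2 := finrank_perp hs hn (orb m z)
    have e3 := hupper z hz
    rw [h.finrank_prod] at e1 e2
    refine ⟨by omega, ?_⟩
    have e4 := perp_eq_self hs hn (hiso z hz) (by rw [h.finrank_prod]; omega)
    rw [← e4, perp_perp hs hn]
  refine { symm := hs, nondeg := hn, flat := ?_, dimL := h.dimL, dimF := h.finrank_prod, lagr := ?_ }
  · intro p l
    by_cases hl : l = 0
    · simp [hl]
    · refine hperp l hl _ ?_
      rw [(hall l hl).2]
      exact orb_mem p l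
  · intro z hz
    rw [IsLagr, (hall z hz).1, h.finrank_prod]

theorem exists_small_rank : ∃ (l : L) (g : F), (l ≠ 0 ∨ g ≠ 0) ∧
    (∀ p, 2 * B (M p l) g + N p g g = 0) ∧
    ∃ K : Submodule ℂ P, Module.finrank ℂ P ≤ Module.finrank ℂ K + 3 ∧
      ∀ p ∈ K, ∀ l' x', B (M p l) x' + B (M p l') g + N p g x' = 0 := by
  obtain ⟨m, hf, hm⟩ := h.exists_flatFour
  have hLpos : 0 < Module.finrank ℂ L := by rw [h.dimL]; norm_num
  have : Nontrivial L := Module.finrank_pos_iff.1 hLpos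
  obtain ⟨z, hz⟩ := exists_ne (0 : L)
  obtain ⟨u, hzu, hne⟩ := hf.exists_meet hz
  obtain ⟨y, ⟨hyz, hyu⟩, hy0⟩ := Submodule.exists_mem_ne_zero_of_ne_bot hne
  have hc : ∀ w, w ≠ 0 → y ∈ orb m w → ∀ p, coupling M B N p₁ H G p w y = 0 := by
    intro w hw hyw p
    rw [← hm, hf.symm]
    exact (hf.mem_orb_iff (hf.lagr w hw)).1 hyw p
  have hyy := h.residual_self hz (hc z hz hyz)
  have hcz := hc z hz hyz
  have hcu := hc u hzu.right_ne hyu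
  obtain ⟨l, g, hg⟩ := y
  refine ⟨l, g, ?_, fun p => ?_, ?_⟩
  · by_contra! hcon
    obtain ⟨rfl, rfl⟩ := hcon
    exact hy0 rfl
  · obtain ⟨s, hs⟩ := h.hyper p
    have e1 := h.iso (h.mem _ hs l) hg
    have e2 := h.N_zero hs hg hg
    rw [residual_apply, h.symm g] at hyy
    simp only [map_sub, map_smul, LinearMap.sub_apply, LinearMap.smul_apply, smul_eq_mul] at e1 e2
    linear_combination 2 * e1 + e2 + s * hyy
  · obtain ⟨C, hC⟩ := Submodule.exists_isCompl (ℂ ∙ z ⊔ ℂ ∙ u)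
    have hCd := Submodule.finrank_add_eq_of_isCompl hC
    have h2 : Module.finrank ℂ (ℂ ∙ z ⊔ ℂ ∙ u : Submodule ℂ L) = 2 := by
      have e1 := Submodule.finrank_sup_add_finrank_inf_eq (ℂ ∙ z) (ℂ ∙ u)
      have e2 : ℂ ∙ z ⊓ ℂ ∙ u = ⊥ := by
        rw [eq_bot_iff]
        rintro _ ⟨h1, h2⟩
        obtain ⟨s, rfl⟩ := Submodule.mem_span_singleton.1 h1
        obtain ⟨t, ht⟩ := Submodule.mem_span_singleton.1 h2
        rw [(hzu s (-t) (by rw [neg_smul, ht, add_neg_cancel])).1, zero_smul]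
        exact Submodule.zero_mem _
      rw [e2, finrank_bot, finrank_span_singleton hz, finrank_span_singleton hzu.right_ne] at e1
      omega
    rw [h2, h.dimL] at hCd
    let T : H →ₗ[ℂ] Module.Dual ℂ C := LinearMap.mk₂ ℂ
      (fun (p : H) (c : C) => B (M p l) (M p₁ c) + N p g (M p₁ c))
      (fun p p' c => by simp; ring) (fun s p c => by simp; ring)
      (fun p c c' => by simp; ring) (fun s p c => by simp; ring)
    refine ⟨(LinearMap.ker T).map H.subtype, ?_, ?_⟩
    · rw [Submodule.finrank_map_subtype_eq]
      have e1 := LinearMap.finrank_range_add_finrank_ker T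
      have e2 := Submodule.finrank_le (LinearMap.range T)
      rw [Subspace.dual_finrank_eq] at e2
      have e3 := h.finH
      omega
    · rintro _ ⟨p, hp, rfl⟩ l' x'
      show B (M p l) x' + B (M p l') g + N p g x' = 0
      rw [h.iso (h.mem p p.2 l') hg]
      obtain ⟨g', hg', w, rfl⟩ := h.exists_decomp x'
      obtain ⟨a, ha, c, hcC, rfl⟩ := Submodule.mem_sup.1
        (hC.sup_eq_top ▸ Submodule.mem_top : w ∈ _)
      obtain ⟨b, hb, d, hd, rfl⟩ := Submodule.mem_sup.1 ha
      obtain ⟨s, rfl⟩ := Submodule.mem_span_singleton.1 hb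
      obtain ⟨t, rfl⟩ := Submodule.mem_span_singleton.1 hd
      have e1 := hcz p
      have e2 := hcu p
      have e3 : B (M p l) (M p₁ c) + N p g (M p₁ c) = 0 := LinearMap.congr_fun hp ⟨c, hcC⟩
      have e4 := h.N_zero p.2 hg hg'
      have e5 := h.iso (h.mem p p.2 l) hg'
      rw [coupling_apply, h.Nsymm] at e1 e2
      simp only [map_add, map_smul, smul_eq_mul] 
      dsimp only at e1 e2
      linear_combination s * e1 + t * e2 + e3 + e4 + e5

end TypeOne

/-- The three possibilities for a flat four-dimensional family with a cubic identity. -/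
theorem Quartic.trichotomy {P L F : Type*} [AddCommGroup P] [Module ℂ P] [FiniteDimensional ℂ P]
    [AddCommGroup L] [Module ℂ L] [FiniteDimensional ℂ L]
    [AddCommGroup F] [Module ℂ F] [FiniteDimensional ℂ F]
    {M : P →ₗ[ℂ] L →ₗ[ℂ] F} {B : F →ₗ[ℂ] F →ₗ[ℂ] ℂ}
    {N : P →ₗ[ℂ] F →ₗ[ℂ] F →ₗ[ℂ] ℂ} {q : P} (h : Quartic M B N q) :
    (∃ z, z ≠ 0 ∧ ∀ p, (∀ l, M p l ∈ orb M z) ∧ ∀ x ∈ orb M z, ∀ y ∈ orb M z, N p x y = 0) ∨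
    (∃ p t, ∃ c : F, ∃ l : L →ₗ[ℂ] ℂ, c ≠ 0 ∧ l ≠ 0 ∧ (∀ x, M p x = l x • c) ∧
      ∀ x y, B c x = 0 → B c y = 0 → N p x y = t * B x y) ∨
    (∃ (l : L) (g : F), (l ≠ 0 ∨ g ≠ 0) ∧ (∀ p, 2 * B (M p l) g + N p g g = 0) ∧
      ∃ K : Submodule ℂ P, Module.finrank ℂ P ≤ Module.finrank ℂ K + 3 ∧
        ∀ p ∈ K, ∀ l' x', B (M p l) x' + B (M p l') g + N p g x' = 0) := by
  by_cases hdist : ∀ z u, Indep z u → orb M u ≠ orb M z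
  · right
    by_cases hII : ∃ c, c ≠ 0 ∧ ∀ u, u ≠ 0 → c ∈ orb M u
    · obtain ⟨c, hc, hcU⟩ := hII
      obtain ⟨p, t, l, hl, h1, h2⟩ := h.exists_rank_one hdist hc hcU
      exact Or.inl ⟨p, t, c, l, hc, hl, h1, h2⟩
    · obtain ⟨H, p₁, G, hT⟩ := h.exists_typeOne hdist hII
      exact Or.inr hT.exists_small_rank
  · push Not at hdist
    obtain ⟨z, u, hzu, heq⟩ := hdist
    exact Or.inl ⟨z, hzu.left_ne, h.const_of_eq hzu heq⟩

section Cone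

variable {A V : Type*} [AddCommGroup A] [Module ℂ A] [FiniteDimensional ℂ A]
  [AddCommGroup V] [Module ℂ V] [FiniteDimensional ℂ V]

/-- The common zeros of a linear system of quadratic forms. -/
def OnCone (S : A →ₗ[ℂ] V →ₗ[ℂ] V →ₗ[ℂ] ℂ) (v : V) : Prop := ∀ p, S p v v = 0

/-- The affine cone over a smooth irreducible nondegenerate variety of codimension four in
projective eleven-space, cut out by at least five quadrics. -/
structure QuadricCone (S : A →ₗ[ℂ] V →ₗ[ℂ] V →ₗ[ℂ] ℂ) : Prop where
  symm : ∀ p v w, S p v w = S p w v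
  dimV : Module.finrank ℂ V = 12
  dimA : 5 ≤ Module.finrank ℂ A
  inj : ∀ p, S p = 0 → p = 0
  rank : ∀ z, z ≠ 0 → OnCone S z → Module.finrank ℂ (orb S z) = 4
  irr : ∀ f g : V → ℂ, PolyFun f → PolyFun g → (∀ v, OnCone S v → f v * g v = 0) →
    (∀ v, OnCone S v → f v = 0) ∨ ∀ v, OnCone S v → g v = 0
  nondeg : ∀ φ : V →ₗ[ℂ] ℂ, (∀ v, OnCone S v → φ v = 0) → φ = 0
  tangent : ∀ f : V → ℂ, PolyFun f → (∀ v, OnCone S v → f v = 0) → ∀ z, z ≠ 0 → OnCone S z →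
    ∀ v, (∀ p, S p z v = 0) → ∀ k : Polynomial ℂ, (∀ t, f (z + t • v) = k.eval t) →
      k.derivative.eval 0 = 0

namespace QuadricCone

variable {S : A →ₗ[ℂ] V →ₗ[ℂ] V →ₗ[ℂ] ℂ} (h : QuadricCone S)
include h

/-- No quadrics of the system can vanish on the linear space cut out by their tangent
hyperplanes at a point of the cone. -/
theorem false_of_vanish {r : ℕ} (hr : 0 < r) {z : V} (hz : OnCone S z) (p : Fin r → A)
    (hli : LinearIndependent ℂ fun j => S (p j) z)
    (hv : ∀ v, (∀ i, S (p i) z v = 0) → ∀ j, S (p j) v v = 0) : False := by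
  obtain ⟨φ, hφ⟩ := exists_dual_of_linearIndependent hli
  choose y hy using fun i => (Module.evalEquiv ℂ V).surjective (φ i)
  have hy' : ∀ i j, S (p j) z (y i) = if i = j then 1 else 0 := by
    intro i j
    rw [← hφ i j, ← hy i]
    rfl
  let π : V →ₗ[ℂ] V := LinearMap.id - ∑ i, (S (p i) z).smulRight (y i)
  have hπ : ∀ v, π v = v - ∑ i, S (p i) z v • y i := fun v => by simp [π]
  have hπ0 : ∀ v i, S (p i) z (π v) = 0 := by
    intro v i
    rw [hπ]
    simp [hy', map_sum]
  let l : V → Matrix (Fin r) (Fin r) ℂ := fun v => Matrix.of fun j i => S (p j) (y i) (π v + v)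
  have hl : ∀ v, OnCone S v → ∀ j, ∑ i, l v j i * S (p i) z v = 0 := by
    intro v hvc j
    have e1 := hv (π v) (hπ0 v) j
    have e2 : S (p j) (v - π v) (π v + v) = 0 := by
      simp only [map_sub, map_add, LinearMap.sub_apply, e1, hvc (p j), h.symm (p j) v (π v)]
      ring
    have e3 : v - π v = ∑ i, S (p i) z v • y i := by rw [hπ]; abel
    rw [e3] at e2
    simp only [map_sum, map_smul, LinearMap.sum_apply, LinearMap.smul_apply, smul_eq_mul] at e2
    rw [← e2]
    exact Finset.sum_congr rfl fun i _ => mul_comm _ _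
  have hdet : ∀ v, OnCone S v → ∀ i, (l v).det * S (p i) z v = 0 := by
    intro v hvc i
    have e1 : (l v).mulVec (fun i => S (p i) z v) = 0 := funext fun j => hl v hvc j
    have e2 := congrArg (fun w => (l v).adjugate.mulVec w i) e1
    simpa [Matrix.mulVec_mulVec, Matrix.adjugate_mul, Matrix.smul_mulVec] using e2
  have hpf : PolyFun fun v => (l v).det := PolyFun.det fun j i => by
    exact (PolyFun.linear (S (p j) (y i) ∘ₗ (π + LinearMap.id)))
  have hz0 : π z = z := by
    rw [hπ]
    simp [hz (p _)]
  have hlz : (l z).det ≠ 0 := by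
    have : l z = (2 : ℂ) • (1 : Matrix (Fin r) (Fin r) ℂ) := by
      ext j i
      simp only [l, Matrix.of_apply, hz0, Matrix.smul_apply, Matrix.one_apply, smul_eq_mul,
        map_add, h.symm (p j) (y i) z, hy', eq_comm (a := i)]
      split_ifs <;> norm_num
    rw [this, Matrix.det_smul, Matrix.det_one, mul_one]
    exact pow_ne_zero _ two_ne_zero
  let i0 : Fin r := ⟨0, hr⟩
  rcases h.irr _ _ hpf (PolyFun.linear (S (p i0) z)) (fun v hvc => hdet v hvc i0) with h1 | h1
  · exact hlz (h1 z hz)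
  · exact hli.ne_zero i0 (h.nondeg _ h1)

theorem add_onCone {z u : V} (hz : OnCone S z) (hu : OnCone S u) (hzu : ∀ p, S p z u = 0)
    (s t : ℂ) : OnCone S (s • z + t • u) := by
  intro p
  simp [hz p, hu p, hzu p, h.symm p u z]

theorem finrank_stab_add {z : V} (hz0 : z ≠ 0) (hz : OnCone S z) :
    Module.finrank ℂ (stab S z) + 4 = Module.finrank ℂ A := by
  rw [← finrank_orb_add (M := S) z, h.rank z hz0 hz, add_comm]

end QuadricCone

/-- The properties of a quadric of maximal rank among those singular at a point of the cone, and
of the tangent space at it to the variety of such quadrics. -/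
structure Extremal (S : A →ₗ[ℂ] V →ₗ[ℂ] V →ₗ[ℂ] ℂ) (q : A) (T : Submodule ℂ A) : Prop
    extends QuadricCone S where
  ne : q ≠ 0
  sing : ∃ z, z ≠ 0 ∧ OnCone S z ∧ S q z = 0
  first : ∀ p ∈ T, ∀ x y, S q x = 0 → S q y = 0 → S p x y = 0
  second : ∀ p ∈ T, ∃ g, ∀ x v, S q x = 0 → S q v = S p x → S g x x = S q v v
  kernel : ∀ z, z ≠ 0 → OnCone S z → S q z = 0 → stab S z ≤ T
  lift : ∀ z, z ≠ 0 → OnCone S z → S q z = 0 → ∀ v, (∀ p, S p z v = 0) →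
    ∃ p ∈ T, S p z = S q v
  line : ∀ z, z ≠ 0 → OnCone S z → S q z = 0 → ∀ p, S p z = 0 → ∀ x v, S q x = 0 →
    S q v = S p x → S q v v = 0 ∧ S p v v = 0
  full : T = ⊤ → ∀ p x v, S q x = 0 → S q v = S p x → S q v v = 0 ∧ S p v v = 0

end Cone

section Framing

variable {A V : Type*} [AddCommGroup A] [Module ℂ A] [FiniteDimensional ℂ A]
  [AddCommGroup V] [Module ℂ V] [FiniteDimensional ℂ V]

/-- A functional vanishing on the common zeros of a subspace of functionals belongs to it. -/
theorem mem_of_forall_eq_zero (W : Submodule ℂ (V →ₗ[ℂ] ℂ)) {φ : V →ₗ[ℂ] ℂ}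
    (hφ : ∀ v, (∀ ψ ∈ W, ψ v = 0) → φ v = 0) : φ ∈ W := by
  have h := Subspace.dualCoannihilator_dualAnnihilator_eq (W := (W : Subspace ℂ (Module.Dual ℂ V)))
  rw [← h, Submodule.mem_dualAnnihilator]
  intro v hv
  exact hφ v fun ψ hψ => (Submodule.mem_dualCoannihilator (Φ := W) v).1 hv ψ hψ

theorem finrank_map_of_inj {E E' : Type*} [AddCommGroup E] [Module ℂ E]
    [AddCommGroup E'] [Module ℂ E'] {f : E →ₗ[ℂ] E'} (hf : Function.Injective f)
    (W : Submodule ℂ E) : Module.finrank ℂ (W.map f) = Module.finrank ℂ W :=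
  (LinearEquiv.finrank_eq (Submodule.equivMapOfInjective f hf W)).symm

/-- A decomposition of the ambient space into the kernel of an extremal quadric and a complement,
with the linear family of maps induced by the quadrics of its tangent space. -/
structure Frame (S : A →ₗ[ℂ] V →ₗ[ℂ] V →ₗ[ℂ] ℂ) (q : A) (T : Submodule ℂ A)
    (Λ F : Submodule ℂ V) (M : T →ₗ[ℂ] Λ →ₗ[ℂ] F) (B : F →ₗ[ℂ] F →ₗ[ℂ] ℂ) : Prop
    extends Extremal S q T where
  mem_ker : ∀ x, x ∈ Λ ↔ S q x = 0
  compl : IsCompl Λ F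
  form : ∀ x y : F, B x y = S q x y
  map : ∀ (p : T) (l : Λ), S q (M p l : V) = S (p : A) (l : V)

theorem Extremal.exists_frame {S : A →ₗ[ℂ] V →ₗ[ℂ] V →ₗ[ℂ] ℂ} {q : A} {T : Submodule ℂ A}
    (h : Extremal S q T) : ∃ Λ F M B, Frame S q T Λ F M B := by
  let Λ : Submodule ℂ V := LinearMap.ker (S q)
  obtain ⟨F, hF⟩ := Submodule.exists_isCompl Λ
  have hmem : ∀ φ : V →ₗ[ℂ] ℂ, (∀ x, S q x = 0 → φ x = 0) → φ ∈ LinearMap.range (S q) := by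
    intro φ hφ
    refine mem_of_forall_eq_zero _ fun v hv => hφ v ?_
    ext w
    rw [h.symm q v w]
    exact hv _ ⟨w, rfl⟩
  have hinj : ∀ x : F, S q x = 0 → x = 0 := fun x hx =>
    Subtype.ext (hF.disjoint.le_bot ⟨(hx : (x : V) ∈ Λ), x.2⟩)
  have hex : ∀ (p : T) (l : Λ), ∃ x : F, S q x = S (p : A) (l : V) := by
    intro p l
    obtain ⟨v, hv⟩ := hmem (S (p : A) (l : V)) fun x hx => h.first p p.2 l x l.2 hx
    obtain ⟨y, hy, w, hw, rfl⟩ := Submodule.mem_sup.1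
      (hF.sup_eq_top ▸ Submodule.mem_top : v ∈ Λ ⊔ F)
    refine ⟨⟨w, hw⟩, ?_⟩
    rw [map_add, (hy : S q y = 0), zero_add] at hv
    exact hv
  choose m hm using hex
  have huniq : ∀ x y : F, S q (x : V) = S q (y : V) → x = y := fun x y hxy =>
    sub_eq_zero.1 (hinj _ (by simp [hxy]))
  refine ⟨Λ, F, LinearMap.mk₂ ℂ m ?_ ?_ ?_ ?_, (S q).compl₁₂ F.subtype F.subtype, ?_⟩
  · intro p p' l
    exact huniq _ _ (by simp [hm])
  · intro c p l
    exact huniq _ _ (by simp [hm])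
  · intro p l l'
    exact huniq _ _ (by simp [hm])
  · intro c p l
    exact huniq _ _ (by simp [hm])
  · exact { h with
      mem_ker := fun x => Iff.rfl
      compl := hF
      form := fun x y => rfl
      map := fun p l => hm p l }

namespace Frame

variable {S : A →ₗ[ℂ] V →ₗ[ℂ] V →ₗ[ℂ] ℂ} {q : A} {T : Submodule ℂ A} {Λ F : Submodule ℂ V}
  {M : T →ₗ[ℂ] Λ →ₗ[ℂ] F} {B : F →ₗ[ℂ] F →ₗ[ℂ] ℂ} (h : Frame S q T Λ F M B)
include h

theorem q_mem : q ∈ T := by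
  obtain ⟨z, hz0, hz, hqz⟩ := h.sing
  exact h.kernel z hz0 hz hqz hqz

theorem eq_zero_of_ker (l : Λ) : S q l = 0 := (h.mem_ker l).1 l.2

theorem eq_zero_of_ker' (v : V) (l : Λ) : S q v l = 0 := by
  rw [h.symm, h.eq_zero_of_ker]; rfl

theorem inj_form {x : F} (hx : S q (x : V) = 0) : x = 0 :=
  Subtype.ext (h.compl.disjoint.le_bot ⟨(h.mem_ker x).2 hx, x.2⟩)

theorem exists_add (v : V) : ∃ (l : Λ) (x : F), v = l + x := by
  obtain ⟨y, hy, w, hw, rfl⟩ := Submodule.mem_sup.1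
    (h.compl.sup_eq_top ▸ Submodule.mem_top : v ∈ Λ ⊔ F)
  exact ⟨⟨y, hy⟩, ⟨w, hw⟩, rfl⟩

theorem form_symm (x y : F) : B x y = B y x := by rw [h.form, h.form, h.symm]

theorem form_nondeg (x : F) (hx : ∀ y, B x y = 0) : x = 0 := by
  refine h.inj_form ?_
  ext v
  obtain ⟨l, y, rfl⟩ := h.exists_add v
  rw [map_add, h.eq_zero_of_ker', ← h.form, hx]
  simp

theorem finrank_add : Module.finrank ℂ Λ + Module.finrank ℂ F = 12 := by
  rw [Submodule.finrank_add_eq_of_isCompl h.compl, h.dimV]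

theorem ker_ker {p : A} (hp : p ∈ T) (l l' : Λ) : S p l l' = 0 :=
  h.first p hp l l' (h.eq_zero_of_ker l) (h.eq_zero_of_ker l')

/-- The value of a quadric of the tangent space in terms of the frame. -/
theorem expand (p : T) (l l' : Λ) (x x' : F) : S (p : A) (l + x : V) (l' + x' : V) =
    B (M p l) x' + B (M p l') x + S (p : A) x x' := by
  rw [h.form, h.form, h.map, h.map, h.symm (p : A) l' x]
  simp only [map_add, LinearMap.add_apply, h.ker_ker p.2]
  ring

/-- Few quadrics outside the tangent space: large subspaces of the kernel meet the cone. -/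
theorem exists_mem (W : Submodule ℂ Λ)
    (hW : Module.finrank ℂ A < Module.finrank ℂ T + Module.finrank ℂ W) :
    ∃ z ∈ W, z ≠ 0 ∧ OnCone S (z : V) := by
  obtain ⟨C, hC⟩ := Submodule.exists_isCompl T
  have hd := Submodule.finrank_add_eq_of_isCompl hC
  let b := Module.finBasis ℂ C
  obtain ⟨z, hz, hz0, hbz⟩ := PolyFun.exists_mem_zero (ι := Fin (Module.finrank ℂ C)) W
    (f := fun i z => S (b i : A) (z : V) (z : V))
    (fun i => PolyFun.bilin ((S (b i : A)).compl₁₂ Λ.subtype Λ.subtype))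
    (fun i => by simp) (by rw [Fintype.card_fin]; omega)
  refine ⟨z, hz, hz0, fun p => ?_⟩
  obtain ⟨t, ht, c, hc, rfl⟩ := Submodule.mem_sup.1
    (hC.sup_eq_top ▸ Submodule.mem_top : p ∈ T ⊔ C)
  have e : c = ((∑ i, b.repr ⟨c, hc⟩ i • b i : C) : A) := by rw [b.sum_repr]
  rw [map_add, LinearMap.add_apply, LinearMap.add_apply, h.ker_ker ht, zero_add]
  have e' : c = ∑ i, b.repr ⟨c, hc⟩ i • (b i : A) := by
    refine e.trans ?_
    push_cast
    rfl
  rw [e']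
  simp only [map_sum, map_smul, LinearMap.sum_apply, LinearMap.smul_apply, hbz, smul_zero,
    Finset.sum_const_zero]

theorem flat_of_onCone {z : Λ} (hz : OnCone S (z : V)) (p p' : T) : B (M p z) (M p' z) = 0 := by
  have key : ∀ p : T, B (M p z) (M p z) = 0 := by
    intro p
    obtain ⟨g, hg⟩ := h.second p p.2
    rw [h.form, ← hg z (M p z) (h.eq_zero_of_ker z) (h.map p z), hz]
  have h1 := key (p + p')
  simp only [map_add, LinearMap.add_apply, key, h.form_symm (M p' z) (M p z)] at h1
  linear_combination h1 / 2

theorem stab_eq_map {z : Λ} (hz0 : z ≠ 0) (hz : OnCone S (z : V)) :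
    (stab M z).map T.subtype = stab S (z : V) := by
  ext p
  constructor
  · rintro ⟨p, hp, rfl⟩
    have hp : M p z = 0 := hp
    have := h.map p z
    rw [hp] at this
    exact this.symm.trans (by simp)
  · intro hp
    have hpT := h.kernel z (by simpa using hz0) hz (h.eq_zero_of_ker z) hp
    refine ⟨⟨p, hpT⟩, ?_, rfl⟩
    refine h.inj_form ?_
    have := h.map ⟨p, hpT⟩ z
    exact this.trans hp

theorem finrank_orb {z : Λ} (hz0 : z ≠ 0) (hz : OnCone S (z : V)) :
    Module.finrank ℂ (orb M z) + Module.finrank ℂ A = Module.finrank ℂ T + 4 := by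
  have h1 := finrank_orb_add (M := M) z
  have h2 := h.finrank_stab_add (z := (z : V)) (by simpa using hz0) hz
  rw [← h.stab_eq_map hz0 hz, finrank_map_of_inj T.injective_subtype] at h2
  omega

theorem mem_orb_of_perp {z : Λ} (hz0 : z ≠ 0) (hz : OnCone S (z : V)) {x : F}
    (hx : x ∈ perp B (orb M z)) : S q (x : V) ∈ orb S (z : V) := by
  refine mem_of_forall_eq_zero _ fun v hv => ?_
  obtain ⟨p, hp, hpv⟩ := h.lift z (by simpa using hz0) hz (h.eq_zero_of_ker z) v
    fun p => hv _ (orb_mem p _)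
  rw [h.symm, ← hpv, ← h.map ⟨p, hp⟩ z, ← h.form, h.form_symm]
  exact hx _ (orb_mem _ _)

/-- The injection of the complement of the kernel into the functionals. -/
theorem ker_domRestrict : LinearMap.ker ((S q).domRestrict F) = ⊥ := by
  rw [LinearMap.ker_eq_bot']
  exact fun x hx => h.inj_form hx

theorem finrank_map (W : Submodule ℂ F) :
    Module.finrank ℂ (W.map ((S q).domRestrict F)) = Module.finrank ℂ W :=
  finrank_map_of_inj (LinearMap.ker_eq_bot.1 h.ker_domRestrict) W

theorem perp_le {z : Λ} (hz0 : z ≠ 0) (hz : OnCone S (z : V)) :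
    (perp B (orb M z)).map ((S q).domRestrict F) ≤ orb S (z : V) := by
  rintro _ ⟨x, hx, rfl⟩
  exact h.mem_orb_of_perp hz0 hz hx

theorem finrank_le {z : Λ} (hz0 : z ≠ 0) (hz : OnCone S (z : V)) :
    Module.finrank ℂ F ≤ Module.finrank ℂ (orb M z) + 4 := by
  have h1 := Submodule.finrank_mono (h.perp_le hz0 hz)
  rw [h.finrank_map, h.rank z (by simpa using hz0) hz] at h1
  have h2 := finrank_perp h.form_symm h.form_nondeg (orb M z)
  omega

theorem two_mul_finrank_le {z : Λ} (hz : OnCone S (z : V)) :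
    2 * Module.finrank ℂ (orb M z) ≤ Module.finrank ℂ F :=
  _root_.two_mul_finrank_le h.form_symm h.form_nondeg (by
    rintro _ ⟨p, rfl⟩ _ ⟨p', rfl⟩
    exact h.flat_of_onCone hz p p')

theorem finrank_pos : 0 < Module.finrank ℂ F := by
  rw [Module.finrank_pos_iff_exists_ne_zero]
  by_contra! hcon
  refine h.ne (h.inj q ?_)
  ext v w
  obtain ⟨l, x, rfl⟩ := h.exists_add v
  rw [hcon x, map_add, h.eq_zero_of_ker]
  simp

omit h in
/-- Two vectors spanning a line of the cone inside the kernel of the extremal quadric. -/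
def _root_.LinePair (S : A →ₗ[ℂ] V →ₗ[ℂ] V →ₗ[ℂ] ℂ) {Λ : Submodule ℂ V} (z u : Λ) : Prop :=
  ∀ s t : ℂ, (s, t) ≠ (0, 0) → s • z + t • u ≠ 0 ∧ OnCone S ((s • z + t • u : Λ) : V)

theorem exists_line {z : Λ} (hz0 : z ≠ 0) (hz : OnCone S (z : V)) : ∃ u, LinePair S z u := by
  have hzV : (z : V) ≠ 0 := by simpa using hz0
  let Tz : Submodule ℂ V := LinearMap.ker (S.flip z).flip
  have hTz : ∀ v, v ∈ Tz ↔ ∀ p, S p z v = 0 := by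
    intro v
    rw [LinearMap.mem_ker, LinearMap.ext_iff]
    rfl
  have hTd : Module.finrank ℂ Tz + 4 = 12 := by
    have h1 : Tz = (orb S (z : V)).dualCoannihilator := by
      ext v
      rw [hTz, Submodule.mem_dualCoannihilator]
      constructor
      · rintro hv _ ⟨p, rfl⟩
        exact hv p
      · exact fun hv p => hv _ (orb_mem p _)
    have h2 := Subspace.finrank_add_finrank_dualCoannihilator_eq
      (W := (orb S (z : V) : Subspace ℂ (Module.Dual ℂ V)))
    rw [← h1, h.rank z hzV hz, h.dimV] at h2
    omega
  let R : Submodule ℂ Λ := Tz.comap Λ.subtype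
  have hR : 8 ≤ Module.finrank ℂ R + Module.finrank ℂ (orb M z) := by
    let κ : Tz →ₗ[ℂ] V →ₗ[ℂ] ℂ := (S q).domRestrict Tz
    have e1 := LinearMap.finrank_range_add_finrank_ker κ
    have e2 : LinearMap.range κ ≤ (orb M z).map ((S q).domRestrict F) := by
      rintro _ ⟨v, rfl⟩
      obtain ⟨p, hp, hpv⟩ := h.lift z hzV hz (h.eq_zero_of_ker z) v ((hTz v).1 v.2)
      refine ⟨M ⟨p, hp⟩ z, orb_mem _ _, ?_⟩
      exact (h.map _ _).trans hpv
    have e3 := Submodule.finrank_mono e2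
    rw [h.finrank_map] at e3
    have e4 : Module.finrank ℂ (LinearMap.ker κ) ≤ Module.finrank ℂ R := by
      let j : LinearMap.ker κ →ₗ[ℂ] R :=
        LinearMap.codRestrict R (LinearMap.codRestrict Λ (Tz.subtype ∘ₗ (LinearMap.ker κ).subtype)
          fun x => (h.mem_ker _).2 x.2) fun x => x.1.2
      refine LinearMap.finrank_le_finrank_of_injective (f := j) fun x y hxy => ?_
      exact Subtype.ext (Subtype.ext (congrArg (fun w : R => ((w : Λ) : V)) hxy))
    omega
  let zR : R := ⟨z, (hTz z).2 hz⟩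
  obtain ⟨C, hC⟩ := Submodule.exists_isCompl (Submodule.span ℂ {zR})
  have hd := Submodule.finrank_add_eq_of_isCompl hC
  rw [finrank_span_singleton (fun h0 => hz0 (congrArg Subtype.val h0))] at hd
  have ho := h.finrank_orb hz0 hz
  obtain ⟨u, hu, hu0, huc⟩ := h.exists_mem (C.map R.subtype) (by
    rw [finrank_map_of_inj R.injective_subtype]
    omega)
  obtain ⟨u, huC, rfl⟩ := hu
  refine ⟨u, fun s t hst => ⟨fun h0 => hst ?_, ?_⟩⟩
  · have h0' : s • zR + t • u = 0 := Subtype.ext h0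
    have e1 : s • zR = 0 := by
      have : s • zR ∈ C := by
        rw [eq_neg_of_add_eq_zero_left h0']
        exact neg_mem (Submodule.smul_mem _ _ huC)
      exact hC.disjoint.le_bot ⟨Submodule.smul_mem _ _ (Submodule.mem_span_singleton_self _), this⟩
    have hs : s = 0 := by
      rcases smul_eq_zero.1 e1 with h1 | h1
      · exact h1
      · exact absurd (congrArg Subtype.val h1) hz0
    rw [e1, zero_add] at h0'
    have ht : t = 0 := by
      rcases smul_eq_zero.1 h0' with h1 | h1
      · exact h1
      · exact absurd (congrArg Subtype.val h1) hu0
    rw [hs, ht]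
  · exact h.add_onCone hz huc ((hTz _).1 u.2) s t

end Frame

end Framing

section Framing

variable {A V : Type*} [AddCommGroup A] [Module ℂ A] [FiniteDimensional ℂ A]
  [AddCommGroup V] [Module ℂ V] [FiniteDimensional ℂ V]

namespace LinePair

variable {S : A →ₗ[ℂ] V →ₗ[ℂ] V →ₗ[ℂ] ℂ} {Λ : Submodule ℂ V} {z u : Λ} (h : LinePair S z u)
include h

theorem left : z ≠ 0 ∧ OnCone S (z : V) := by simpa using h 1 0 (by simp)

theorem right : u ≠ 0 ∧ OnCone S (u : V) := by simpa using h 0 1 (by simp)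

end LinePair

namespace Frame

variable {S : A →ₗ[ℂ] V →ₗ[ℂ] V →ₗ[ℂ] ℂ} {q : A} {T : Submodule ℂ A} {Λ F : Submodule ℂ V}
  {M : T →ₗ[ℂ] Λ →ₗ[ℂ] F} {B : F →ₗ[ℂ] F →ₗ[ℂ] ℂ} (h : Frame S q T Λ F M B)
include h

theorem exists_onCone : ∃ z : Λ, z ≠ 0 ∧ OnCone S (z : V) := by
  obtain ⟨z, hz0, hz, hqz⟩ := h.sing
  exact ⟨⟨z, (h.mem_ker z).2 hqz⟩, fun h0 => hz0 (congrArg Subtype.val h0), hz⟩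

theorem finrank_orb_eq {z u : Λ} (hz : z ≠ 0 ∧ OnCone S (z : V)) (hu : u ≠ 0 ∧ OnCone S (u : V)) :
    Module.finrank ℂ (orb M z) = Module.finrank ℂ (orb M u) := by
  have h1 := h.finrank_orb hz.1 hz.2
  have h2 := h.finrank_orb hu.1 hu.2
  omega

theorem finrank_stab_eq {z u : Λ} (hz : z ≠ 0 ∧ OnCone S (z : V)) (hu : u ≠ 0 ∧ OnCone S (u : V)) :
    Module.finrank ℂ (stab M z) = Module.finrank ℂ (stab M u) := by
  have h1 := h.finrank_orb_eq hz hu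
  have h2 := finrank_orb_add (M := M) z
  have h3 := finrank_orb_add (M := M) u
  omega

theorem comb_mem_sup {z u : Λ} (s t : ℂ) {x : F} (hx : x ∈ perp B (orb M z ⊔ orb M u)) :
    x ∈ perp B (orb M (s • z + t • u)) := by
  rintro _ ⟨p, rfl⟩
  refine hx _ ?_
  rw [LinearMap.flip_apply, map_add, map_smul, map_smul]
  exact add_mem (Submodule.smul_mem _ _ (Submodule.mem_sup_left (orb_mem p z)))
    (Submodule.smul_mem _ _ (Submodule.mem_sup_right (orb_mem p u)))

theorem finrank_le_of_stab_eq {z u : Λ} (hl : LinePair S z u) (hK : stab M z = stab M u) :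
    Module.finrank ℂ F ≤ 2 * Module.finrank ℂ (orb M z) := by
  have hKS : stab S (z : V) = stab S (u : V) := by
    rw [← h.stab_eq_map hl.left.1 hl.left.2, ← h.stab_eq_map hl.right.1 hl.right.2, hK]
  obtain ⟨C, hC⟩ := Submodule.exists_isCompl (stab S (z : V))
  have hcomb : ∀ s t : ℂ, ∀ p : A, s • S p z + t • S p u = S p ((s • z + t • u : Λ) : V) := by
    intro s t p
    simp
  have hstab : ∀ s t : ℂ, (s, t) ≠ (0, 0) →
      stab S (z : V) = stab S ((s • z + t • u : Λ) : V) := by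
    intro s t hst
    obtain ⟨h0, hc⟩ := hl s t hst
    apply Submodule.eq_of_le_of_finrank_le
    · intro p hp
      have hp' : p ∈ stab S (u : V) := hKS ▸ hp
      rw [mem_stab] at hp hp' ⊢
      rw [← hcomb, hp, hp']
      simp
    · have h1 := h.finrank_stab_add (z := (z : V)) (by simpa using hl.left.1) hl.left.2
      have h2 := h.finrank_stab_add (by simpa only [ne_eq, ZeroMemClass.coe_eq_zero] using h0) hc
      omega
  have hperp : perp B (orb M z ⊔ orb M u) = ⊥ := by
    rw [eq_bot_iff]
    intro x hx
    refine h.inj_form (pencil_eq_zero ((S.flip (z : V)).domRestrict C)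
      ((S.flip (u : V)).domRestrict C) ?_ ?_)
    · intro s t hst p hp
      have hp' : (p : A) ∈ stab S (z : V) := by
        rw [hstab s t hst, mem_stab, ← hcomb]
        exact hp
      exact Subtype.ext (hC.disjoint.le_bot ⟨hp', p.2⟩)
    · intro s t hst
      obtain ⟨h0, hc⟩ := hl s t hst
      obtain ⟨p, hp⟩ := h.mem_orb_of_perp h0 hc (h.comb_mem_sup s t hx)
      obtain ⟨k, hk, c, hcC, rfl⟩ := Submodule.mem_sup.1
        (hC.sup_eq_top ▸ Submodule.mem_top : p ∈ stab S (z : V) ⊔ C)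
      refine ⟨⟨c, hcC⟩, ?_⟩
      rw [hstab s t hst, mem_stab] at hk
      rw [← hp]
      change s • S c z + t • S c u = S (k + c) _
      rw [hcomb, map_add, LinearMap.add_apply, hk, zero_add]
  have h1 := finrank_perp h.form_symm h.form_nondeg (orb M z ⊔ orb M u)
  have h2 := Submodule.finrank_add_le_finrank_add_finrank (orb M z) (orb M u)
  have h3 := h.finrank_orb_eq hl.left hl.right
  rw [hperp, finrank_bot] at h1
  omega

theorem finrank_le_of_orb_eq {z u : Λ} (hl : LinePair S z u) (hU : orb M z = orb M u) :
    Module.finrank ℂ F ≤ 2 * Module.finrank ℂ (orb M z) := by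
  have hcomb : ∀ s t : ℂ, ∀ p : A, s • S p z + t • S p u = S p ((s • z + t • u : Λ) : V) := by
    intro s t p
    simp
  have horb : ∀ s t : ℂ, (s, t) ≠ (0, 0) → orb M (s • z + t • u) = orb M z := by
    intro s t hst
    apply Submodule.eq_of_le_of_finrank_le
    · rintro _ ⟨p, rfl⟩
      rw [LinearMap.flip_apply, map_add, map_smul, map_smul]
      exact add_mem (Submodule.smul_mem _ _ (orb_mem p z))
        (Submodule.smul_mem _ _ (hU ▸ orb_mem p u))
    · exact (h.finrank_orb_eq hl.left (hl s t hst)).le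
  have hle : perp B (orb M z) ≤ orb M z := by
    intro y hy
    have : S q (y : V) ∈ (orb M z).map ((S q).domRestrict F) := by
      refine pencil_mem (S.flip (z : V)) (S.flip (u : V)) T _ ?_ ?_
      · intro s t hst p
        obtain ⟨h0, hc⟩ := hl s t hst
        change s • S p z + t • S p u ∈ _ ↔ _
        rw [hcomb]
        constructor
        · rintro ⟨x, hx, hxp⟩
          rw [SetLike.mem_coe, ← horb s t hst] at hx
          obtain ⟨p', rfl⟩ := hx
          have e : S (p' : A) ((s • z + t • u : Λ) : V) = S p ((s • z + t • u : Λ) : V) :=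
            (h.map p' _).symm.trans hxp
          have := h.kernel _ (by simpa only [ne_eq, ZeroMemClass.coe_eq_zero] using h0) hc (h.eq_zero_of_ker _)
            (show p - p' ∈ stab S ((s • z + t • u : Λ) : V) by
              rw [mem_stab, map_sub, LinearMap.sub_apply, e, sub_self])
          simpa using add_mem this p'.2
        · intro hp
          exact ⟨M ⟨p, hp⟩ (s • z + t • u), horb s t hst ▸ orb_mem _ _, h.map ⟨p, hp⟩ _⟩
      · intro s t hst
        obtain ⟨h0, hc⟩ := hl s t hst
        obtain ⟨p, hp⟩ := h.mem_orb_of_perp h0 hc (x := y) (by rwa [horb s t hst])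
        refine ⟨p, ?_⟩
        change S q (y : V) - (s • S p z + t • S p u) ∈ _
        rw [hcomb, ← hp, LinearMap.flip_apply, sub_self]
        exact zero_mem _
    obtain ⟨x, hx, hxy⟩ := this
    have := h.inj_form (x := x - y) (by simpa [sub_eq_zero] using hxy)
    rwa [← sub_eq_zero.1 this]
  have h1 := finrank_perp h.form_symm h.form_nondeg (orb M z)
  have h2 := Submodule.finrank_mono hle
  omega

/-- The vectors of the kernel paired to zero with the whole kernel by every quadric. -/
def core (_ : Frame S q T Λ F M B) : Submodule ℂ Λ where
  carrier := {z | ∀ p, ∀ l : Λ, S p z l = 0}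
  add_mem' := fun ha hb p l => by simp [ha p l, hb p l]
  zero_mem' := fun p l => by simp
  smul_mem' := fun c x hx p l => by simp [hx p l]

theorem finrank_ne {z₀ : Λ} (hz₀ : z₀ ≠ 0 ∧ OnCone S (z₀ : V))
    (hr : Module.finrank ℂ (orb M z₀) < 4) :
    Module.finrank ℂ F ≠ Module.finrank ℂ (orb M z₀) + 4 := by
  intro hf
  have hd0 := h.finrank_orb hz₀.1 hz₀.2
  have hmap : ∀ z : Λ, z ≠ 0 → OnCone S (z : V) →
      (perp B (orb M z)).map ((S q).domRestrict F) = orb S (z : V) := by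
    intro z hz0 hz
    apply Submodule.eq_of_le_of_finrank_le (h.perp_le hz0 hz)
    rw [h.finrank_map, h.rank z (by simpa using hz0) hz]
    have h1 := finrank_perp h.form_symm h.form_nondeg (orb M z)
    have h2 := h.finrank_orb_eq hz₀ ⟨hz0, hz⟩
    omega
  have hcore : ∀ z : Λ, z ≠ 0 → OnCone S (z : V) → z ∈ h.core := by
    intro z hz0 hz p l
    have : S p (z : V) ∈ (perp B (orb M z)).map ((S q).domRestrict F) := by
      rw [hmap z hz0 hz]; exact orb_mem _ _
    obtain ⟨x, -, hx⟩ := this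
    rw [← hx]
    exact h.eq_zero_of_ker' _ _
  have hcone : ∀ z ∈ h.core, OnCone S (z : V) := fun z hz p => hz p z
  have hdim : 2 ≤ Module.finrank ℂ h.core := by
    obtain ⟨C, hC⟩ := Submodule.exists_isCompl h.core
    have e1 := Submodule.finrank_add_eq_of_isCompl hC
    have e2 := h.finrank_add
    by_contra hlt
    obtain ⟨z, hzC, hz0, hz⟩ := h.exists_mem C (by omega)
    exact hz0 (hC.disjoint.le_bot ⟨hcore z hz0 hz, hzC⟩)
  have hex : ∀ (p : A) (z : h.core), ∃ x : F, S q (x : V) = S p ((z : Λ) : V) := by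
    intro p z
    by_cases hz0 : z = 0
    · exact ⟨0, by simp [hz0]⟩
    have hz0' : (z : Λ) ≠ 0 := by simpa using hz0
    have : S p ((z : Λ) : V) ∈ (perp B (orb M (z : Λ))).map ((S q).domRestrict F) := by
      rw [hmap z hz0' (hcone z z.2)]; exact orb_mem _ _
    obtain ⟨x, -, hx⟩ := this
    exact ⟨x, hx⟩
  choose m hm using hex
  have huniq : ∀ x y : F, S q (x : V) = S q (y : V) → x = y := fun x y hxy =>
    sub_eq_zero.1 (h.inj_form (by simp [hxy]))
  let mL : A → h.core →ₗ[ℂ] F := fun p =>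
    { toFun := m p
      map_add' := fun z z' => huniq _ _ (by simp [hm])
      map_smul' := fun c z => huniq _ _ (by simp [hm]) }
  have hmL : ∀ p z, S q (mL p z : V) = S p ((z : Λ) : V) := hm
  obtain ⟨C, hC⟩ := Submodule.exists_isCompl T
  have hdC := Submodule.finrank_add_eq_of_isCompl hC
  let b := Module.finBasis ℂ C
  let G : h.core → Matrix (Fin (Module.finrank ℂ C)) (Fin (Module.finrank ℂ C)) ℂ :=
    fun z => Matrix.of fun i j => B (mL (b i) z) (mL (b j) z)
  have hpf : PolyFun fun z => (G z).det := PolyFun.det fun i j =>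
    PolyFun.bilin₂ B (mL (b i)) (mL (b j))
  have h00 : (G 0).det = 0 := by
    have : G 0 = 0 := by ext i j; simp [G]
    have hne : Nonempty (Fin (Module.finrank ℂ C)) := ⟨⟨0, by omega⟩⟩
    rw [this, Matrix.det_zero]
  obtain ⟨z, -, hz0, hz⟩ := PolyFun.exists_mem_zero (ι := Fin 1) (⊤ : Submodule ℂ h.core)
    (f := fun _ z => (G z).det) (fun _ => hpf) (fun _ => h00) (by
      rw [finrank_top, Fintype.card_fin]; omega)
  obtain ⟨c, hc0, hc⟩ := Matrix.exists_vecMul_eq_zero_iff.2 (hz 0)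
  have hz0' : (z : Λ) ≠ 0 := by simpa using hz0
  have hzc := hcone z z.2
  set x : F := ∑ i, c i • mL (b i) z with hx
  set a : C := ∑ i, c i • b i with ha
  have hxa : S q (x : V) = S a ((z : Λ) : V) := by
    rw [hx, ha]
    simp only [Submodule.coe_sum, Submodule.coe_smul, map_sum, map_smul, hmL,
      LinearMap.sum_apply, LinearMap.smul_apply]
  have hxb : ∀ j, B x (mL (b j) z) = 0 := by
    intro j
    have := congrFun hc j
    simpa [Matrix.vecMul, dotProduct, G, hx] using this
  have hxP : x ∈ perp B (orb M (z : Λ)) := by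
    have : S q (x : V) ∈ (perp B (orb M (z : Λ))).map ((S q).domRestrict F) := by
      rw [hmap z hz0' hzc, hxa]; exact orb_mem _ _
    obtain ⟨y, hy, hyx⟩ := this
    rwa [← huniq y x hyx]
  have hmC : ∀ d : C, B x (mL d z) = 0 := by
    intro d
    have e : mL d z = ∑ j, b.repr d j • mL (b j) z := by
      refine huniq _ _ ?_
      have e' : ((∑ j, b.repr d j • b j : C) : A) = d := by rw [b.sum_repr]
      rw [hmL, ← e']
      simp only [Submodule.coe_sum, Submodule.coe_smul, map_sum, map_smul, hmL,
        LinearMap.sum_apply, LinearMap.smul_apply]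
    rw [e]
    simp [hxb]
  have hxU : x ∈ orb M (z : Λ) := by
    rw [← perp_perp h.form_symm h.form_nondeg (orb M (z : Λ))]
    intro y hy
    have : S q (y : V) ∈ orb S ((z : Λ) : V) := by
      rw [← hmap z hz0' hzc]; exact ⟨y, hy, rfl⟩
    obtain ⟨p, hp⟩ := this
    obtain ⟨t, ht, d, hd, rfl⟩ := Submodule.mem_sup.1
      (hC.sup_eq_top ▸ Submodule.mem_top : p ∈ T ⊔ C)
    have e : y = M ⟨t, ht⟩ z + mL d z := by
      refine huniq _ _ ?_
      rw [← hp, Submodule.coe_add, map_add (S q), h.map, hmL, LinearMap.flip_apply, map_add,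
        LinearMap.add_apply]
    rw [e, map_add, hxP _ (orb_mem _ _), zero_add]
    exact hmC ⟨d, hd⟩
  obtain ⟨p, hp⟩ := hxU
  have hmem : (a : A) - p ∈ stab S ((z : Λ) : V) := by
    rw [mem_stab, map_sub, LinearMap.sub_apply, ← hxa, ← hp, LinearMap.flip_apply, h.map, sub_self]
  have haT : (a : A) ∈ T := by
    simpa using add_mem (h.kernel _ (by simpa using hz0') hzc (h.eq_zero_of_ker _) hmem) p.2
  have ha0 : a = 0 := Subtype.ext (hC.disjoint.le_bot ⟨haT, a.2⟩)
  refine hc0 (funext fun i => ?_)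
  exact Fintype.linearIndependent_iff.1 b.linearIndependent c (ha ▸ ha0) i

/-- The rank of the extremal quadric is twice the dimension of the swept-out spaces. -/
theorem finrank_eq {z : Λ} (hz : z ≠ 0 ∧ OnCone S (z : V)) :
    Module.finrank ℂ F = 2 * Module.finrank ℂ (orb M z) := by
  refine le_antisymm ?_ (h.two_mul_finrank_le hz.2)
  obtain ⟨u, hl⟩ := h.exists_line hz.1 hz.2
  have hu := hl.right
  by_contra hlt
  have hK : stab M z ≠ stab M u := fun hK => hlt (h.finrank_le_of_stab_eq hl hK)
  have hU : orb M z ≠ orb M u := fun hU => hlt (h.finrank_le_of_orb_eq hl hU)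
  have hr1 := h.finrank_le hz.1 hz.2
  have hne := h.finrank_ne hz
  have hru := h.finrank_orb_eq hz hu
  have hsu := h.finrank_stab_eq hz hu
  have hos := finrank_orb_add (M := M) z
  have hdT := h.finrank_orb hz.1 hz.2
  have hTA := Submodule.finrank_le T
  have hzu1 := hl 1 1 (by simp)
  have hzur := h.finrank_orb_eq hz hzu1
  rw [one_smul, one_smul] at hzu1 hzur
  have hKle : ¬ stab M z ≤ stab M u := fun hle =>
    hK (Submodule.eq_of_le_of_finrank_eq hle hsu)
  have hKle' : ¬ stab M u ≤ stab M z := fun hle =>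
    hK (Submodule.eq_of_le_of_finrank_eq hle hsu.symm).symm
  have hUlt : Module.finrank ℂ (orb M z) <
      Module.finrank ℂ (orb M z ⊔ orb M u : Submodule ℂ F) := by
    refine Submodule.finrank_lt_finrank_of_lt (lt_of_le_of_ne le_sup_left fun heq => hU ?_)
    exact (Submodule.eq_of_le_of_finrank_eq (heq ▸ le_sup_right) hru.symm).symm
  obtain h0 | h1 | h2 : Module.finrank ℂ (orb M z) = 0 ∨ Module.finrank ℂ (orb M z) = 1 ∨
      (Module.finrank ℂ (orb M z) = 2 ∧ Module.finrank ℂ F = 5) := by omega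
  · apply hU
    rw [Submodule.finrank_eq_zero.1 h0, Submodule.finrank_eq_zero.1 (hru.symm.trans h0)]
  · obtain ⟨p, hpz, hpu⟩ := SetLike.not_le_iff_exists.1 hKle
    obtain ⟨p', hpu', hpz'⟩ := SetLike.not_le_iff_exists.1 hKle'
    rw [mem_stab] at hpz hpu hpz' hpu'
    have hle : orb M z ⊔ orb M u ≤ orb M (z + u) := by
      refine sup_le ?_ ?_
      · have e : orb M z = Submodule.span ℂ {M p' z} :=
          (Submodule.eq_of_le_of_finrank_eq
            ((Submodule.span_singleton_le_iff_mem _ _).2 (orb_mem _ _))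
            (by rw [finrank_span_singleton hpz', h1])).symm
        rw [e, Submodule.span_singleton_le_iff_mem]
        exact ⟨p', by simp [hpu']⟩
      · have e : orb M u = Submodule.span ℂ {M p u} :=
          (Submodule.eq_of_le_of_finrank_eq
            ((Submodule.span_singleton_le_iff_mem _ _).2 (orb_mem _ _))
            (by rw [finrank_span_singleton hpu, ← hru, h1])).symm
        rw [e, Submodule.span_singleton_le_iff_mem]
        exact ⟨p, by simp [hpz]⟩
    have := Submodule.finrank_mono hle
    omega
  · let Om : T →ₗ[ℂ] T →ₗ[ℂ] ℂ := B.compl₁₂ (M.flip z) (M.flip u)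
    have hOm : ∀ p p', Om p p' = B (M p z) (M p' u) := fun p q => rfl
    have hsk : ∀ p p', Om p p' = -Om p' p := by
      intro p p'
      have e1 := h.flat_of_onCone hzu1.2 p p'
      simp only [map_add, LinearMap.add_apply, h.flat_of_onCone hz.2, h.flat_of_onCone hu.2] at e1
      rw [hOm, hOm, h.form_symm (M p' z)]
      linear_combination e1
    have hRz : ∀ x ∈ stab M z, ∀ y, Om x y = 0 := by
      intro x hx y
      rw [hOm, (mem_stab.1 hx)]; simp
    have hRu : ∀ x ∈ stab M u, ∀ y, Om x y = 0 := by
      intro x hx y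
      rw [hsk, hOm, (mem_stab.1 hx)]; simp
    have hR : ∀ x ∈ stab M z ⊔ stab M u, ∀ y, Om x y = 0 := by
      intro x hx y
      obtain ⟨a, ha, b, hb, rfl⟩ := Submodule.mem_sup.1 hx
      rw [map_add, LinearMap.add_apply, hRz a ha, hRu b hb, add_zero]
    have hlt2 : Module.finrank ℂ (stab M z) <
        Module.finrank ℂ (stab M z ⊔ stab M u : Submodule ℂ T) :=
      Submodule.finrank_lt_finrank_of_lt (lt_of_le_of_ne le_sup_left fun heq =>
        hKle' (heq ▸ le_sup_right))
    obtain ⟨C, hC⟩ := Submodule.exists_isCompl (stab M z ⊔ stab M u)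
    have hdC := Submodule.finrank_add_eq_of_isCompl hC
    have hself : ∀ x, Om x x = 0 := fun x => by linear_combination (1/2) * hsk x x
    have hCC : ∀ x ∈ C, ∀ y ∈ C, Om x y = 0 := by
      intro x hx y hy
      by_cases hx0 : x = 0
      · simp [hx0]
      have : y ∈ Submodule.span ℂ {x} := by
        have e : Submodule.span ℂ {x} = C := Submodule.eq_of_le_of_finrank_le
          ((Submodule.span_singleton_le_iff_mem _ _).2 hx)
          (by rw [finrank_span_singleton hx0]; omega)
        rwa [e]
      obtain ⟨c, rfl⟩ := Submodule.mem_span_singleton.1 this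
      rw [map_smul, hself, smul_zero]
    have hall : ∀ x y, Om x y = 0 := by
      intro x y
      obtain ⟨a, ha, b, hb, rfl⟩ := Submodule.mem_sup.1
        (hC.sup_eq_top ▸ Submodule.mem_top : x ∈ (stab M z ⊔ stab M u) ⊔ C)
      obtain ⟨a', ha', b', hb', rfl⟩ := Submodule.mem_sup.1
        (hC.sup_eq_top ▸ Submodule.mem_top : y ∈ (stab M z ⊔ stab M u) ⊔ C)
      have e1 : Om b a' = 0 := by rw [hsk, hR a' ha', neg_zero]
      rw [map_add Om, LinearMap.add_apply, hR a ha, zero_add, map_add, e1, hCC b hb b' hb', add_zero]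
    have hiso := _root_.two_mul_finrank_le h.form_symm h.form_nondeg (W := orb M z ⊔ orb M u) (by
      intro x hx y hy
      obtain ⟨_, ⟨a, rfl⟩, _, ⟨b, rfl⟩, rfl⟩ := Submodule.mem_sup.1 hx
      obtain ⟨_, ⟨a', rfl⟩, _, ⟨b', rfl⟩, rfl⟩ := Submodule.mem_sup.1 hy
      have e1 := hall a b'
      have e2 := hall a' b
      rw [hOm] at e1 e2
      simp only [LinearMap.flip_apply, map_add, LinearMap.add_apply, h.flat_of_onCone hz.2,
        h.flat_of_onCone hu.2, e1, h.form_symm (M b u) (M a' z), e2, add_zero])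
    omega

end Frame

end Framing

section Framing

variable {A V : Type*} [AddCommGroup A] [Module ℂ A] [FiniteDimensional ℂ A]
  [AddCommGroup V] [Module ℂ V] [FiniteDimensional ℂ V]

namespace Frame

variable {S : A →ₗ[ℂ] V →ₗ[ℂ] V →ₗ[ℂ] ℂ} {q : A} {T : Submodule ℂ A} {Λ F : Submodule ℂ V}
  {M : T →ₗ[ℂ] Λ →ₗ[ℂ] F} {B : F →ₗ[ℂ] F →ₗ[ℂ] ℂ} (h : Frame S q T Λ F M B)
include h

theorem isLagr {z : Λ} (hz0 : z ≠ 0) (hz : OnCone S (z : V)) : IsLagr M z :=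
  (h.finrank_eq ⟨hz0, hz⟩).symm

theorem of_ker {p : T} {z : Λ} (hz0 : z ≠ 0) (hz : OnCone S (z : V)) (hp : M p z = 0) (l : Λ) :
    B (M p l) (M p l) = 0 ∧ S (p : A) (M p l : V) (M p l : V) = 0 := by
  have hpz : S (p : A) (z : V) = 0 := by rw [← h.map, hp]; simp
  rw [h.form]
  exact h.line z (by simpa using hz0) hz (h.eq_zero_of_ker z) p hpz l (M p l) (h.eq_zero_of_ker l)
    (h.map p l)

theorem even_sub_of_onCone {W : Submodule ℂ Λ} (hW : ∀ l ∈ W, OnCone S (l : V)) {z u : Λ}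
    (hz0 : z ≠ 0) (hu0 : u ≠ 0) (hz : z ∈ W) (hu : u ∈ W) :
    Even (Module.finrank ℂ (orb M z) -
      Module.finrank ℂ (orb M z ⊓ orb M u : Submodule ℂ F)) := by
  have hf : IsFlat (M.compl₂ W.subtype) B :=
    ⟨h.form_symm, h.form_nondeg, fun p l => h.flat_of_onCone (hW l l.2) p p⟩
  exact hf.even_sub (z := ⟨z, hz⟩) (u := ⟨u, hu⟩) (h.isLagr hz0 (hW z hz)) (h.isLagr hu0 (hW u hu))

/-- The span of two orthogonal vectors of the cone lies on the cone. -/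
theorem span_onCone {z u : Λ} (hz : OnCone S (z : V)) (hu : OnCone S (u : V))
    (hzu : ∀ p, S p (z : V) u = 0) :
    ∀ l ∈ Submodule.span ℂ {z, u}, OnCone S (l : V) := by
  intro l hl
  obtain ⟨s, t, rfl⟩ := Submodule.mem_span_pair.1 hl
  simpa using h.add_onCone hz hu hzu s t

theorem flat_of_codim_one (hd : Module.finrank ℂ T + 1 = Module.finrank ℂ A) (p : T) (l₀ : Λ) :
    B (M p l₀) (M p l₀) = 0 := by
  by_contra hne
  obtain ⟨g, hg⟩ := h.second p p.2
  have hg1 : ∀ l : Λ, S g l l = B (M p l) (M p l) := by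
    intro l
    rw [h.form]
    exact hg l (M p l) (h.eq_zero_of_ker l) (h.map p l)
  have hg2 : ∀ l l' : Λ, S g l l' = B (M p l) (M p l') := by
    intro l l'
    have e := hg1 (l + l')
    simp only [Submodule.coe_add, map_add, LinearMap.add_apply, hg1, h.symm g l' l,
      h.form_symm (M p l') (M p l)] at e
    linear_combination e / 2
  have hgT : g ∉ T := by
    intro hgT
    exact hne ((hg1 l₀).symm.trans (h.ker_ker hgT l₀ l₀))
  have hsup : T ⊔ Submodule.span ℂ {g} = ⊤ := by
    apply Submodule.eq_top_of_finrank_eq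
    have h1 : Module.finrank ℂ T < Module.finrank ℂ (T ⊔ Submodule.span ℂ {g} : Submodule ℂ A) := by
      refine Submodule.finrank_lt_finrank_of_lt (lt_of_le_of_ne le_sup_left fun heq => hgT ?_)
      rw [heq]
      exact Submodule.mem_sup_right (Submodule.mem_span_singleton_self g)
    have h2 := Submodule.finrank_le (T ⊔ Submodule.span ℂ {g} : Submodule ℂ A)
    omega
  have hpair : ∀ l l' : Λ, B (M p l) (M p l') = 0 → ∀ a, S a l l' = 0 := by
    intro l l' hll a
    obtain ⟨t, ht, c, hc, rfl⟩ := Submodule.mem_sup.1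
      (hsup ▸ Submodule.mem_top : a ∈ T ⊔ Submodule.span ℂ {g})
    obtain ⟨c, rfl⟩ := Submodule.mem_span_singleton.1 hc
    simp only [map_add, LinearMap.add_apply, h.ker_ker ht, map_smul, LinearMap.smul_apply, hg2,
      hll, smul_zero, add_zero]
  have hcone : ∀ l : Λ, B (M p l) (M p l) = 0 → OnCone S (l : V) := fun l hl a => hpair l l hl a
  have hinj : Function.Injective (M p) := by
    rw [← LinearMap.ker_eq_bot, LinearMap.ker_eq_bot']
    intro l hl
    by_contra hl0
    exact hne (h.of_ker hl0 (hcone l (by simp [hl])) hl l₀).1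
  obtain ⟨z₀, hz₀0, hz₀⟩ := h.exists_onCone
  have hr := h.finrank_orb hz₀0 hz₀
  have hf := h.finrank_eq ⟨hz₀0, hz₀⟩
  have hΛ := h.finrank_add
  have hr3 : ∀ z : Λ, z ≠ 0 → OnCone S (z : V) → Module.finrank ℂ (orb M z) = 3 := by
    intro z hz0 hz
    have := h.finrank_orb hz0 hz
    omega
  have hself : ∀ {z : Λ}, z ≠ 0 → OnCone S (z : V) → perp B (orb M z) = orb M z := by
    intro z hz0 hz
    refine perp_eq_self h.form_symm h.form_nondeg ?_ ?_
    · rintro _ ⟨a, rfl⟩ _ ⟨b, rfl⟩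
      exact h.flat_of_onCone hz a b
    · exact (h.finrank_eq ⟨hz0, hz⟩).le
  have heq : ∀ {z u : Λ}, z ≠ 0 → u ≠ 0 → OnCone S (z : V) → OnCone S (u : V) →
      Module.finrank ℂ (orb M z) ≤ Module.finrank ℂ (orb M z ⊓ orb M u : Submodule ℂ F) →
      orb M u = orb M z := by
    intro z u hz0 hu0 hz hu hle
    have e1 := Submodule.eq_of_le_of_finrank_le inf_le_left hle
    exact (Submodule.eq_of_le_of_finrank_eq (e1 ▸ inf_le_right)
      (by rw [hr3 z hz0 hz, hr3 u hu0 hu])).symm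
  have hα : ∀ {z u : Λ}, z ≠ 0 → u ≠ 0 → OnCone S (z : V) → M p u ∈ orb M z →
      orb M u = orb M z := by
    intro z u hz0 hu0 hz hmem
    have hu : OnCone S (u : V) := by
      obtain ⟨a, ha⟩ := hmem
      refine hcone u ?_
      rw [← ha]
      exact h.flat_of_onCone hz a a
    have hzu : ∀ a, S a (z : V) u = 0 := by
      refine hpair z u ?_
      obtain ⟨a, ha⟩ := hmem
      rw [← ha]
      exact h.flat_of_onCone hz p a
    have hW := h.span_onCone hz hu hzu
    have hev := h.even_sub_of_onCone hW hz0 hu0 (Submodule.subset_span (by simp))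
      (Submodule.subset_span (by simp))
    have hskew : ∀ a b, B (M a z) (M b u) = -B (M b z) (M a u) := by
      intro a b
      have e1 := h.flat_of_onCone (hW (z + u) (add_mem (Submodule.subset_span (by simp))
        (Submodule.subset_span (by simp)))) a b
      simp only [map_add, LinearMap.add_apply, h.flat_of_onCone hz, h.flat_of_onCone hu] at e1
      rw [h.form_symm (M b z)]
      linear_combination e1
    have hpz : M p z ∈ orb M u := by
      rw [← hself hu0 hu]
      rintro _ ⟨b, rfl⟩
      change B (M p z) (M b u) = 0
      rw [hskew]
      obtain ⟨a, ha⟩ := hmem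
      rw [← ha]
      simpa using h.flat_of_onCone hz b a
    by_cases hdep : ∃ c : ℂ, u = c • z
    · obtain ⟨c, rfl⟩ := hdep
      refine heq hz0 hu0 hz hu (Submodule.finrank_mono (le_inf le_rfl ?_))
      rintro _ ⟨a, rfl⟩
      have hc : c ≠ 0 := by rintro rfl; simp at hu0
      refine ⟨c⁻¹ • a, ?_⟩
      simp [smul_smul, hc]
    · have h2 : 2 ≤ Module.finrank ℂ (orb M z ⊓ orb M u : Submodule ℂ F) := by
        have hli : LinearIndependent ℂ ![M p z, M p u] := by
          rw [LinearIndependent.pair_iff' (fun h0 => hz0 (hinj (h0.trans (map_zero _).symm)))]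
          intro c hc
          exact hdep ⟨c, (hinj (by rw [map_smul, hc])).symm⟩
        have e1 : _ = 2 := (finrank_span_eq_card hli).trans (Fintype.card_fin 2)
        refine e1.symm.trans_le ?_
        refine Submodule.finrank_mono (Submodule.span_le.2 ?_)
        rintro _ ⟨i, rfl⟩
        fin_cases i
        · exact ⟨orb_mem _ _, hpz⟩
        · exact ⟨hmem, orb_mem _ _⟩
      refine heq hz0 hu0 hz hu ?_
      rw [hr3 z hz0 hz] at hev ⊢
      obtain ⟨k, hk⟩ := hev
      omega
  have hline : ∀ {z u : Λ}, z ≠ 0 → u ≠ 0 → OnCone S (z : V) → OnCone S (u : V) →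
      (∀ a, S a (z : V) u = 0) → orb M u = orb M z := by
    intro z u hz0 hu0 hz hu hzu
    have hev := h.even_sub_of_onCone (h.span_onCone hz hu hzu) hz0 hu0
      (Submodule.subset_span (by simp)) (Submodule.subset_span (by simp))
    have hne' : orb M z ⊓ orb M u ≠ ⊥ := by
      intro h0
      rw [h0, finrank_bot, hr3 z hz0 hz] at hev
      obtain ⟨k, hk⟩ := hev
      omega
    obtain ⟨x, ⟨hxz, hxu⟩, hx0⟩ := Submodule.exists_mem_ne_zero_of_ne_bot hne'
    have hsurj : Function.Surjective (M p) :=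
      (LinearMap.injective_iff_surjective_of_finrank_eq_finrank (by omega)).1 hinj
    obtain ⟨w, rfl⟩ := hsurj x
    have hw0 : w ≠ 0 := by rintro rfl; simp at hx0
    rw [← hα hz0 hw0 hz hxz, hα hu0 hw0 hu hxu]
  have hconst : ∀ z : Λ, z ≠ 0 → OnCone S (z : V) → orb M z = orb M z₀ := by
    intro z hz0 hz
    let R : Submodule ℂ Λ := LinearMap.ker (B.compl₁₂ (M p) (M p) z) ⊓
      LinearMap.ker (B.compl₁₂ (M p) (M p) z₀)
    have hR : 4 ≤ Module.finrank ℂ R := by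
      have e1 := LinearMap.finrank_range_add_finrank_ker (B.compl₁₂ (M p) (M p) z)
      have e2 := LinearMap.finrank_range_add_finrank_ker (B.compl₁₂ (M p) (M p) z₀)
      have e3 := Submodule.finrank_sup_add_finrank_inf_eq (LinearMap.ker (B.compl₁₂ (M p) (M p) z))
        (LinearMap.ker (B.compl₁₂ (M p) (M p) z₀))
      have e4 := Submodule.finrank_le (LinearMap.range (B.compl₁₂ (M p) (M p) z))
      have e5 := Submodule.finrank_le (LinearMap.range (B.compl₁₂ (M p) (M p) z₀))
      have e6 := Submodule.finrank_le (LinearMap.ker (B.compl₁₂ (M p) (M p) z) ⊔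
        LinearMap.ker (B.compl₁₂ (M p) (M p) z₀))
      rw [Module.finrank_self] at e4 e5
      change 4 ≤ Module.finrank ℂ (LinearMap.ker _ ⊓ LinearMap.ker _ : Submodule ℂ Λ)
      omega
    obtain ⟨w, hw, hw0, hwc⟩ := h.exists_mem R (by omega)
    rw [← hline hz0 hw0 hz hwc (hpair z w hw.1), hline hz₀0 hw0 hz₀ hwc (hpair z₀ w hw.2)]
  obtain ⟨C, hC⟩ := Submodule.exists_isCompl ((orb M z₀).comap (M p))
  have hdC := Submodule.finrank_add_eq_of_isCompl hC
  have hcm := finrank_comap_add (M p) (orb M z₀)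
  rw [LinearMap.ker_eq_bot.2 hinj, finrank_bot, zero_add] at hcm
  have hle := Submodule.finrank_mono (inf_le_right : LinearMap.range (M p) ⊓ orb M z₀ ≤ _)
  obtain ⟨z, hzC, hz0, hz⟩ := h.exists_mem C (by omega)
  refine hz0 (hC.disjoint.le_bot ⟨?_, hzC⟩)
  rw [SetLike.mem_coe, Submodule.mem_comap, ← hconst z hz0 hz]
  exact orb_mem _ _

theorem flat (p : T) (l : Λ) : B (M p l) (M p l) = 0 := by
  obtain ⟨z₀, hz₀0, hz₀⟩ := h.exists_onCone
  have hr := h.finrank_orb hz₀0 hz₀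
  have hf := h.finrank_eq ⟨hz₀0, hz₀⟩
  have hΛ := h.finrank_add
  have hTA := Submodule.finrank_le T
  rcases Nat.lt_or_ge (Module.finrank ℂ T + 1) (Module.finrank ℂ A) with h2 | h2
  · have e1 := LinearMap.finrank_range_add_finrank_ker (M p)
    have e2 := Submodule.finrank_le (LinearMap.range (M p))
    obtain ⟨z, hz, hz0, hzc⟩ := h.exists_mem (LinearMap.ker (M p)) (by omega)
    exact (h.of_ker hz0 hzc hz l).1
  · rcases h2.eq_or_lt with h1 | h0
    · exact h.flat_of_codim_one h1.symm p l
    · have hT : T = ⊤ := Submodule.eq_top_of_finrank_eq (by omega)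
      rw [h.form]
      exact (h.full hT p l (M p l) (h.eq_zero_of_ker l) (h.map p l)).1

theorem isFlat : IsFlat M B := ⟨h.form_symm, h.form_nondeg, h.flat⟩

/-- The swept-out space cannot be constant with the quadrics vanishing on it. -/
theorem false_of_const {z : Λ} (hz0 : z ≠ 0) (hz : OnCone S (z : V)) (hM : ∀ p l, M p l ∈ orb M z)
    (hN : ∀ p : T, ∀ x ∈ orb M z, ∀ y ∈ orb M z, S (p : A) (x : V) (y : V) = 0) : False := by
  have hf := h.finrank_eq ⟨hz0, hz⟩
  have hpos := h.finrank_pos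
  let b := Module.finBasis ℂ (orb M z)
  choose p hp using fun i => (b i).2
  have hp' : ∀ i, M (p i) z = b i := hp
  have hSp : ∀ i v, S (p i : A) (z : V) v = S q (b i : V) v := by
    intro i v
    rw [← h.map, hp']
  refine h.false_of_vanish (by omega) hz (fun i => (p i : A)) ?_ ?_
  · have e : (fun i => S (p i : A) (z : V)) =
        ((S q).domRestrict F ∘ₗ (orb M z).subtype) ∘ b := by
      funext i
      exact LinearMap.ext fun v => hSp i v
    rw [e]
    refine b.linearIndependent.map' _ ?_
    rw [LinearMap.ker_eq_bot']
    intro x hx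
    exact Subtype.ext (h.inj_form hx)
  · intro v hv j
    obtain ⟨l, x, rfl⟩ := h.exists_add v
    have hx : x ∈ orb M z := by
      rw [h.isFlat.mem_orb_iff (h.isLagr hz0 hz)]
      intro a
      have hpx : ∀ i, B (b i) x = 0 := by
        intro i
        have := hv i
        rwa [hSp, map_add, h.eq_zero_of_ker', zero_add, ← h.form] at this
      have e : M a z = ∑ i, b.repr ⟨M a z, orb_mem a z⟩ i • (b i : F) := by
        have := congrArg Subtype.val (b.sum_repr ⟨M a z, orb_mem a z⟩)
        refine this.symm.trans ?_
        push_cast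
        rfl
      rw [h.form_symm, e]
      simp [hpx]
    have hMx : B (M (p j) l) x = 0 := by
      have := (h.isFlat.mem_orb_iff (h.isLagr hz0 hz)).1 hx
      obtain ⟨a, ha⟩ := hM (p j) l
      obtain ⟨c, hc⟩ := hx
      rw [← ha, ← hc]
      exact h.flat_of_onCone hz a c
    rw [h.expand, hMx, hN _ x hx x hx]
    ring

/-- Finitely many quadrics outside the tangent space define the cone inside the kernel. -/
theorem exists_gen : ∃ e, Module.finrank ℂ T + e = Module.finrank ℂ A ∧ ∃ g : Fin e → A,
    ∀ z : Λ, (∀ i, S (g i) (z : V) z = 0) → OnCone S (z : V) := by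
  obtain ⟨C, hC⟩ := Submodule.exists_isCompl T
  let b := Module.finBasis ℂ C
  refine ⟨_, Submodule.finrank_add_eq_of_isCompl hC, fun i => b i, fun z hbz p => ?_⟩
  obtain ⟨t, ht, c, hc, rfl⟩ := Submodule.mem_sup.1
    (hC.sup_eq_top ▸ Submodule.mem_top : p ∈ T ⊔ C)
  have e : c = ((∑ i, b.repr ⟨c, hc⟩ i • b i : C) : A) := by rw [b.sum_repr]
  rw [map_add, LinearMap.add_apply, LinearMap.add_apply, h.ker_ker ht, zero_add]
  have e' : c = ∑ i, b.repr ⟨c, hc⟩ i • (b i : A) := by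
    refine e.trans ?_
    push_cast
    rfl
  rw [e']
  simp only [map_sum, map_smul, LinearMap.sum_apply, LinearMap.smul_apply, hbz, smul_zero,
    Finset.sum_const_zero]

theorem false_of_ne_top (hT : Module.finrank ℂ T < Module.finrank ℂ A) : False := by
  obtain ⟨e, he, g, hg⟩ := h.exists_gen
  obtain ⟨z₀, hz₀0, hz₀⟩ := h.exists_onCone
  have hr := h.finrank_orb hz₀0 hz₀
  have hf := h.finrank_eq ⟨hz₀0, hz₀⟩
  have hΛ := h.finrank_add
  have hpos := h.finrank_pos
  have hloc : FlatLocus M B fun i (z : Λ) => S (g i) (z : V) z :=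
    { h.isFlat with
      poly := fun i => PolyFun.bilin ((S (g i)).compl₁₂ Λ.subtype Λ.subtype)
      zero := fun i => by simp
      lagr := fun z hz0 hz => h.isLagr hz0 (hg z hz)
      line := fun z hz0 hz => by
        obtain ⟨u, hu⟩ := h.exists_line hz0 (hg z hz)
        exact ⟨u, fun s t hst => ⟨(hu s t hst).1, fun i => (hu s t hst).2 _⟩⟩ }
  obtain ⟨z, hz0, hz, hM⟩ := hloc.const (r := Module.finrank ℂ (orb M z₀)) (by omega) (by omega)
    (by omega) hf (by omega)
  have hzc := hg z hz
  refine h.false_of_const hz0 hzc hM fun p x hx y hy => ?_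
  have hk := hloc.finrank_ker p
  obtain ⟨z', hz', hz'0, hz'c⟩ := h.exists_mem (LinearMap.ker (M p)) (by omega)
  have hpz' : M p z' = 0 := hz'
  have hU : orb M z' = orb M z := by
    refine Submodule.eq_of_le_of_finrank_eq ?_ (h.finrank_orb_eq ⟨hz'0, hz'c⟩ ⟨hz0, hzc⟩)
    rintro _ ⟨a, rfl⟩
    exact hM a z'
  have hcub : ∀ (p' : T) (l : Λ), S (p' : A) (M p' l : V) (M p' l : V) = 0 := by
    intro p' l
    have hk := hloc.finrank_ker p'
    obtain ⟨w, hw, hw0, hwc⟩ := h.exists_mem (LinearMap.ker (M p')) (by omega)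
    exact (h.of_ker hw0 hwc hw l).2
  have hsq : ∀ x ∈ orb M z', S (p : A) (x : V) x = 0 := by
    rintro _ ⟨a, rfl⟩
    have e := hcub (p + a) z'
    simp only [map_add, LinearMap.add_apply, hpz', zero_add, Submodule.coe_add, hcub a z',
      add_zero] at e
    exact e
  rw [← hU] at hx hy
  have e := hsq _ (add_mem hx hy)
  simp only [Submodule.coe_add, map_add, LinearMap.add_apply, hsq x hx, hsq y hy,
    h.symm (p : A) y x] at e
  linear_combination e / 2

theorem false_of_eq_top (hT : T = ⊤) : False := by
  obtain ⟨z₀, hz₀0, hz₀⟩ := h.exists_onCone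
  have hr := h.finrank_orb hz₀0 hz₀
  have hf := h.finrank_eq ⟨hz₀0, hz₀⟩
  have hΛ := h.finrank_add
  have hTd : Module.finrank ℂ T = Module.finrank ℂ A := by rw [hT, finrank_top]
  have hcone : ∀ z : Λ, OnCone S (z : V) := fun z p => h.ker_ker (hT ▸ Submodule.mem_top) z z
  let N : T →ₗ[ℂ] F →ₗ[ℂ] F →ₗ[ℂ] ℂ :=
    { toFun := fun p => (S (p : A)).compl₁₂ F.subtype F.subtype
      map_add' := fun p p' => by ext; simp
      map_smul' := fun c p => by ext; simp }
  have hN : ∀ p x y, N p x y = S (p : A) (x : V) (y : V) := fun p x y => rfl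
  have hq : Quartic M B N ⟨q, h.q_mem⟩ :=
    { h.isFlat with
      dimL := by omega
      dimF := by omega
      lagr := fun z hz0 => h.isLagr hz0 (hcone z)
      Nsymm := fun p x y => h.symm p x y
      cubic := fun p l => (h.full hT p l (M p l) (h.eq_zero_of_ker l) (h.map p l)).2
      Mq := by
        ext l : 1
        refine h.inj_form ?_
        rw [h.map]
        exact h.eq_zero_of_ker l
      Nq := fun x y => (h.form x y).symm }
  rcases hq.trichotomy with ⟨z, hz0, hz⟩ | ⟨p, t, c, l, hc, hl, hp1, hp2⟩ |
    ⟨l, g, hlg, hcub, K, hK, hKv⟩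
  · exact h.false_of_const hz0 (hcone z) (fun p => (hz p).1) fun p => (hz p).2
  · obtain ⟨z, hz⟩ : ∃ z, l z ≠ 0 := by
      by_contra! hcon
      exact hl (LinearMap.ext hcon)
    have hS : ∀ (m : Λ) (v : V) (m' : Λ) (x' x : F), S ((p : A) - t • q) (m + x : V) (m' + x' : V) =
        l m * B c x' + l m' * B c x + (S (p : A) x x' - t * B x x') := by
      intro m v m' x' x
      have e1 := h.expand p m m' x x'
      have e2 : S q (m + x : V) (m' + x' : V) = B x x' := by
        rw [h.form]
        simp [h.eq_zero_of_ker, h.eq_zero_of_ker']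
      rw [map_sub, LinearMap.sub_apply, LinearMap.sub_apply, e1, map_smul, LinearMap.smul_apply,
        LinearMap.smul_apply, e2, hp1, hp1]
      simp only [map_smul, LinearMap.smul_apply, smul_eq_mul]
      ring
    have hSz : ∀ (m : Λ) (x : F), S ((p : A) - t • q) (z : V) (m + x : V) = l z * B c x := by
      intro m x
      have := hS z 0 m x 0
      simpa using this
    refine h.false_of_vanish (r := 1) one_pos (hcone z) (fun _ => (p : A) - t • q) ?_ ?_
    · rw [linearIndependent_unique_iff]
      intro h0
      refine hc (h.form_nondeg c fun x => ?_)
      have e1 := hSz 0 x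
      rw [h0] at e1
      have e2 : l z * B c x = 0 := by rw [← e1]; rfl
      exact (mul_eq_zero.1 e2).resolve_left hz
    · intro v hv j
      obtain ⟨m, x, rfl⟩ := h.exists_add v
      have e1 := hv 0
      rw [hSz] at e1
      have e2 : B c x = 0 := (mul_eq_zero.1 e1).resolve_left hz
      have e3 := hp2 x x e2 e2
      rw [hN] at e3
      rw [hS m 0, e2, e3]
      ring
  · have hv0 : (l + g : V) ≠ 0 := by
      intro h0
      have hl0 : l = 0 := Subtype.ext (h.compl.disjoint.le_bot
        ⟨l.2, by rw [eq_neg_of_add_eq_zero_left h0]; exact neg_mem g.2⟩)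
      have hg0 : g = 0 := by
        rw [hl0, Submodule.coe_zero, zero_add] at h0
        exact Subtype.ext h0
      exact hlg.elim (fun h1 => h1 hl0) fun h1 => h1 hg0
    have hvc : OnCone S (l + g : V) := by
      intro p
      have := h.expand ⟨p, hT ▸ Submodule.mem_top⟩ l l g g
      refine this.trans ?_
      rw [← hN, ← hcub ⟨p, hT ▸ Submodule.mem_top⟩]
      ring
    have hle : K.map T.subtype ≤ stab S (l + g : V) := by
      rintro _ ⟨p, hp, rfl⟩
      rw [mem_stab]
      ext v
      obtain ⟨l', x', rfl⟩ := h.exists_add v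
      have := h.expand p l l' g x'
      refine this.trans ?_
      rw [← hN]
      exact hKv p hp l' x'
    have e1 := Submodule.finrank_mono hle
    rw [finrank_map_of_inj T.injective_subtype] at e1
    have e2 := h.finrank_stab_add hv0 hvc
    omega

end Frame

theorem Extremal.false {S : A →ₗ[ℂ] V →ₗ[ℂ] V →ₗ[ℂ] ℂ} {q : A} {T : Submodule ℂ A}
    (h : Extremal S q T) : False := by
  obtain ⟨Λ, F, M, B, hF⟩ := h.exists_frame
  rcases (Submodule.finrank_le T).lt_or_eq with hT | hT
  · exact hF.false_of_ne_top hT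
  · exact hF.false_of_eq_top (Submodule.eq_top_of_finrank_eq hT)

end Framing

section Bordered

variable {R R' V : Type*} [CommRing R] [CommRing R'] {f : ℕ}

/-- The square matrix of the values of a pairing. -/
def pairMatrix (s : V → V → R) (c d : Fin f → V) : Matrix (Fin f) (Fin f) R :=
  Matrix.of fun i j => s (c i) (d j)

/-- A multiple of the bordered determinant of a pairing. -/
def border (s : V → V → R) (c d : Fin f → V) (x y : V) : R :=
  (pairMatrix s c d).det * ((pairMatrix s c d).det * s x y -
    (fun j => s x (d j)) ⬝ᵥ ((pairMatrix s c d).adjugate.mulVec fun i => s (c i) y))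

theorem map_det_pairMatrix (φ : R →+* R') (s : V → V → R) (c d : Fin f → V) :
    φ (pairMatrix s c d).det = (pairMatrix (fun x y => φ (s x y)) c d).det := by
  rw [RingHom.map_det]
  rfl

theorem map_border (φ : R →+* R') (s : V → V → R) (c d : Fin f → V) (x y : V) :
    φ (border s c d x y) = border (fun x y => φ (s x y)) c d x y := by
  have e : φ.mapMatrix (pairMatrix s c d) = pairMatrix (fun x y => φ (s x y)) c d := rfl
  rw [border, map_mul, map_sub, map_mul, RingHom.map_dotProduct, map_det_pairMatrix, border]
  congr 3
  funext j
  rw [Function.comp_apply, RingHom.map_mulVec, ← e, ← RingHom.map_adjugate]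
  rfl

theorem border_eq_zero {s : V → V → R} {c d : Fin f → V} {x : V} (β : Fin f → R)
    (h : ∀ y, s x y = ∑ i, β i * s (c i) y) (y : V) : border s c d x y = 0 := by
  have e1 : (fun j => s x (d j)) = Matrix.vecMul β (pairMatrix s c d) := by
    funext j
    rw [h]
    rfl
  rw [border, e1, Matrix.dotProduct_mulVec, Matrix.vecMul_vecMul, Matrix.mul_adjugate,
    Matrix.vecMul_smul, Matrix.vecMul_one, smul_dotProduct, smul_eq_mul, h]
  simp [dotProduct]

open Polynomial in
theorem border_eval {s : V → V → ℂ[X]} {c d : Fin f → V}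
    (hG : (pairMatrix s c d).det.eval 0 ≠ 0) {x₁ x₂ y₁ y₂ : V} {a b k : ℕ} (hk : k + 1 ≤ a + b)
    (hE : ∀ x y, X ^ (k + 1) ∣ border s c d x y)
    (ha : ∀ j, X ^ a ∣ s x₁ (d j) - X * s x₂ (d j))
    (hb : ∀ i, X ^ b ∣ s (c i) y₁ - X * s (c i) y₂) {e : ℂ[X]}
    (he : s x₁ y₁ - X * s x₂ y₁ - X * s x₁ y₂ + X ^ 2 * s x₂ y₂ = X ^ k * e) :
    e.eval 0 = 0 := by
  set G := pairMatrix s c d with hGdef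
  choose u hu using ha
  choose w hw using hb
  have hp : IsCoprime (X ^ (k + 1) : ℂ[X]) G.det := by
    refine IsCoprime.pow_left ?_
    rw [(Polynomial.irreducible_X).coprime_iff_not_dvd, Polynomial.X_dvd_iff,
      Polynomial.coeff_zero_eq_eval_zero]
    exact hG
  have hE' : ∀ x y, X ^ (k + 1) ∣ G.det * s x y -
      (fun j => s x (d j)) ⬝ᵥ (G.adjugate.mulVec fun i => s (c i) y) :=
    fun x y => hp.dvd_of_dvd_mul_left (hE x y)
  have h1 : X ^ (k + 1) ∣ G.det * (X ^ k * e) -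
      (fun j => s x₁ (d j) - X * s x₂ (d j)) ⬝ᵥ
        (G.adjugate.mulVec fun i => s (c i) y₁ - X * s (c i) y₂) := by
    have e1 : (fun j => s x₁ (d j) - X * s x₂ (d j)) =
        (fun j => s x₁ (d j)) - (X : ℂ[X]) • fun j => s x₂ (d j) := rfl
    have e2 : (fun i => s (c i) y₁ - X * s (c i) y₂) =
        (fun i => s (c i) y₁) - (X : ℂ[X]) • fun i => s (c i) y₂ := rfl
    rw [← he, e1, e2]
    simp only [Matrix.mulVec_sub, Matrix.mulVec_smul, sub_dotProduct, dotProduct_sub,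
      smul_dotProduct, dotProduct_smul, smul_eq_mul]
    obtain ⟨r₁, h₁⟩ := hE' x₁ y₁
    obtain ⟨r₂, h₂⟩ := hE' x₂ y₁
    obtain ⟨r₃, h₃⟩ := hE' x₁ y₂
    obtain ⟨r₄, h₄⟩ := hE' x₂ y₂
    refine ⟨r₁ - X * r₂ - X * r₃ + X ^ 2 * r₄, ?_⟩
    linear_combination h₁ - X * h₂ - X * h₃ + X ^ 2 * h₄
  have h2 : X ^ (k + 1) ∣ (fun j => s x₁ (d j) - X * s x₂ (d j)) ⬝ᵥ
      (G.adjugate.mulVec fun i => s (c i) y₁ - X * s (c i) y₂) := by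
    have e1 : (fun j => s x₁ (d j) - X * s x₂ (d j)) = (X ^ a : ℂ[X]) • u := funext hu
    have e2 : (fun i => s (c i) y₁ - X * s (c i) y₂) = (X ^ b : ℂ[X]) • w := funext hw
    rw [e1, e2, Matrix.mulVec_smul, smul_dotProduct, dotProduct_smul, smul_smul, ← pow_add]
    exact (pow_dvd_pow _ hk).mul_right _
  have h3 : X ^ (k + 1) ∣ X ^ k * e :=
    hp.dvd_of_dvd_mul_left (by simpa using dvd_add h1 h2)
  rw [pow_succ, mul_dvd_mul_iff_left (pow_ne_zero _ Polynomial.X_ne_zero)] at h3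
  rwa [Polynomial.X_dvd_iff, Polynomial.coeff_zero_eq_eval_zero] at h3

end Bordered

section Kernel

variable {R R' : Type*} [CommRing R] [CommRing R'] {r m : ℕ}

/-- A vector in the kernel of `Φ`, depending polynomially on `Φ`. -/
def kerVec (Φ : Matrix (Fin r) (Fin m) R) (E : Matrix (Fin m) (Fin r) R) (p : Fin m → R) :
    Fin m → R :=
  (Φ * E).det • p - E.mulVec ((Φ * E).adjugate.mulVec (Φ.mulVec p))

theorem mulVec_kerVec (Φ : Matrix (Fin r) (Fin m) R) (E : Matrix (Fin m) (Fin r) R)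
    (p : Fin m → R) : Φ.mulVec (kerVec Φ E p) = 0 := by
  rw [kerVec, Matrix.mulVec_sub, Matrix.mulVec_smul, Matrix.mulVec_mulVec, Matrix.mulVec_mulVec,
    Matrix.mul_adjugate, Matrix.smul_mulVec, Matrix.one_mulVec, sub_self]

theorem kerVec_eq_self {Φ : Matrix (Fin r) (Fin m) R} {E : Matrix (Fin m) (Fin r) R}
    {p : Fin m → R} (hE : Φ * E = 1) (hp : Φ.mulVec p = 0) : kerVec Φ E p = p := by
  simp [kerVec, hE, hp]

theorem map_kerVec (φ : R →+* R') (Φ : Matrix (Fin r) (Fin m) R) (E : Matrix (Fin m) (Fin r) R)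
    (p : Fin m → R) (j : Fin m) :
    φ (kerVec Φ E p j) = kerVec (Φ.map φ) (E.map φ) (fun i => φ (p i)) j := by
  have e1 : (Φ.map φ * E.map φ) = φ.mapMatrix (Φ * E) := by
    rw [RingHom.mapMatrix_apply, Matrix.map_mul]
  rw [kerVec, kerVec, e1, ← RingHom.map_det, ← RingHom.map_adjugate]
  simp only [Pi.sub_apply, Pi.smul_apply, smul_eq_mul, map_sub, map_mul]
  rw [RingHom.map_mulVec]
  congr 3
  funext i
  rw [Function.comp_apply, RingHom.map_mulVec]
  congr 1
  funext i
  rw [Function.comp_apply, RingHom.map_mulVec]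
  rfl

end Kernel

section Jets

open Polynomial

variable {m : ℕ}

theorem aeval_first_order (q p : Fin m → ℂ) (γ : Fin m → ℂ[X])
    (hγ : ∀ j, X ^ 2 ∣ γ j - (C (q j) + C (p j) * X)) (h : MvPolynomial (Fin m) ℂ) :
    X ^ 2 ∣ MvPolynomial.aeval γ h -
      (C (MvPolynomial.eval q h) + C (PaperQV.polyDiff h q p) * X) := by
  have hd : ∀ h, PaperQV.polyDiff h q p = ∑ j, MvPolynomial.eval q (MvPolynomial.pderiv j h) * p j := by
    intro h
    simp [PaperQV.polyDiff]
  induction h using MvPolynomial.induction_on with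
  | C a => simp [hd]
  | add g h hg hh =>
    have e : PaperQV.polyDiff (g + h) q p = PaperQV.polyDiff g q p + PaperQV.polyDiff h q p := by
      simp [hd, add_mul, Finset.sum_add_distrib]
    rw [e]
    obtain ⟨r, hr⟩ := hg
    obtain ⟨r', hr'⟩ := hh
    refine ⟨r + r', ?_⟩
    simp only [map_add]
    linear_combination hr + hr'
  | mul_X g j hg =>
    have e : PaperQV.polyDiff (g * MvPolynomial.X j) q p =
        PaperQV.polyDiff g q p * q j + MvPolynomial.eval q g * p j := by
      simp only [hd, Derivation.leibniz, MvPolynomial.pderiv_X, smul_eq_mul, map_add, map_mul,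
        MvPolynomial.eval_X, add_mul, Finset.sum_add_distrib]
      rw [add_comm, Finset.sum_mul]
      congr 1
      · exact Finset.sum_congr rfl fun i _ => by ring
      · rw [Finset.sum_eq_single j (fun i _ hi => by simp [hi.symm]) (by simp)]
        simp
    rw [e]
    obtain ⟨r, hr⟩ := hg
    obtain ⟨r', hr'⟩ := hγ j
    refine ⟨r * γ j + r' * (C (MvPolynomial.eval q g) + C (PaperQV.polyDiff g q p) * X) +
      C (PaperQV.polyDiff g q p) * C (p j), ?_⟩
    simp only [map_add, map_mul, MvPolynomial.aeval_X, MvPolynomial.eval_X]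
    linear_combination hr * γ j +
      hr' * (C (MvPolynomial.eval q g) + C (PaperQV.polyDiff g q p) * X)

theorem aeval_second_order (q : Fin m → ℂ)
    (D : Derivation ℂ (MvPolynomial (Fin m) ℂ) (MvPolynomial (Fin m) ℂ)) (γ : Fin m → ℂ[X])
    (hγ : ∀ j, γ j = C (q j) + C (MvPolynomial.eval q (D (MvPolynomial.X j))) * X +
      C (MvPolynomial.eval q (D (D (MvPolynomial.X j))) / 2) * X ^ 2)
    (h : MvPolynomial (Fin m) ℂ) :
    X ^ 3 ∣ MvPolynomial.aeval γ h - (C (MvPolynomial.eval q h) +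
      C (MvPolynomial.eval q (D h)) * X + C (MvPolynomial.eval q (D (D h)) / 2) * X ^ 2) := by
  induction h using MvPolynomial.induction_on with
  | C a => simp
  | add g h hg hh =>
    obtain ⟨r, hr⟩ := hg
    obtain ⟨r', hr'⟩ := hh
    refine ⟨r + r', ?_⟩
    simp only [map_add, add_div]
    linear_combination hr + hr'
  | mul_X g j hg =>
    obtain ⟨r, hr⟩ := hg
    set q0 := MvPolynomial.eval q g
    set q1 := MvPolynomial.eval q (D g)
    set q2 := MvPolynomial.eval q (D (D g))
    set y0 := q j
    set y1 := MvPolynomial.eval q (D (MvPolynomial.X j))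
    set y2 := MvPolynomial.eval q (D (D (MvPolynomial.X j)))
    have e1 : MvPolynomial.eval q (D (g * MvPolynomial.X j)) = q0 * y1 + y0 * q1 := by
      simp [Derivation.leibniz, q0, q1, y0, y1]
    have e2 : MvPolynomial.eval q (D (D (g * MvPolynomial.X j))) / 2 =
        q0 * (y2 / 2) + q1 * y1 + y0 * (q2 / 2) := by
      simp only [Derivation.leibniz, smul_eq_mul, map_add, map_mul, MvPolynomial.eval_X]
      simp only [q0, q1, q2, y0, y1, y2]
      ring
    rw [e1, e2]
    refine ⟨r * γ j + C q1 * C (y2 / 2) + C (q2 / 2) * C y1 + C (q2 / 2) * C (y2 / 2) * X, ?_⟩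
    simp only [map_add, map_mul, MvPolynomial.aeval_X, MvPolynomial.eval_X]
    rw [hγ j] at *
    linear_combination hr * (C y0 + C y1 * X + C (y2 / 2) * X ^ 2)

end Jets

section Curves

open Polynomial

variable {m : ℕ} {V : Type*} [AddCommGroup V] [Module ℂ V] [FiniteDimensional ℂ V]
  (S : (Fin m → ℂ) →ₗ[ℂ] V →ₗ[ℂ] V →ₗ[ℂ] ℂ)

/-- The value of a quadric with coefficients in a `ℂ`-algebra at a pair of vectors. -/
def formOn {R : Type*} [CommRing R] [Algebra ℂ R] (γ : Fin m → R) (x y : V) : R :=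
  ∑ j, γ j * algebraMap ℂ R (S (Pi.single j 1) x y)

theorem formOn_apply (a : Fin m → ℂ) (x y : V) : formOn S a x y = S a x y := by
  conv_rhs => rw [pi_eq_sum_univ' a]
  simp only [formOn, map_sum, map_smul, LinearMap.sum_apply, LinearMap.smul_apply, smul_eq_mul]
  refine Finset.sum_congr rfl fun j _ => ?_
  congr 4

theorem map_formOn {R R' : Type*} [CommRing R] [Algebra ℂ R] [CommRing R'] [Algebra ℂ R']
    (φ : R →ₐ[ℂ] R') (γ : Fin m → R) (x y : V) :
    φ (formOn S γ x y) = formOn S (fun j => φ (γ j)) x y := by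
  simp [formOn]

/-- A curve of degree two. -/
def parabola (q p g : Fin m → ℂ) (j : Fin m) : ℂ[X] := C (q j) + C (p j) * X + C (g j) * X ^ 2

theorem formOn_parabola (q p g : Fin m → ℂ) (x y : V) :
    formOn S (parabola q p g) x y = C (S q x y) + C (S p x y) * X + C (S g x y) * X ^ 2 := by
  rw [← formOn_apply S q, ← formOn_apply S p, ← formOn_apply S g]
  simp only [formOn, parabola, map_sum, Finset.sum_mul, ← Finset.sum_add_distrib]
  refine Finset.sum_congr rfl fun j _ => ?_
  simp only [map_mul, Algebra.algebraMap_self, RingHom.id_apply, Polynomial.algebraMap_eq]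
  ring

variable {S} {f : ℕ}

theorem border_eq_zero_of_finrank_le {a : Fin m → ℂ}
    (ha : Module.finrank ℂ (LinearMap.range (S a)) ≤ f) (c d : Fin f → V) (x y : V) :
    border (fun x y => S a x y) c d x y = 0 := by
  by_cases h0 : (pairMatrix (fun x y => S a x y) c d).det = 0
  · simp [border, h0]
  have hli : LinearIndependent ℂ fun i => S a (c i) := by
    refine linearIndependent_of_det_ne_zero (fun j => LinearMap.applyₗ (d j)) ?_
    rw [← Matrix.det_transpose]
    exact h0
  have hsp : Submodule.span ℂ (Set.range fun i => S a (c i)) = LinearMap.range (S a) := by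
    refine Submodule.eq_of_le_of_finrank_le (Submodule.span_le.2 ?_) ?_
    · rintro _ ⟨i, rfl⟩
      exact ⟨c i, rfl⟩
    · rw [finrank_span_eq_card hli, Fintype.card_fin]
      exact ha
  obtain ⟨β, hβ⟩ := (Submodule.mem_span_range_iff_exists_fun ℂ).1
    (hsp ▸ LinearMap.mem_range_self (S a) x)
  refine border_eq_zero β (fun y => ?_) y
  rw [← hβ]
  simp

theorem exists_pairMatrix_det_ne_zero {q : Fin m → ℂ}
    (hq : Module.finrank ℂ (LinearMap.range (S q)) = f) :
    ∃ c d : Fin f → V, (pairMatrix (fun x y => S q x y) c d).det ≠ 0 := by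
  let b := (Module.finBasis ℂ (LinearMap.range (S q))).reindex (finCongr hq)
  choose c hc using fun i => (b i).2
  have hli : LinearIndependent ℂ fun i => S q (c i) := by
    simp only [hc]
    exact b.linearIndependent.map' (LinearMap.range (S q)).subtype (by simp)
  obtain ⟨φ, hφ⟩ := exists_det_ne_zero hli
  choose d hd using fun i => (Module.evalEquiv ℂ V).surjective (φ i)
  refine ⟨c, d, ?_⟩
  rw [← Matrix.det_transpose]
  convert hφ using 2
  ext i j
  simp only [Matrix.transpose_apply, pairMatrix, Matrix.of_apply, ← hd]
  rfl

/-- The bordered determinants as polynomials in the coefficients of the quadric. -/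
def borderPoly (S : (Fin m → ℂ) →ₗ[ℂ] V →ₗ[ℂ] V →ₗ[ℂ] ℂ) (c d : Fin f → V) (x y : V) :
    MvPolynomial (Fin m) ℂ :=
  border (formOn S MvPolynomial.X) c d x y

theorem aeval_borderPoly {R : Type*} [CommRing R] [Algebra ℂ R] (γ : Fin m → R) (c d : Fin f → V)
    (x y : V) : MvPolynomial.aeval γ (borderPoly S c d x y) = border (formOn S γ) c d x y := by
  have := map_border (MvPolynomial.aeval γ : MvPolynomial (Fin m) ℂ →ₐ[ℂ] R).toRingHom
    (formOn S MvPolynomial.X) c d x y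
  refine this.trans ?_
  congr 1
  funext x y
  exact (map_formOn S (MvPolynomial.aeval γ) MvPolynomial.X x y).trans (by simp)

theorem eval_borderPoly (a : Fin m → ℂ) (c d : Fin f → V) (x y : V) :
    MvPolynomial.eval a (borderPoly S c d x y) = border (fun x y => S a x y) c d x y := by
  rw [← MvPolynomial.coe_aeval_eq_eval, RingHom.coe_coe, aeval_borderPoly]
  congr 1
  funext x y
  exact formOn_apply S a x y

section Orders

variable {q p g : Fin m → ℂ} (hsymm : ∀ p v w, S p v w = S p w v)
  (hq : Module.finrank ℂ (LinearMap.range (S q)) = f)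
include hsymm hq

theorem apply_eq_zero_of_first_order
    (H : ∀ (c d : Fin f → V) (x y : V), X ^ 2 ∣ border (formOn S (parabola q p g)) c d x y)
    {x y : V} (hx : S q x = 0) (hy : S q y = 0) : S p x y = 0 := by
  obtain ⟨c, d, hcd⟩ := exists_pairMatrix_det_ne_zero hq
  have hxa : ∀ w, S q x w = 0 := fun w => by rw [hx, LinearMap.zero_apply]
  have hya : ∀ w, S q w y = 0 := fun w => by rw [hsymm, hy, LinearMap.zero_apply]
  have e := border_eval (s := formOn S (parabola q p g)) (c := c) (d := d) (x₁ := x) (x₂ := 0)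
    (y₁ := y) (y₂ := 0) (a := 1) (b := 1) (k := 1) (e := C (S p x y) + C (S g x y) * X) ?_ le_rfl
    (H c d) ?_ ?_ ?_
  · simpa using e
  · rw [← Polynomial.coe_evalRingHom, map_det_pairMatrix]
    simpa [formOn_parabola] using hcd
  · exact fun j => ⟨C (S p x (d j)) + C (S g x (d j)) * X, by simp [formOn_parabola, hxa]; ring⟩
  · exact fun i => ⟨C (S p (c i) y) + C (S g (c i) y) * X, by simp [formOn_parabola, hya]; ring⟩
  · simp [formOn_parabola, hxa]
    ring

theorem apply_eq_of_second_order
    (H : ∀ (c d : Fin f → V) (x y : V), X ^ 3 ∣ border (formOn S (parabola q p g)) c d x y)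
    {x v : V} (hx : S q x = 0) (hv : S q v = S p x) : S g x x = S q v v := by
  obtain ⟨c, d, hcd⟩ := exists_pairMatrix_det_ne_zero hq
  have hxa : ∀ w, S q x w = 0 := fun w => by rw [hx, LinearMap.zero_apply]
  have hxb : ∀ w, S q w x = 0 := fun w => by rw [hsymm, hx, LinearMap.zero_apply]
  have hva : ∀ w, S p x w = S q v w := fun w => by rw [hv]
  have hvb : ∀ w, S p w x = S q w v := fun w => by rw [hsymm, hva, hsymm]
  have e := border_eval (s := formOn S (parabola q p g)) (c := c) (d := d) (x₁ := x) (x₂ := v)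
    (y₁ := x) (y₂ := v) (a := 2) (b := 2) (k := 2)
    (e := C (S g x x) - C (S q v v) + (C (S p v v) - C (S g v x) - C (S g x v)) * X +
      C (S g v v) * X ^ 2) ?_ (by norm_num) (H c d) ?_ ?_ ?_
  · simp only [eval_add, eval_sub, eval_mul, eval_C, eval_X, eval_pow, mul_zero, add_zero,
      ne_eq, OfNat.ofNat_ne_zero, not_false_eq_true, zero_pow] at e
    exact sub_eq_zero.1 e
  · rw [← Polynomial.coe_evalRingHom, map_det_pairMatrix]
    simpa [formOn_parabola] using hcd
  · exact fun j => ⟨C (S g x (d j)) - C (S p v (d j)) - C (S g v (d j)) * X, by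
      simp [formOn_parabola, hxa, hva]; ring⟩
  · exact fun i => ⟨C (S g (c i) x) - C (S p (c i) v) - C (S g (c i) v) * X, by
      simp [formOn_parabola, hxb, hvb]; ring⟩
  · simp only [formOn_parabola, hxa, hxb, hva, hvb, map_zero]
    ring

theorem apply_eq_zero_of_line
    (H : ∀ (c d : Fin f → V) (x y : V), border (formOn S (parabola q p 0)) c d x y = 0)
    {x v : V} (hx : S q x = 0) (hv : S q v = S p x) : S q v v = 0 ∧ S p v v = 0 := by
  have h1 : S q v v = 0 := by
    rw [← apply_eq_of_second_order (g := 0) hsymm hq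
      (fun c d x y => by rw [H]; exact dvd_zero _) hx hv]
    simp
  refine ⟨h1, ?_⟩
  obtain ⟨c, d, hcd⟩ := exists_pairMatrix_det_ne_zero hq
  have hxa : ∀ w, S q x w = 0 := fun w => by rw [hx, LinearMap.zero_apply]
  have hxb : ∀ w, S q w x = 0 := fun w => by rw [hsymm, hx, LinearMap.zero_apply]
  have hva : ∀ w, S p x w = S q v w := fun w => by rw [hv]
  have hvb : ∀ w, S p w x = S q w v := fun w => by rw [hsymm, hva, hsymm]
  have e := border_eval (s := formOn S (parabola q p 0)) (c := c) (d := d) (x₁ := x) (x₂ := v)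
    (y₁ := x) (y₂ := v) (a := 2) (b := 2) (k := 3)
    (e := C (S p v v)) ?_ le_rfl (fun x y => by rw [H]; exact dvd_zero _) ?_ ?_ ?_
  · simpa using e
  · rw [← Polynomial.coe_evalRingHom, map_det_pairMatrix]
    simpa [formOn_parabola] using hcd
  · exact fun j => ⟨- C (S p v (d j)), by
      simp [formOn_parabola, hxa, hva]; ring⟩
  · exact fun i => ⟨- C (S p (c i) v), by
      simp [formOn_parabola, hxb, hvb]; ring⟩
  · simp only [formOn_parabola, hxa, hxb, hva, hvb, h1, map_zero, LinearMap.zero_apply]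
    ring

end Orders

end Curves

section Tangent

open Polynomial

variable {m : ℕ}

/-- The polynomials vanishing on a set. -/
def vanSub (D : Set (Fin m → ℂ)) : Submodule ℂ (MvPolynomial (Fin m) ℂ) where
  carrier := {h | ∀ a ∈ D, MvPolynomial.eval a h = 0}
  add_mem' := fun hg hh a ha => by rw [map_add, hg a ha, hh a ha, add_zero]
  zero_mem' := fun a _ => map_zero _
  smul_mem' := fun c h hh a ha => by rw [MvPolynomial.smul_eval, hh a ha, mul_zero]

theorem polyDiff_apply (h : MvPolynomial (Fin m) ℂ) (a p : Fin m → ℂ) :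
    PaperQV.polyDiff h a p = ∑ j, MvPolynomial.eval a (MvPolynomial.pderiv j h) * p j := by
  simp [PaperQV.polyDiff]

/-- The differential at a point as a function of the polynomial. -/
def diffMap (a : Fin m → ℂ) : MvPolynomial (Fin m) ℂ →ₗ[ℂ] (Fin m → ℂ) →ₗ[ℂ] ℂ where
  toFun h := PaperQV.polyDiff h a
  map_add' g h := by
    refine LinearMap.ext fun p => ?_
    simp [polyDiff_apply, add_mul, Finset.sum_add_distrib]
  map_smul' c h := by
    refine LinearMap.ext fun p => ?_
    simp only [polyDiff_apply, LinearMap.smul_apply, smul_eq_mul, Finset.mul_sum,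
      Derivation.map_smul, MvPolynomial.smul_eval, RingHom.id_apply, mul_assoc]

/-- The conormal space. -/
def conormal (D : Set (Fin m → ℂ)) (a : Fin m → ℂ) : Submodule ℂ ((Fin m → ℂ) →ₗ[ℂ] ℂ) :=
  (vanSub D).map (diffMap a)

/-- The Zariski tangent space. -/
def zariskiTangent (D : Set (Fin m → ℂ)) (a : Fin m → ℂ) : Submodule ℂ (Fin m → ℂ) :=
  ⨅ h ∈ vanSub D, LinearMap.ker (PaperQV.polyDiff h a)

theorem mem_zariskiTangent {D : Set (Fin m → ℂ)} {a p : Fin m → ℂ} :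
    p ∈ zariskiTangent D a ↔ ∀ h ∈ vanSub D, PaperQV.polyDiff h a p = 0 := by
  simp [zariskiTangent, Submodule.mem_iInf]

/-- A tangent vector at a point of minimal tangent dimension is the velocity of an arc that
annihilates the vanishing ideal to third order. -/
theorem exists_parabola {D : Set (Fin m → ℂ)} {q : Fin m → ℂ} (hq : q ∈ D)
    (hmax : ∀ a ∈ D, Module.finrank ℂ (conormal D a) ≤ Module.finrank ℂ (conormal D q))
    {p : Fin m → ℂ} (hp : p ∈ zariskiTangent D q) :
    ∃ g, ∀ h ∈ vanSub D, X ^ 3 ∣ MvPolynomial.aeval (parabola q p g) h := by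
  let b := Module.finBasis ℂ (conormal D q)
  choose h hhI hh using fun i => (Submodule.mem_map.1 (b i).2)
  have hh' : ∀ i, PaperQV.polyDiff (h i) q = b i := hh
  have hli : LinearIndependent ℂ fun i => PaperQV.polyDiff (h i) q := by
    simp only [hh']
    exact b.linearIndependent.map' (conormal D q).subtype (by simp)
  obtain ⟨φ, hφ⟩ := exists_dual_of_linearIndependent hli
  choose e he using fun i => (Module.evalEquiv ℂ (Fin m → ℂ)).surjective (φ i)
  have he' : ∀ k i, PaperQV.polyDiff (h k) q (e i) = if i = k then 1 else 0 := by
    intro k i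
    rw [← hφ i k, ← he i]
    rfl
  let Φ : Matrix (Fin (Module.finrank ℂ (conormal D q))) (Fin m) (MvPolynomial (Fin m) ℂ) :=
    Matrix.of fun i j => MvPolynomial.pderiv j (h i)
  let E : Matrix (Fin m) (Fin (Module.finrank ℂ (conormal D q))) (MvPolynomial (Fin m) ℂ) :=
    Matrix.of fun j i => MvPolynomial.C (e i j)
  let J := (Φ * E).det
  let ξ := kerVec Φ E fun j => MvPolynomial.C (p j)
  have hΦE : ∀ a : Fin m → ℂ, Φ.map (MvPolynomial.eval a) * E.map (MvPolynomial.eval a) =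
      Matrix.of fun k i => PaperQV.polyDiff (h k) a (e i) := by
    intro a
    ext k i
    simp [Matrix.mul_apply, Φ, E, polyDiff_apply]
  have hJ : ∀ a, MvPolynomial.eval a J =
      (Matrix.of fun k i => PaperQV.polyDiff (h k) a (e i)).det := by
    intro a
    rw [← hΦE, RingHom.map_det, RingHom.mapMatrix_apply, Matrix.map_mul]
  have hone : (Matrix.of fun k i => PaperQV.polyDiff (h k) q (e i)) = 1 := by
    ext k i
    simp [he', Matrix.one_apply, eq_comm]
  have hJq : MvPolynomial.eval q J = 1 := by rw [hJ, hone, Matrix.det_one]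
  have hξq : ∀ j, MvPolynomial.eval q (ξ j) = p j := by
    intro j
    simp only [ξ]
    rw [map_kerVec, kerVec_eq_self ((hΦE q).trans hone)]
    · simp
    · funext i
      have := mem_zariskiTangent.1 hp (h i) (hhI i)
      rw [polyDiff_apply] at this
      simpa [Matrix.mulVec, dotProduct, Φ] using this
  have hξ : ∀ a i, PaperQV.polyDiff (h i) a (fun j => MvPolynomial.eval a (ξ j)) = 0 := by
    intro a i
    have := congrArg (fun v => MvPolynomial.eval a (v i))
      (mulVec_kerVec Φ E fun j => MvPolynomial.C (p j))
    rw [polyDiff_apply]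
    simpa [Matrix.mulVec, dotProduct, Φ] using this
  have htan : ∀ a ∈ D, MvPolynomial.eval a J ≠ 0 → ∀ g ∈ vanSub D,
      PaperQV.polyDiff g a (fun j => MvPolynomial.eval a (ξ j)) = 0 := by
    intro a ha hJa g hg
    have hlia : LinearIndependent ℂ fun i => PaperQV.polyDiff (h i) a := by
      refine linearIndependent_of_det_ne_zero (fun i => LinearMap.applyₗ (e i)) ?_
      rw [← Matrix.det_transpose]
      rwa [hJ] at hJa
    have hsp : Submodule.span ℂ (Set.range fun i => PaperQV.polyDiff (h i) a) = conormal D a := by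
      refine Submodule.eq_of_le_of_finrank_le (Submodule.span_le.2 ?_) ?_
      · rintro _ ⟨i, rfl⟩
        exact Submodule.mem_map_of_mem (hhI i)
      · rw [finrank_span_eq_card hlia, Fintype.card_fin]
        exact hmax a ha
    have hmem : PaperQV.polyDiff g a ∈ conormal D a := Submodule.mem_map_of_mem (f := diffMap a) hg
    rw [← hsp] at hmem
    obtain ⟨β, hβ⟩ := (Submodule.mem_span_range_iff_exists_fun ℂ).1 hmem
    rw [← hβ]
    simp [hξ]
  let Δ : Derivation ℂ (MvPolynomial (Fin m) ℂ) (MvPolynomial (Fin m) ℂ) :=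
    ∑ j, (J * ξ j) • MvPolynomial.pderiv j
  have hΔ : ∀ g a, MvPolynomial.eval a (Δ g) = MvPolynomial.eval a J *
      PaperQV.polyDiff g a (fun j => MvPolynomial.eval a (ξ j)) := by
    intro g a
    have e1 : Δ g = ∑ j, (J * ξ j) * MvPolynomial.pderiv j g := by
      have := congrFun (map_sum Derivation.coeFnAddMonoidHom
        (fun j => (J * ξ j) • MvPolynomial.pderiv (R := ℂ) j) Finset.univ) g
      rw [Finset.sum_apply] at this
      exact this
    rw [e1, polyDiff_apply, map_sum, Finset.mul_sum]
    refine Finset.sum_congr rfl fun j _ => ?_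
    simp only [map_mul]
    ring
  have hΔI : ∀ g ∈ vanSub D, Δ g ∈ vanSub D := by
    intro g hg a ha
    rw [hΔ]
    by_cases hJa : MvPolynomial.eval a J = 0
    · rw [hJa, zero_mul]
    · rw [htan a ha hJa g hg, mul_zero]
  have hΔX : ∀ j, MvPolynomial.eval q (Δ (MvPolynomial.X j)) = p j := by
    intro j
    rw [hΔ, hJq, one_mul, polyDiff_apply,
      Finset.sum_eq_single j (fun i _ hi => by simp [MvPolynomial.pderiv_X, hi.symm]) (by simp)]
    simp [hξq]
  refine ⟨fun j => MvPolynomial.eval q (Δ (Δ (MvPolynomial.X j))) / 2, fun g hg => ?_⟩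
  have := aeval_second_order q Δ (parabola q p _) (fun j => by rw [hΔX]; rfl) g
  rw [hg q hq, hΔI g hg q hq, hΔI _ (hΔI g hg) q hq] at this
  simpa using this

/-- A polynomial vanishes if all its derivatives at a point vanish. -/
theorem vanSub_eq_bot {D : Set (Fin m → ℂ)} {q : Fin m → ℂ} (hq : q ∈ D)
    (hmax : ∀ a ∈ D, Module.finrank ℂ (conormal D a) ≤ Module.finrank ℂ (conormal D q))
    (htop : zariskiTangent D q = ⊤) {h : MvPolynomial (Fin m) ℂ} (hh : h ∈ vanSub D) : h = 0 := by
  have h0 : conormal D q = ⊥ := by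
    rw [eq_bot_iff]
    rintro _ ⟨g, hg, rfl⟩
    refine LinearMap.ext fun p => ?_
    exact mem_zariskiTangent.1 (htop ▸ Submodule.mem_top : p ∈ zariskiTangent D q) g hg
  have hder : ∀ g ∈ vanSub D, ∀ j, MvPolynomial.pderiv j g ∈ vanSub D := by
    intro g hg j a ha
    have h1 : conormal D a = ⊥ := by
      rw [← Submodule.finrank_eq_zero (R := ℂ)]
      have := hmax a ha
      rw [h0, finrank_bot] at this
      omega
    have h2 : PaperQV.polyDiff g a = 0 := by
      rw [← Submodule.mem_bot ℂ, ← h1]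
      exact Submodule.mem_map_of_mem (f := diffMap a) hg
    have h3 := LinearMap.congr_fun h2 (Pi.single j 1)
    rw [polyDiff_apply, Finset.sum_eq_single j (fun i _ hi => by simp [hi]) (by simp)] at h3
    simpa using h3
  by_contra hne
  have key : ∀ n, ∀ g ∈ vanSub D, g ≠ 0 → g.totalDegree = n → False := by
    intro n
    induction n using Nat.strong_induction_on with
    | _ n ih =>
      intro g hg hg0 hn
      by_cases hall : ∀ j, MvPolynomial.pderiv j g = 0
      · obtain ⟨c, rfl⟩ : ∃ c, g = MvPolynomial.C c := by
          refine ⟨MvPolynomial.coeff 0 g, MvPolynomial.ext _ _ fun d => ?_⟩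
          rw [MvPolynomial.coeff_C]
          split_ifs with hd
          · rw [hd]
          · obtain ⟨j, hj⟩ : ∃ j, d j ≠ 0 := by
              by_contra hcon
              push Not at hcon
              exact hd (Finsupp.ext fun j => by simp [hcon j])
            have h1 := congrArg (MvPolynomial.coeff (d - Finsupp.single j 1)) (hall j)
            rw [MvPolynomial.coeff_pderiv, MvPolynomial.coeff_zero,
              tsub_add_cancel_of_le (by simpa [Nat.one_le_iff_ne_zero] using hj)] at h1
            exact (mul_eq_zero.1 h1).resolve_right (Nat.cast_add_one_ne_zero _)
        have := hg q hq
        rw [MvPolynomial.eval_C] at this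
        exact hg0 (by rw [this, map_zero])
      · push Not at hall
        obtain ⟨j, hj⟩ := hall
        refine ih _ ?_ _ (hder g hg j) hj rfl
        rw [← hn, MvPolynomial.totalDegree, Finset.sup_lt_iff]
        · intro d hd
          rw [MvPolynomial.mem_support_iff, MvPolynomial.coeff_pderiv] at hd
          have h1 := MvPolynomial.le_totalDegree
            (MvPolynomial.mem_support_iff.2 (left_ne_zero_of_mul hd))
          rw [Finsupp.sum_add_index' (fun _ => rfl) (fun _ _ _ => rfl),
            Finsupp.sum_single_index rfl] at h1
          omega
        · rw [bot_eq_zero, Nat.pos_iff_ne_zero]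
          intro h0
          rw [MvPolynomial.totalDegree_eq_zero_iff_eq_C] at h0
          rw [h0, MvPolynomial.pderiv_C] at hj
          exact hj rfl
  exact key _ h hh hne rfl

end Tangent

namespace PolyFun

variable {E : Type*} [AddCommGroup E] [Module ℂ E] {m r : ℕ}

theorem eval {κ : E → Fin m → ℂ} (hκ : ∀ j, PolyFun fun v => κ v j)
    (h : MvPolynomial (Fin m) ℂ) : PolyFun fun v => MvPolynomial.eval (κ v) h := by
  induction h using MvPolynomial.induction_on with
  | C a => simpa using const (E := E) a
  | add g h hg hh => simpa using hg.add hh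
  | mul_X g j hg => simpa using hg.mul (hκ j)

theorem adjugate {M : E → Matrix (Fin r) (Fin r) ℂ} (hM : ∀ i j, PolyFun fun v => M v i j)
    (i j : Fin r) : PolyFun fun v => (M v).adjugate i j := by
  simp only [Matrix.adjugate_apply]
  refine det fun k l => ?_
  simp only [Matrix.updateRow_apply]
  split_ifs
  · exact const _
  · exact hM k l

theorem kerVec {Φ : E → Matrix (Fin r) (Fin m) ℂ} (hΦ : ∀ i j, PolyFun fun v => Φ v i j)
    (A : Matrix (Fin m) (Fin r) ℂ) (p : Fin m → ℂ) (j : Fin m) :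
    PolyFun fun v => kerVec (Φ v) A p j := by
  have hM : ∀ i k, PolyFun fun v => (Φ v * A) i k := fun i k => by
    simp only [Matrix.mul_apply]
    exact sum fun l _ => (hΦ i l).mul (const _)
  simp only [_root_.kerVec, Pi.sub_apply, Pi.smul_apply, smul_eq_mul, Matrix.mulVec, dotProduct]
  exact ((det hM).mul (const _)).sub (sum fun i _ => (const _).mul
    (sum fun k _ => (adjugate hM i k).mul (sum fun l _ => (hΦ k l).mul (const _))))

end PolyFun

open Polynomial in
theorem polyDiff_eq_zero_of_curve {m : ℕ} {q p : Fin m → ℂ} {γ : Fin m → ℂ[X]}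
    (h0 : ∀ j, (γ j).eval 0 = q j) (h1 : ∀ j, (derivative (γ j)).eval 0 = p j)
    {h : MvPolynomial (Fin m) ℂ} (hq : MvPolynomial.eval q h = 0) {u : ℂ[X]} (hu : u.eval 0 ≠ 0)
    (hd : (derivative (MvPolynomial.aeval γ h * u)).eval 0 = 0) :
    PaperQV.polyDiff h q p = 0 := by
  obtain ⟨r, hr⟩ := aeval_first_order q p γ (fun j => by
    rw [X_pow_dvd_iff]
    intro d hd
    interval_cases d
    · simp [← h0, coeff_zero_eq_eval_zero]
    · have e1 := coeff_derivative (γ j) 0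
      rw [coeff_zero_eq_eval_zero, h1] at e1
      simpa using sub_eq_zero.2 e1.symm) h
  have e : MvPolynomial.aeval γ h = C (PaperQV.polyDiff h q p) * X + X ^ 2 * r := by
    rw [hq] at hr
    linear_combination hr + (map_zero C : (C (0 : ℂ) : ℂ[X]) = 0)
  rw [e] at hd
  simpa [hu] using hd

section Extremal

open Polynomial

variable {m : ℕ} {V : Type*} [AddCommGroup V] [Module ℂ V] [FiniteDimensional ℂ V]

/-- The quadrics of a given rank that are singular at a point of the cone. -/
def singLocus (S : (Fin m → ℂ) →ₗ[ℂ] V →ₗ[ℂ] V →ₗ[ℂ] ℂ) (f : ℕ) : Set (Fin m → ℂ) :=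
  {a | (∃ z, z ≠ 0 ∧ OnCone S z ∧ S a z = 0) ∧ Module.finrank ℂ (LinearMap.range (S a)) = f}

namespace QuadricCone

variable {S : (Fin m → ℂ) →ₗ[ℂ] V →ₗ[ℂ] V →ₗ[ℂ] ℂ} (h : QuadricCone S) {f : ℕ}

section

variable (hf : ∀ a z, z ≠ 0 → OnCone S z → S a z = 0 →
  Module.finrank ℂ (LinearMap.range (S a)) ≤ f) {q : Fin m → ℂ} (hq : q ∈ singLocus S f)
include hf hq

/-- A polynomial whose nonvanishing forces maximal rank. -/
theorem exists_rank_poly : ∃ R : MvPolynomial (Fin m) ℂ, MvPolynomial.eval q R ≠ 0 ∧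
    ∀ a z, z ≠ 0 → OnCone S z → S a z = 0 → MvPolynomial.eval a R ≠ 0 → a ∈ singLocus S f := by
  obtain ⟨F, hF, hFq, hFr⟩ := exists_polyFun_rank S q hq.2.ge
  obtain ⟨R, hR⟩ := hF m LinearMap.id
  refine ⟨R, by rwa [← hR], fun a z hz0 hz haz ha => ⟨⟨z, hz0, hz, haz⟩, ?_⟩⟩
  rw [← hR] at ha
  exact (hf a z hz0 hz haz).antisymm (hFr a ha)

theorem stab_le_tangent {z : V} (hz0 : z ≠ 0) (hz : OnCone S z) (hqz : S q z = 0) :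
    stab S z ≤ zariskiTangent (singLocus S f) q := by
  intro p hp
  have hpz : S p z = 0 := hp
  obtain ⟨R, hRq, hR⟩ := exists_rank_poly hf hq
  refine mem_zariskiTangent.2 fun g hg => ?_
  let γ : Fin m → ℂ[X] := fun j => C (q j) + C (p j) * X
  have hγ : ∀ (t : ℂ) k, (MvPolynomial.aeval γ k).eval t = MvPolynomial.eval (q + t • p) k := by
    intro t k
    rw [← Polynomial.coe_aeval_eq_eval, ← MvPolynomial.coe_aeval_eq_eval]
    have : (Polynomial.aeval t).comp (MvPolynomial.aeval γ) =
        (MvPolynomial.aeval (q + t • p) : MvPolynomial (Fin m) ℂ →ₐ[ℂ] ℂ) := by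
      ext j
      simp [γ]
      ring
    exact AlgHom.congr_fun this k
  refine polyDiff_eq_zero_of_curve (γ := γ) (u := MvPolynomial.aeval γ R) (by simp [γ])
    (by simp [γ]) (hg q hq) (by simpa [hγ] using hRq) ?_
  have : MvPolynomial.aeval γ g * MvPolynomial.aeval γ R = 0 := by
    refine Polynomial.funext fun t => ?_
    rw [eval_mul, hγ, hγ, eval_zero]
    by_cases h0 : MvPolynomial.eval (q + t • p) R = 0
    · rw [h0, mul_zero]
    · rw [hg _ (hR _ z hz0 hz (by simp [hqz, hpz]) h0), zero_mul]
  simp [this]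

include h

theorem exists_lift {z : V} (hz0 : z ≠ 0) (hz : OnCone S z) (hqz : S q z = 0) {v : V}
    (hv : ∀ p, S p z v = 0) : ∃ p ∈ zariskiTangent (singLocus S f) q, S p z = S q v := by
  obtain ⟨R, hRq, hR⟩ := exists_rank_poly hf hq
  let b := (Module.finBasis ℂ (orb S z)).reindex (finCongr (h.rank z hz0 hz))
  choose e he using fun i => (b i).2
  have he' : ∀ i, S (e i) z = b i := he
  have hli : LinearIndependent ℂ fun i => S (e i) z := by
    simp only [he']
    exact b.linearIndependent.map' (orb S z).subtype (by simp)
  obtain ⟨φ, hφ⟩ := exists_dual_of_linearIndependent hli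
  choose w hw using fun i => (Module.evalEquiv ℂ V).surjective (φ i)
  have hew : ∀ i j, S (e j) z (w i) = if i = j then 1 else 0 := by
    intro i j
    rw [← hφ i j, ← hw i]
    rfl
  let A : Matrix (Fin m) (Fin 4) ℂ := Matrix.of fun j i => e i j
  let Φ : V → Matrix (Fin 4) (Fin m) ℂ := fun y => Matrix.of fun i j => S (Pi.single j 1) y (w i)
  have hΦv : ∀ y a i, (Φ y).mulVec a i = S a y (w i) := by
    intro y a i
    rw [← formOn_apply]
    simp [Φ, Matrix.mulVec, dotProduct, formOn, mul_comm]
  have hΦA : ∀ y i j, (Φ y * A) i j = S (e j) y (w i) := fun y i j => hΦv y (e j) i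
  let κ : V → Fin m → ℂ := fun y => kerVec (Φ y) A q
  let Δ : V → ℂ := fun y => (Φ y * A).det
  have hΦpf : ∀ i j, PolyFun fun y => Φ y i j := fun i j =>
    PolyFun.linear ((S (Pi.single j 1)).flip (w i))
  have hκpf : ∀ j, PolyFun fun y => κ y j := fun j => PolyFun.kerVec hΦpf A q j
  have hΔpf : PolyFun Δ := PolyFun.det fun i j => by
    simp only [hΦA]
    exact PolyFun.linear ((S (e j)).flip (w i))
  have hone : Φ z * A = 1 := by
    ext i j
    rw [hΦA, hew, Matrix.one_apply]
  have hκz : κ z = q := kerVec_eq_self hone (funext fun i => by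
    rw [hΦv, hqz, LinearMap.zero_apply, Pi.zero_apply])
  have hκ : ∀ y, OnCone S y → Δ y ≠ 0 → y ≠ 0 ∧ S (κ y) y = 0 := by
    intro y hy hΔ
    have hy0 : y ≠ 0 := by
      rintro rfl
      apply hΔ
      have : Φ 0 * A = 0 := by
        ext i j
        rw [hΦA]
        simp
      simp [Δ, this, Matrix.det_zero]
    refine ⟨hy0, ?_⟩
    have hli' : LinearIndependent ℂ fun i => S (e i) y := by
      refine linearIndependent_of_det_ne_zero (fun i => LinearMap.applyₗ (w i)) ?_
      convert hΔ using 2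
      ext i j
      rw [hΦA]
      rfl
    have hsp : Submodule.span ℂ (Set.range fun i => S (e i) y) = orb S y := by
      refine Submodule.eq_of_le_of_finrank_le (Submodule.span_le.2 ?_) ?_
      · rintro _ ⟨i, rfl⟩
        exact orb_mem _ _
      · rw [finrank_span_eq_card hli', Fintype.card_fin, h.rank y hy0 hy]
    have hmem : S (κ y) y ∈ orb S y := orb_mem _ _
    rw [← hsp] at hmem
    obtain ⟨β, hβ⟩ := (Submodule.mem_span_range_iff_exists_fun ℂ).1 hmem
    have hβ0 : (Φ y * A).mulVec β = 0 := by
      funext i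
      have e1 : S (κ y) y (w i) = 0 := by
        rw [← hΦv, mulVec_kerVec]
        rfl
      rw [← hβ] at e1
      simpa [Matrix.mulVec, dotProduct, hΦA, mul_comm] using e1
    have : β = 0 := by
      by_contra hne
      exact hΔ (Matrix.exists_mulVec_eq_zero_iff.1 ⟨β, hne, hβ0⟩)
    rw [← hβ, this]
    simp
  let Φp : Matrix (Fin 4) (Fin m) ℂ[X] := Matrix.of fun i j =>
    C (S (Pi.single j 1) z (w i)) + X * C (S (Pi.single j 1) v (w i))
  let Ap : Matrix (Fin m) (Fin 4) ℂ[X] := A.map C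
  let κp : Fin m → ℂ[X] := kerVec Φp Ap fun j => C (q j)
  let Δp : ℂ[X] := (Φp * Ap).det
  have hΦp : ∀ t, Φp.map (evalRingHom t) = Φ (z + t • v) := by
    intro t
    ext i j
    simp [Φp, Φ]
    ring
  have hAp : ∀ t, Ap.map (evalRingHom t) = A := by
    intro t
    ext i j
    simp [Ap]
  have hκp : ∀ t, (fun j => (κp j).eval t) = κ (z + t • v) := by
    intro t
    funext j
    rw [← coe_evalRingHom]
    simp only [κp, κ]
    rw [map_kerVec, hΦp, hAp]
    simp
  have hΔp : ∀ t, Δp.eval t = Δ (z + t • v) := by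
    intro t
    simp only [Δp, Δ]
    rw [← coe_evalRingHom, RingHom.map_det, RingHom.mapMatrix_apply, Matrix.map_mul, hΦp, hAp]
  have hev : ∀ t k, (MvPolynomial.aeval κp k).eval t = MvPolynomial.eval (κ (z + t • v)) k := by
    intro t k
    rw [← hκp, ← Polynomial.coe_aeval_eq_eval, ← MvPolynomial.coe_aeval_eq_eval]
    have : (Polynomial.aeval t).comp (MvPolynomial.aeval κp) =
        (MvPolynomial.aeval fun j => (κp j).eval t : MvPolynomial (Fin m) ℂ →ₐ[ℂ] ℂ) := by
      ext j
      simp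
    exact AlgHom.congr_fun this k
  have hκp0 : ∀ j, (κp j).eval 0 = q j := by
    intro j
    have := congrFun (hκp 0) j
    rwa [zero_smul, add_zero, hκz] at this
  have hΔ0 : Δp.eval 0 = 1 := by
    rw [hΔp, zero_smul, add_zero]
    simp only [Δ]
    rw [hone, Matrix.det_one]
  let p : Fin m → ℂ := fun j => (derivative (κp j)).eval 0
  refine ⟨-p, Submodule.neg_mem _ (mem_zariskiTangent.2 fun g hg => ?_), ?_⟩
  · refine polyDiff_eq_zero_of_curve (γ := κp) (u := Δp * MvPolynomial.aeval κp R) hκp0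
      (fun j => rfl) (hg q hq) ?_ ?_
    · rw [eval_mul, hΔ0, hev, zero_smul, add_zero, hκz, one_mul]
      exact hRq
    · refine h.tangent (fun y => MvPolynomial.eval (κ y) g * (Δ y * MvPolynomial.eval (κ y) R))
        ((PolyFun.eval hκpf g).mul (hΔpf.mul (PolyFun.eval hκpf R))) ?_ z hz0 hz v hv _ ?_
      · intro y hy
        by_cases hΔ : Δ y = 0
        · rw [hΔ, zero_mul, mul_zero]
        by_cases hRy : MvPolynomial.eval (κ y) R = 0
        · rw [hRy, mul_zero, mul_zero]
        · obtain ⟨hy0, hky⟩ := hκ y hy hΔ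
          rw [hg _ (hR _ y hy0 hy hky hRy), zero_mul]
      · intro t
        rw [eval_mul, eval_mul, hev, hev, hΔp]
  · refine LinearMap.ext fun x => ?_
    have key := h.tangent (fun y => Δ y * ∑ j, κ y j * S (Pi.single j 1) y x)
      (hΔpf.mul (PolyFun.sum fun j _ => (hκpf j).mul
        (PolyFun.linear ((S (Pi.single j 1)).flip x)))) ?_ z hz0 hz v hv
      (Δp * ∑ j, κp j * (C (S (Pi.single j 1) z x) + X * C (S (Pi.single j 1) v x))) ?_
    · have e1 : ∑ j, p j * S (Pi.single j 1) z x = S p z x := formOn_apply S p z x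
      have e2 : ∑ j, q j * S (Pi.single j 1) v x = S q v x := formOn_apply S q v x
      have e3 : ∑ j, q j * S (Pi.single j 1) z x = 0 := by
        rw [show ∑ j, q j * S (Pi.single j 1) z x = S q z x from formOn_apply S q z x, hqz,
          LinearMap.zero_apply]
      have e4 : S p z x + S q v x = 0 := by
        rw [← e1, ← e2, ← Finset.sum_add_distrib]
        simpa [derivative_mul, eval_finsetSum, hκp0, hΔ0, e3, p] using key
      rw [map_neg, LinearMap.neg_apply, LinearMap.neg_apply]
      linear_combination -e4
    · intro y hy
      by_cases hΔ : Δ y = 0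
      · rw [hΔ, zero_mul]
      · rw [show ∑ j, κ y j * S (Pi.single j 1) y x = S (κ y) y x from formOn_apply S (κ y) y x,
          (hκ y hy hΔ).2, LinearMap.zero_apply, mul_zero]
    · intro t
      rw [eval_mul, hΔp, eval_finsetSum, ← hκp]
      simp
      left
      exact Finset.sum_congr rfl fun j _ => by ring

end

include h in
theorem exists_onCone : ∃ z : V, z ≠ 0 ∧ OnCone S z := by
  by_contra! hcon
  have hφ : ∀ φ : V →ₗ[ℂ] ℂ, φ = 0 := fun φ => h.nondeg φ fun v hv => by
    rw [show v = 0 from by_contra fun h0 => hcon v h0 hv, map_zero]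
  have : Nontrivial V := Module.nontrivial_of_finrank_pos (R := ℂ) (by rw [h.dimV]; norm_num)
  obtain ⟨v, hv⟩ := exists_ne (0 : V)
  exact hv ((Module.forall_dual_apply_eq_zero_iff ℂ v).1 fun φ => by
    rw [hφ φ, LinearMap.zero_apply])

include h in
theorem exists_extremal : ∃ q T, Extremal S q T := by
  obtain ⟨z₀, hz₀0, hz₀⟩ := h.exists_onCone
  let s : Set ℕ := {n | ∃ a z, z ≠ 0 ∧ OnCone S z ∧ S a z = 0 ∧
    Module.finrank ℂ (LinearMap.range (S a)) = n}
  have hsb : BddAbove s := by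
    refine ⟨Module.finrank ℂ (V →ₗ[ℂ] ℂ), ?_⟩
    rintro _ ⟨a, z, -, -, -, rfl⟩
    exact Submodule.finrank_le _
  obtain ⟨q₀, z₁, hz₁0, hz₁, hq₀, hfq₀⟩ := Nat.sSup_mem (s := s)
    ⟨_, 0, z₀, hz₀0, hz₀, by simp, rfl⟩ hsb
  set f := sSup s with hfdef
  have hf : ∀ a z, z ≠ 0 → OnCone S z → S a z = 0 →
      Module.finrank ℂ (LinearMap.range (S a)) ≤ f :=
    fun a z hz0 hz ha => le_csSup hsb ⟨a, z, hz0, hz, ha, rfl⟩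
  have hfpos : 0 < f := by
    have h1 := h.finrank_stab_add hz₀0 hz₀
    have h2 := h.dimA
    have : Nontrivial (stab S z₀) := Module.nontrivial_of_finrank_pos (R := ℂ) (by omega)
    obtain ⟨⟨a, ha⟩, ha0⟩ := exists_ne (0 : stab S z₀)
    refine lt_of_lt_of_le (Nat.pos_iff_ne_zero.2 fun h0 => ?_) (hf a z₀ hz₀0 hz₀ ha)
    rw [Submodule.finrank_eq_zero, LinearMap.range_eq_bot] at h0
    exact ha0 (Subtype.ext (h.inj a h0))
  let D := singLocus S f
  let s' : Set ℕ := (fun a => Module.finrank ℂ (conormal D a)) '' D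
  have hsb' : BddAbove s' := by
    refine ⟨Module.finrank ℂ ((Fin m → ℂ) →ₗ[ℂ] ℂ), ?_⟩
    rintro _ ⟨a, -, rfl⟩
    exact Submodule.finrank_le _
  obtain ⟨q, hq, hqs⟩ := Nat.sSup_mem (s := s') ⟨_, q₀, ⟨⟨z₁, hz₁0, hz₁, hq₀⟩, hfq₀⟩, rfl⟩ hsb'
  have hmax : ∀ a ∈ D, Module.finrank ℂ (conormal D a) ≤ Module.finrank ℂ (conormal D q) := by
    intro a ha
    refine (le_csSup hsb' ⟨a, ha, rfl⟩).trans hqs.ge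
  have hD : ∀ (c d : Fin f → V) (x y : V), borderPoly S c d x y ∈ vanSub D := by
    rintro c d x y a ⟨-, ha⟩
    rw [eval_borderPoly]
    exact border_eq_zero_of_finrank_le ha.le c d x y
  have hpar : ∀ p ∈ zariskiTangent D q, ∃ g, ∀ (c d : Fin f → V) (x y : V),
      X ^ 3 ∣ border (formOn S (parabola q p g)) c d x y := by
    intro p hp
    obtain ⟨g, hg⟩ := exists_parabola hq hmax hp
    refine ⟨g, fun c d x y => ?_⟩
    rw [← aeval_borderPoly]
    exact hg _ (hD c d x y)
  have hq0 : q ≠ 0 := by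
    rintro rfl
    have := hq.2
    rw [map_zero, LinearMap.range_zero, finrank_bot] at this
    omega
  refine ⟨q, zariskiTangent D q, { h with
    ne := hq0
    sing := hq.1
    first := fun p hp x y hx hy => ?_
    second := fun p hp => ?_
    kernel := fun z hz0 hz hqz => stab_le_tangent hf hq hz0 hz hqz
    lift := fun z hz0 hz hqz v hv => h.exists_lift hf hq hz0 hz hqz hv
    line := fun z hz0 hz hqz p hpz x v hx hv => ?_
    full := fun hT p x v hx hv => ?_ }⟩
  · obtain ⟨g, hg⟩ := hpar p hp
    exact apply_eq_zero_of_first_order h.symm hq.2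
      (fun c d x y => (pow_dvd_pow X (by norm_num)).trans (hg c d x y)) hx hy
  · obtain ⟨g, hg⟩ := hpar p hp
    exact ⟨g, fun x v hx hv => apply_eq_of_second_order h.symm hq.2 hg hx hv⟩
  · refine apply_eq_zero_of_line h.symm hq.2 (fun c d x y => ?_) hx hv
    refine Polynomial.funext fun t => ?_
    rw [← coe_evalRingHom, map_border, map_zero]
    have e : (fun x y => (evalRingHom t) (formOn S (parabola q p 0) x y)) =
        fun x y => S (q + t • p) x y := by
      funext x y
      simp [formOn_parabola]
      ring
    rw [e]
    exact border_eq_zero_of_finrank_le (hf _ z hz0 hz (by simp [hqz, hpz])) c d x y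
  · refine apply_eq_zero_of_line h.symm hq.2 (fun c d x y => ?_) hx hv
    rw [← aeval_borderPoly, vanSub_eq_bot hq hmax hT (hD c d x y), map_zero]

include h in
theorem false : False := by
  obtain ⟨q, T, hT⟩ := h.exists_extremal
  exact hT.false

end QuadricCone

end Extremal

section Polar

open MvPolynomial

variable {m k : ℕ}

theorem pderiv_pderiv_comm (i j : Fin m) (Q : MvPolynomial (Fin m) ℂ) :
    pderiv i (pderiv j Q) = pderiv j (pderiv i Q) := by
  induction Q using MvPolynomial.induction_on with
  | C a => simp
  | add p q hp hq => simp [hp, hq]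
  | mul_X p l hp =>
    simp only [Derivation.leibniz, map_add, pderiv_X, smul_eq_mul, hp, Pi.single_apply]
    split_ifs <;> simp <;> ring

/-- The matrix of second derivatives at the origin. -/
def hessian (Q : MvPolynomial (Fin m) ℂ) : Matrix (Fin m) (Fin m) ℂ :=
  Matrix.of fun i j => eval 0 (pderiv i (pderiv j Q))

theorem eval_pderiv_of_isHomogeneous {Q : MvPolynomial (Fin m) ℂ} (hQ : Q.IsHomogeneous 2)
    (v : Fin m → ℂ) (j : Fin m) : eval v (pderiv j Q) = ∑ i, v i * hessian Q i j := by
  have h1 : (pderiv j Q).IsHomogeneous 1 := hQ.pderiv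
  have h2 := congrArg (eval v) h1.sum_X_mul_pderiv
  rw [one_smul] at h2
  rw [← h2, map_sum]
  refine Finset.sum_congr rfl fun i _ => ?_
  have h3 : (pderiv i (pderiv j Q)).IsHomogeneous 0 := h1.pderiv
  rw [← totalDegree_zero_iff_isHomogeneous, totalDegree_eq_zero_iff_eq_C] at h3
  rw [map_mul, eval_X, hessian, Matrix.of_apply, h3]
  simp

/-- The symmetric bilinear form `v, w ↦ dQ_v(w)` of a quadratic form. -/
def polarForm (Q : MvPolynomial (Fin m) ℂ) : (Fin m → ℂ) →ₗ[ℂ] (Fin m → ℂ) →ₗ[ℂ] ℂ :=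
  Matrix.toLinearMap₂' ℂ (hessian Q)

theorem polarForm_comm (Q : MvPolynomial (Fin m) ℂ) (v w : Fin m → ℂ) :
    polarForm Q v w = polarForm Q w v := by
  simp only [polarForm, Matrix.toLinearMap₂'_apply, smul_eq_mul]
  rw [Finset.sum_comm]
  refine Finset.sum_congr rfl fun i _ => Finset.sum_congr rfl fun j _ => ?_
  rw [show hessian Q j i = hessian Q i j by simp [hessian, pderiv_pderiv_comm i j]]
  ring

theorem polarForm_eq {Q : MvPolynomial (Fin m) ℂ} (hQ : Q.IsHomogeneous 2) (v : Fin m → ℂ) :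
    polarForm Q v = PaperQV.polyDiff Q v := by
  refine LinearMap.ext fun w => ?_
  simp only [polyDiff_apply, eval_pderiv_of_isHomogeneous hQ, polarForm,
    Matrix.toLinearMap₂'_apply, smul_eq_mul, Finset.sum_mul]
  rw [Finset.sum_comm]
  exact Finset.sum_congr rfl fun i _ => Finset.sum_congr rfl fun j _ => by ring

theorem polarForm_self {Q : MvPolynomial (Fin m) ℂ} (hQ : Q.IsHomogeneous 2) (v : Fin m → ℂ) :
    polarForm Q v v = 2 * eval v Q := by
  have h := congrArg (eval v) hQ.sum_X_mul_pderiv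
  rw [polarForm_eq hQ, polyDiff_apply]
  simp only [map_sum, map_mul, eval_X, nsmul_eq_mul, Nat.cast_ofNat, map_ofNat] at h
  rw [← h]
  exact Finset.sum_congr rfl fun i _ => by ring

/-- The linear system of bilinear forms spanned by a family of quadratic forms. -/
def polarSystem (Q : Fin k → MvPolynomial (Fin m) ℂ) :
    (Fin k → ℂ) →ₗ[ℂ] (Fin m → ℂ) →ₗ[ℂ] (Fin m → ℂ) →ₗ[ℂ] ℂ :=
  Fintype.linearCombination ℂ fun i => polarForm (Q i)

theorem polarSystem_apply (Q : Fin k → MvPolynomial (Fin m) ℂ) (p : Fin k → ℂ)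
    (v w : Fin m → ℂ) : polarSystem Q p v w = ∑ i, p i * polarForm (Q i) v w := by
  simp [polarSystem, Fintype.linearCombination_apply]

theorem polarSystem_single (Q : Fin k → MvPolynomial (Fin m) ℂ) (i : Fin k) (v w : Fin m → ℂ) :
    polarSystem Q (Pi.single i 1) v w = polarForm (Q i) v w := by
  simp [polarSystem_apply, Pi.single_apply]

theorem onCone_polarSystem {Q : Fin k → MvPolynomial (Fin m) ℂ}
    (hQ : ∀ i, (Q i).IsHomogeneous 2) {v : Fin m → ℂ} :
    OnCone (polarSystem Q) v ↔ ∀ i, eval v (Q i) = 0 := by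
  refine ⟨fun h i => ?_, fun h p => ?_⟩
  · have := h (Pi.single i 1)
    rw [polarSystem_single, polarForm_self (hQ i)] at this
    simpa using this
  · rw [polarSystem_apply]
    exact Finset.sum_eq_zero fun i _ => by rw [polarForm_self (hQ i), h i, mul_zero, mul_zero]

theorem onCone_smul {A V : Type*} [AddCommGroup A] [Module ℂ A] [FiniteDimensional ℂ A]
    [AddCommGroup V] [Module ℂ V] [FiniteDimensional ℂ V]
    {S : A →ₗ[ℂ] V →ₗ[ℂ] V →ₗ[ℂ] ℂ} {v : V} (h : OnCone S v) (c : ℂ) : OnCone S (c • v) := by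
  intro p
  simp [h p]

theorem PolyFun.exists_mvPolynomial {f : (Fin m → ℂ) → ℂ} (hf : PolyFun f) :
    ∃ F : MvPolynomial (Fin m) ℂ, ∀ v, f v = MvPolynomial.eval v F :=
  hf m LinearMap.id

theorem polarSystem_injective {Q : Fin k → MvPolynomial (Fin m) ℂ}
    (hQ : ∀ i, (Q i).IsHomogeneous 2) (hli : LinearIndependent ℂ Q) (p : Fin k → ℂ)
    (hp : polarSystem Q p = 0) : p = 0 := by
  refine funext (Fintype.linearIndependent_iff.1 hli p (MvPolynomial.funext fun v => ?_))
  have h : polarSystem Q p v v = 0 := by rw [hp]; rfl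
  rw [polarSystem_apply] at h
  simp only [polarForm_self (hQ _)] at h
  have h2 : (2 : ℂ) * ∑ i, p i * eval v (Q i) = 0 := by
    rw [← h, Finset.mul_sum]
    exact Finset.sum_congr rfl fun i _ => by ring
  rw [map_zero, map_sum]
  simpa [smul_eval] using h2

end Polar

section Projective

open MvPolynomial PaperQV

variable {m k n : ℕ} {X : Set (PS m)} {Q : Fin k → MvPolynomial (Fin m) ℂ}

theorem mem_iff_onCone_rep (hQ : ∀ i, (Q i).IsHomogeneous 2) (hX : SchemeCutOutBy X Q) (x : PS m) :
    x ∈ X ↔ OnCone (polarSystem Q) x.rep := by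
  rw [hX.1, Set.mem_ofPred_eq]
  refine ⟨fun h => (onCone_polarSystem hQ).2 fun i => h i _ ?_, fun h i v hv => ?_⟩
  · rw [Projectivization.submodule_eq]
    exact Submodule.mem_span_singleton_self _
  · rw [Projectivization.submodule_eq] at hv
    obtain ⟨c, rfl⟩ := Submodule.mem_span_singleton.1 hv
    exact (onCone_polarSystem hQ).1 (onCone_smul h c) i

theorem onCone_of_mem (hQ : ∀ i, (Q i).IsHomogeneous 2) (hX : SchemeCutOutBy X Q) {x : PS m}
    (hx : x ∈ X) {v : Fin m → ℂ} (hv : v ∈ x.submodule) : OnCone (polarSystem Q) v := by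
  rw [hX.1] at hx
  exact (onCone_polarSystem hQ).2 fun i => hx i v hv

theorem exists_rep_of_onCone (hQ : ∀ i, (Q i).IsHomogeneous 2) (hX : SchemeCutOutBy X Q)
    {z : Fin m → ℂ} (hz0 : z ≠ 0) (hz : OnCone (polarSystem Q) z) :
    ∃ x ∈ X, ∃ a : ℂ, a ≠ 0 ∧ a • z = x.rep ∧ z ∈ x.submodule := by
  obtain ⟨a, ha⟩ := Projectivization.exists_smul_eq_mk_rep ℂ z hz0
  refine ⟨Projectivization.mk ℂ z hz0, ?_, a, a.ne_zero, ha, ?_⟩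
  · rw [mem_iff_onCone_rep hQ hX, ← ha]
    exact onCone_smul hz _
  · rw [Projectivization.submodule_mk]
    exact Submodule.mem_span_singleton_self _

theorem mem_tangentSubmodule (hQ : ∀ i, (Q i).IsHomogeneous 2) (hX : SchemeCutOutBy X Q)
    {x : PS m} (hx : x ∈ X) {v : Fin m → ℂ} :
    v ∈ tangentSubmodule X x ↔ ∀ p, polarSystem Q p x.rep v = 0 := by
  have hi : v ∈ ⨅ i, LinearMap.ker (polyDiff (Q i) x.rep) ↔
      ∀ p, polarSystem Q p x.rep v = 0 := by
    simp only [Submodule.mem_iInf, LinearMap.mem_ker]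
    refine ⟨fun h p => ?_, fun h i => ?_⟩
    · rw [polarSystem_apply]
      exact Finset.sum_eq_zero fun i _ => by rw [polarForm_eq (hQ i), h i, mul_zero]
    · rw [← polarForm_eq (hQ i), ← polarSystem_single, h]
  rw [← hi]
  constructor
  · intro h
    simp only [tangentSubmodule, Submodule.mem_iInf] at h ⊢
    refine fun i => h (Q i) fun y hy => ?_
    rw [hX.1] at hy
    exact hy i
  · intro h
    simp only [tangentSubmodule, Submodule.mem_iInf]
    exact fun p hp => hX.2 x hx p hp h

theorem finrank_orb_polarSystem (hQ : ∀ i, (Q i).IsHomogeneous 2) (hX : SchemeCutOutBy X Q)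
    {x : PS m} (hx : x ∈ X) {z : Fin m → ℂ} {a : ℂ} (ha : a ≠ 0) (haz : a • z = x.rep) :
    Module.finrank ℂ (orb (polarSystem Q) z) + Module.finrank ℂ (tangentSubmodule X x) = m := by
  have h := Subspace.finrank_add_finrank_dualCoannihilator_eq
    (orb (polarSystem Q) z : Subspace ℂ (Module.Dual ℂ (Fin m → ℂ)))
  rw [Module.finrank_fin_fun] at h
  suffices e : tangentSubmodule X x = Submodule.dualCoannihilator
      (R := ℂ) (M := Fin m → ℂ) (orb (polarSystem Q) z) by rw [e]; exact h
  ext v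
  rw [mem_tangentSubmodule hQ hX hx, Submodule.mem_dualCoannihilator]
  rw [← haz]
  refine ⟨?_, fun hv p => ?_⟩
  · rintro hv _ ⟨p, rfl⟩
    simpa [ha] using hv p
  · have := hv (polarSystem Q p z) ⟨p, rfl⟩
    rw [map_smul, LinearMap.smul_apply, this, smul_zero]

theorem derivative_eq_zero_of_tangent (hQ : ∀ i, (Q i).IsHomogeneous 2)
    (hX : SchemeCutOutBy X Q) {f : (Fin m → ℂ) → ℂ} (hf : PolyFun f)
    (hfv : ∀ v, OnCone (polarSystem Q) v → f v = 0) {z : Fin m → ℂ} (hz0 : z ≠ 0)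
    (hz : OnCone (polarSystem Q) z) {v : Fin m → ℂ} (hv : ∀ p, polarSystem Q p z v = 0)
    {l : Polynomial ℂ} (hl : ∀ t, f (z + t • v) = l.eval t) : l.derivative.eval 0 = 0 := by
  obtain ⟨x, hx, a, ha, haz, -⟩ := exists_rep_of_onCone hQ hX hz0 hz
  obtain ⟨F, hF⟩ := (hf.comp_linear (a⁻¹ • LinearMap.id)).exists_mvPolynomial
  have hav : a • v ∈ tangentSubmodule X x := by
    rw [mem_tangentSubmodule hQ hX hx, ← haz]
    intro p
    simp [hv p]
  have hd : polyDiff F x.rep (a • v) = 0 := by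
    simp only [tangentSubmodule, Submodule.mem_iInf] at hav
    refine hav F fun y hy w hw => ?_
    rw [← hF]
    exact hfv _ (onCone_smul (onCone_of_mem hQ hX hy hw) _)
  let γ : Fin m → Polynomial ℂ := fun j =>
    Polynomial.C (x.rep j) + Polynomial.C ((a • v) j) * Polynomial.X
  obtain ⟨r, hr⟩ := aeval_first_order x.rep (a • v) γ (fun j => by simp [γ]) F
  have hlF : MvPolynomial.aeval γ F = l := by
    refine Polynomial.funext fun t => ?_
    have e : (Polynomial.aeval t).comp (MvPolynomial.aeval γ) =
        (MvPolynomial.aeval (x.rep + t • a • v) : MvPolynomial (Fin m) ℂ →ₐ[ℂ] ℂ) := by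
      ext j
      simp [γ]
      ring
    have e' := AlgHom.congr_fun e F
    rw [AlgHom.comp_apply, Polynomial.coe_aeval_eq_eval] at e'
    rw [e', ← hl]
    change eval _ F = _
    rw [← hF, ← haz]
    congr 1
    simp only [LinearMap.smul_apply, LinearMap.id_apply, smul_add, smul_smul, smul_comm t a]
    simp [ha]
  rw [hlF, hd] at hr
  have : l = Polynomial.C (eval x.rep F) + Polynomial.X ^ 2 * r := by
    linear_combination hr + Polynomial.X * (map_zero Polynomial.C : Polynomial.C (0 : ℂ) = 0)
  rw [this]
  simp

theorem polyFun_irreducible (hQ : ∀ i, (Q i).IsHomogeneous 2) (hX : SchemeCutOutBy X Q)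
    (hirr : ZIrreducible X) {f g : (Fin m → ℂ) → ℂ} (hf : PolyFun f) (hg : PolyFun g)
    (hfg : ∀ v, OnCone (polarSystem Q) v → f v * g v = 0) :
    (∀ v, OnCone (polarSystem Q) v → f v = 0) ∨ ∀ v, OnCone (polarSystem Q) v → g v = 0 := by
  have main : ∀ {f : (Fin m → ℂ) → ℂ} {F : MvPolynomial (Fin m) ℂ}, (∀ v, f v = eval v F) →
      X ⊆ ZeroLocus {F} → ∀ v, OnCone (polarSystem Q) v → f v = 0 := by
    intro f F hF h v hv
    rw [hF]
    rcases eq_or_ne v 0 with rfl | hv0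
    · obtain ⟨x, hx⟩ := hirr.1
      exact h hx F rfl 0 (Submodule.zero_mem _)
    · obtain ⟨x, hx, -, -, -, hvx⟩ := exists_rep_of_onCone hQ hX hv0 hv
      exact h hx F rfl v hvx
  obtain ⟨F, hF⟩ := hf.exists_mvPolynomial
  obtain ⟨G, hG⟩ := hg.exists_mvPolynomial
  refine (hirr.2 (ZeroLocus {F}) (ZeroLocus {G}) ⟨_, rfl⟩ ⟨_, rfl⟩ fun x hx => ?_).imp
    (main hF) (main hG)
  obtain ⟨a, ha⟩ := hf.line 0 x.rep
  obtain ⟨b, hb⟩ := hg.line 0 x.rep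
  have hab : a * b = 0 := by
    refine Polynomial.funext fun t => ?_
    rw [Polynomial.eval_mul, ← ha, ← hb, hfg _ ?_, Polynomial.eval_zero]
    rw [zero_add]
    exact onCone_smul ((mem_iff_onCone_rep hQ hX x).1 hx) t
  have key : ∀ {f : (Fin m → ℂ) → ℂ} {F : MvPolynomial (Fin m) ℂ} {a : Polynomial ℂ},
      (∀ v, f v = eval v F) → (∀ t, f (0 + t • x.rep) = a.eval t) → a = 0 →
      x ∈ ZeroLocus {F} := by
    rintro f F a hF ha rfl _ rfl v hv
    rw [Projectivization.submodule_eq] at hv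
    obtain ⟨c, rfl⟩ := Submodule.mem_span_singleton.1 hv
    rw [← hF, ← zero_add (c • x.rep), ha, Polynomial.eval_zero]
  exact (mul_eq_zero.1 hab).imp (key hF ha) (key hG hb)

/-- The quadrics through a smooth nondegenerate quadratic variety of dimension seven in
projective eleven-space that is not a complete intersection. -/
theorem quadricCone_polarSystem {X : Set (PS 12)} {Q : Fin k → MvPolynomial (Fin 12) ℂ}
    (hQ : ∀ i, (Q i).IsHomogeneous 2) (hli : LinearIndependent ℂ Q) (hX : SchemeCutOutBy X Q)
    (hsm : SmoothVariety X 7) (hnd : Nondegenerate X) (hci : ¬ IsCompleteIntersection X 7) :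
    QuadricCone (polarSystem Q) := by
  have hrank : ∀ z, z ≠ 0 → OnCone (polarSystem Q) z →
      Module.finrank ℂ (orb (polarSystem Q) z) = 4 := by
    intro z hz0 hz
    obtain ⟨x, hx, a, ha, haz, -⟩ := exists_rep_of_onCone hQ hX hz0 hz
    have h1 := finrank_orb_polarSystem hQ hX hx ha haz
    have h2 := hsm.2.2.2 x hx
    omega
  refine
    { symm := fun p v w => ?_
      dimV := Module.finrank_fin_fun ℂ
      dimA := ?_
      inj := polarSystem_injective hQ hli
      rank := hrank
      irr := fun f g hf hg => polyFun_irreducible hQ hX hsm.2.1 hf hg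
      nondeg := fun φ hφ => hnd φ fun x hx v hv => hφ v (onCone_of_mem hQ hX hx hv)
      tangent := fun f hf hfv z hz0 hz v hv l hl =>
        derivative_eq_zero_of_tangent hQ hX hf hfv hz0 hz hv hl }
  · simp only [polarSystem_apply, polarForm_comm _ v w]
  · obtain ⟨x, hx⟩ := hsm.2.1.1
    have h1 := hrank x.rep x.rep_nonzero ((mem_iff_onCone_rep hQ hX x).1 hx)
    have h2 : Module.finrank ℂ (orb (polarSystem Q) x.rep) ≤ Module.finrank ℂ (Fin k → ℂ) :=
      LinearMap.finrank_range_le _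
    rw [Module.finrank_fin_fun] at h2 ⊢
    by_contra hk
    obtain rfl : k = 4 := by omega
    exact hci ⟨Q, fun _ => 2, hQ, fun _ => by norm_num, hX⟩

end Projective

/-- For a quadratic, non-complete-intersection `X` with `n = 2c - 1`, `c ≥ 3`
and `c` even, one has `c ≠ 4`. -/
theorem even_case_c_ne_four (n c : ℕ) (hc : 3 ≤ c) (hceven : Even c)
    (hn : n + 1 = 2 * c)
    (X : Set (PS (n + c + 1)))
    (hsm : SmoothVariety X n) (hnd : Nondegenerate X) (hq : IsQuadratic X)
    (hci : ¬ IsCompleteIntersection X n) :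
    c ≠ 4 := by
  rintro rfl
  obtain rfl : n = 7 := by omega
  obtain ⟨k, Q, hQ, hli, hX⟩ := hq
  exact (quadricCone_polarSystem hQ hli hX hsm hnd hci).false
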